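/- arXiv:1904.04171 — 4 statements merged into one kernel-verified Lean document; each statement's English description precedes it below -/
import Mathlib

section
/- Let $X, Y$ be Polish spaces, $c : X \times Y \to \mathbb{R}$ measurable, $C(x,p) := \int_Y c(x,y)\,p(dy)$, and $\pi \in \Pi(\mu,\nu)$ with $c \in L^1(\pi)$. If $\pi$ is $C$-monotone and $A \subset X \times Y$ is Borel measurable with $\pi(A) > 0$, then the normalized restriction $\pi|_A / \pi(A)$ is also $C$-monotone. -/
open MeasureTheory Filter Topology

noncomputable section

def IsCoupling {X Y : Type*} [MeasurableSpace X] [MeasurableSpace Y]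
    (π : Measure (X × Y)) (μ : Measure X) (ν : Measure Y) : Prop :=
  π.map Prod.fst = μ ∧ π.map Prod.snd = ν

/-- `C`-monotonicity of a coupling given by first marginal `μ` and disintegration
kernel `κ`: there is a `μ`-full set `Γ` such that for all finitely many `x_i ∈ Γ`
and competitor probability measures `q_i` with `∑ κ(x_i) = ∑ q_i`, the `C`-cost of
the `κ(x_i)` does not exceed that of the `q_i`. -/
def CMonotoneKernel {X Y : Type*} [MeasurableSpace X] [MeasurableSpace Y]
    (C : X → Measure Y → ℝ) (μ : Measure X) (κ : X → Measure Y) : Prop :=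
  ∃ Γ : Set X, MeasurableSet Γ ∧ μ Γᶜ = 0 ∧
    ∀ (N : ℕ) (x : Fin N → X) (q : Fin N → Measure Y),
      (∀ i, x i ∈ Γ) → (∀ i, IsProbabilityMeasure (q i)) →
      (∑ i, κ (x i)) = (∑ i, q i) →
      (∑ i, C (x i) (κ (x i))) ≤ ∑ i, C (x i) (q i)

open ProbabilityTheory
open scoped ENNReal

/-- The first marginal of `π.restrict A` has density `x ↦ π.condKernel x {y | (x, y) ∈ A}`. -/
lemma fst_restrict_eq_withDensity {X Y : Type*} [MeasurableSpace X] [MeasurableSpace Y]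
    [StandardBorelSpace Y] [Nonempty Y] (π : Measure (X × Y)) [IsFiniteMeasure π]
    {A : Set (X × Y)} (hA : MeasurableSet A) :
    (π.restrict A).fst = π.fst.withDensity fun x => π.condKernel x (Prod.mk x ⁻¹' A) := by
  ext s hs
  rw [Measure.fst_apply hs, Measure.restrict_apply (measurable_fst hs), withDensity_apply _ hs]
  conv_lhs => rw [← π.disintegrate π.condKernel]
  rw [Measure.compProd_apply ((measurable_fst hs).inter hA), ← lintegral_indicator hs]
  congr with x
  by_cases hx : x ∈ s <;> simp [hx, Set.preimage_inter, Set.preimage_preimage]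

/-- The disintegration of `π.restrict A` is that of `π`, restricted to the sections of `A`, up to
normalization. -/
lemma smul_condKernel_restrict_ae_eq {X Y : Type*} [MeasurableSpace X] [MeasurableSpace Y]
    [StandardBorelSpace Y] [Nonempty Y] (π : Measure (X × Y)) [IsFiniteMeasure π]
    {A : Set (X × Y)} (hA : MeasurableSet A) :
    ∀ᵐ x ∂π.fst, π.condKernel x (Prod.mk x ⁻¹' A) • (π.restrict A).condKernel x =
      (π.condKernel x).restrict (Prod.mk x ⁻¹' A) := by
  set κ := π.condKernel
  set κA := (π.restrict A).condKernel
  have hh : Measurable fun x => κ x (Prod.mk x ⁻¹' A) := Kernel.measurable_kernel_prodMk_left hA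
  have hf : Measurable (Function.uncurry fun (x : X) (_ : Y) => κ x (Prod.mk x ⁻¹' A)) :=
    hh.comp measurable_fst
  have hg : Measurable (Function.uncurry fun (x : X) (y : Y) =>
      A.indicator (1 : X × Y → ℝ≥0∞) (x, y)) := measurable_one.indicator hA
  have : IsFiniteKernel (κA.withDensity fun x _ => κ x (Prod.mk x ⁻¹' A)) :=
    Kernel.isFiniteKernel_withDensity_of_bounded κA ENNReal.one_ne_top fun _ _ => prob_le_one
  have : IsFiniteKernel (κ.withDensity fun x y => A.indicator (1 : X × Y → ℝ≥0∞) (x, y)) :=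
    Kernel.isFiniteKernel_withDensity_of_bounded κ ENNReal.one_ne_top
      fun _ _ => Set.indicator_le_self _ _ _
  have heq : π.fst ⊗ₘ (κA.withDensity fun x _ => κ x (Prod.mk x ⁻¹' A)) =
      π.fst ⊗ₘ (κ.withDensity fun x y => A.indicator (1 : X × Y → ℝ≥0∞) (x, y)) := by
    rw [Measure.compProd_withDensity hg, π.disintegrate π.condKernel]
    trans π.restrict A
    · conv_rhs => rw [← (π.restrict A).disintegrate (π.restrict A).condKernel]
      ext s hs
      rw [Measure.compProd_apply hs, Measure.compProd_apply hs, fst_restrict_eq_withDensity π hA,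
        lintegral_withDensity_eq_lintegral_mul _ hh (Kernel.measurable_kernel_prodMk_left hs)]
      congr with x
      simp [Kernel.withDensity_apply _ hf, withDensity_const, κA, κ]
    · exact (withDensity_indicator_one hA).symm
  filter_upwards [Kernel.ae_eq_of_compProd_eq heq] with x hx
  rw [Kernel.withDensity_apply _ hf, Kernel.withDensity_apply _ hg, withDensity_const] at hx
  rw [hx]
  exact withDensity_indicator_one (measurable_prodMk_left hA)

/-- At almost every point, the disintegration of `π.restrict A` is dominated by a multiple of the
disintegration of `π`. -/
lemma exists_condKernel_restrict_le_nsmul {X Y : Type*} [MeasurableSpace X] [MeasurableSpace Y]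
    [StandardBorelSpace Y] [Nonempty Y] (π : Measure (X × Y)) [IsFiniteMeasure π]
    {A : Set (X × Y)} (hA : MeasurableSet A) :
    ∀ᵐ x ∂(π.restrict A).fst, ∃ m : ℕ, (π.restrict A).condKernel x ≤ m • π.condKernel x := by
  have hh : Measurable fun x => π.condKernel x (Prod.mk x ⁻¹' A) :=
    Kernel.measurable_kernel_prodMk_left hA
  rw [fst_restrict_eq_withDensity π hA, ae_withDensity_iff hh]
  filter_upwards [smul_condKernel_restrict_ae_eq π hA] with x hx hx0
  obtain ⟨m, hm⟩ := ENNReal.exists_nat_gt (ENNReal.inv_ne_top.2 hx0)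
  refine ⟨m, ?_⟩
  calc (π.restrict A).condKernel x
      = (π.condKernel x (Prod.mk x ⁻¹' A))⁻¹ •
          (π.condKernel x).restrict (Prod.mk x ⁻¹' A) := by
        rw [← hx, smul_smul, ENNReal.inv_mul_cancel hx0 (measure_ne_top _ _), one_smul]
    _ ≤ (m : ℝ≥0∞) • π.condKernel x := by
        gcongr
        exact Measure.restrict_le_self
    _ = m • π.condKernel x := Nat.cast_smul_eq_nsmul ..

/-- If `p ≤ m • k` for probability measures, a copy of `p` can be completed to `m + 1` copies of
`k` by `m` copies of a probability measure. -/
lemma exists_isProbabilityMeasure_add_nsmul_eq {Y : Type*} [MeasurableSpace Y] {k p : Measure Y}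
    [IsProbabilityMeasure k] [IsProbabilityMeasure p] {m : ℕ} (hm : m ≠ 0)
    (h : p ≤ (m + 1) • k) :
    ∃ r : Measure Y, IsProbabilityMeasure r ∧ p + m • r = (m + 1) • k := by
  have hm0 : (m : ℝ≥0∞) ≠ 0 := by exact_mod_cast hm
  have hr : m • ((m : ℝ≥0∞)⁻¹ • ((m + 1) • k - p)) = (m + 1) • k - p := by
    rw [← Nat.cast_smul_eq_nsmul ℝ≥0∞, smul_smul,
      ENNReal.mul_inv_cancel hm0 (ENNReal.natCast_ne_top m), one_smul]
  refine ⟨(m : ℝ≥0∞)⁻¹ • ((m + 1) • k - p), ⟨?_⟩, ?_⟩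
  · rw [Measure.smul_apply, Measure.sub_apply .univ h, Measure.smul_apply, measure_univ,
      measure_univ, smul_eq_mul, nsmul_eq_mul, Nat.cast_add, Nat.cast_one, mul_one,
      ENNReal.add_sub_cancel_right ENNReal.one_ne_top,
      ENNReal.inv_mul_cancel hm0 (ENNReal.natCast_ne_top m)]
  · rw [hr, add_comm, Measure.sub_add_cancel_of_le h]

/-- Pointwise form of the stability of optimality under passing to dominated measures: if the
`k i` are optimal even when repeated, then so are measures `p i` dominated by multiples of them. -/
lemma sum_integral_le_of_le_nsmul {ι Y : Type*} [Fintype ι] [MeasurableSpace Y]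
    {f : ι → Y → ℝ} {k p q : ι → Measure Y}
    [∀ i, IsProbabilityMeasure (k i)] [∀ i, IsProbabilityMeasure (p i)]
    [∀ i, IsProbabilityMeasure (q i)]
    (hf : ∀ i, Integrable (f i) (k i)) {m : ι → ℕ} (hle : ∀ i, p i ≤ m i • k i)
    (hopt : ∀ (n : ℕ) (r : ι × Fin n → Measure Y), (∀ j, IsProbabilityMeasure (r j)) →
      ∑ j : ι × Fin n, k j.1 = ∑ j, r j →
      ∑ j : ι × Fin n, ∫ y, f j.1 y ∂k j.1 ≤ ∑ j, ∫ y, f j.1 y ∂r j)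
    (hpq : ∑ i, p i = ∑ i, q i) :
    ∑ i, ∫ y, f i y ∂p i ≤ ∑ i, ∫ y, f i y ∂q i := by
  obtain ⟨n, hn0, hn⟩ : ∃ n : ℕ, n ≠ 0 ∧ ∀ i, m i ≤ n + 1 :=
    ⟨∑ i, m i + 1, by omega, fun i =>
      (Finset.single_le_sum (fun _ _ => Nat.zero_le _) (Finset.mem_univ i)).trans (by omega)⟩
  have hle' : ∀ i, p i ≤ (n + 1) • k i := fun i =>
    (hle i).trans (nsmul_le_nsmul_left (Measure.zero_le _) (hn i))
  choose r hr hrk using fun i => exists_isProbabilityMeasure_add_nsmul_eq hn0 (hle' i)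
  have hint : ∀ i, Integrable (f i) ((n + 1) • k i) := fun i => by
    rw [← Nat.cast_smul_eq_nsmul ℝ≥0∞]
    exact (hf i).smul_measure (ENNReal.natCast_ne_top _)
  have hcost : ∀ i, ∫ y, f i y ∂p i + n * ∫ y, f i y ∂r i = (n + 1) * ∫ y, f i y ∂k i := by
    intro i
    have h1 := hint i
    rw [← hrk i] at h1
    have h2 := integral_add_measure h1.left_of_add_measure h1.right_of_add_measure
    rw [hrk i, ← Nat.cast_smul_eq_nsmul ℝ≥0∞, ← Nat.cast_smul_eq_nsmul ℝ≥0∞,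
      integral_smul_measure, integral_smul_measure, ENNReal.toReal_natCast,
      ENNReal.toReal_natCast] at h2
    simpa using h2.symm
  have key := hopt (n + 1)
    (fun j => Fin.cons (α := fun _ => Measure Y) (q j.1) (fun _ => r j.1) j.2) ?_ ?_
  · simp only [Fintype.sum_prod_type, Fin.sum_univ_succ, Fin.cons_zero, Fin.cons_succ,
      Finset.sum_const, Finset.card_univ, Fintype.card_fin, nsmul_eq_mul,
      Finset.sum_add_distrib, Nat.cast_add, Nat.cast_one] at key
    have h3 := Finset.sum_congr rfl fun i (_ : i ∈ Finset.univ) => hcost i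
    simp only [Finset.sum_add_distrib] at h3
    linarith
  · rintro ⟨i, j⟩
    refine Fin.cases ?_ (fun _ => ?_) j
    · exact inferInstanceAs (IsProbabilityMeasure (q i))
    · exact hr i
  · simp only [Fintype.sum_prod_type]
    calc ∑ i, ∑ _ : Fin (n + 1), k i = ∑ i, (p i + n • r i) := by simp [hrk]
      _ = ∑ i, (q i + n • r i) := by rw [Finset.sum_add_distrib, hpq, Finset.sum_add_distrib]
      _ = _ := by simp [Fin.sum_univ_succ]

/-- **Restriction property of `C`-monotonicity** (Lemma 4.3): if `π ∈ Π(μ,ν)` is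
`C`-monotone for `C(x,p) = ∫ c(x,y) p(dy)` with `c ∈ L¹(π)`, and `A` is measurable
with `π(A) > 0`, then the normalized restriction `π|_A / π(A)` is also `C`-monotone. -/
theorem restriction_CMonotone {X Y : Type*}
    [MeasurableSpace X] [StandardBorelSpace X]
    [MeasurableSpace Y] [StandardBorelSpace Y] [Nonempty Y]
    (μ : Measure X) (ν : Measure Y)
    (c : X → Y → ℝ) (hc : Measurable (Function.uncurry c))
    (π : Measure (X × Y)) [IsProbabilityMeasure π]
    (hcoup : IsCoupling π μ ν)
    (hint : Integrable (fun z => c z.1 z.2) π)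
    (hmono : CMonotoneKernel (fun x p => ∫ y, c x y ∂p) μ (fun x => π.condKernel x))
    (A : Set (X × Y)) (hA : MeasurableSet A) (hpos : 0 < π A) :
    CMonotoneKernel (fun x p => ∫ y, c x y ∂p)
      (((π A)⁻¹ • π.restrict A).map Prod.fst)
      (fun x => (π.restrict A).condKernel x) := by
  obtain ⟨hfst, -⟩ := hcoup
  obtain ⟨Γ, hΓ, hΓμ, hΓmono⟩ := hmono
  have hmarg : ((π A)⁻¹ • π.restrict A).map Prod.fst = (π A)⁻¹ • (π.restrict A).fst :=
    Measure.map_smul ..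
  have hac : (π.restrict A).fst ≪ π.fst := Measure.restrict_le_self.absolutelyContinuous.map
    measurable_fst
  have hgood : ∀ᵐ x ∂(π.restrict A).fst, x ∈ Γ ∧ Integrable (c x) (π.condKernel x) ∧
      ∃ m : ℕ, (π.restrict A).condKernel x ≤ m • π.condKernel x := by
    have hΓ' : ∀ᵐ x ∂π.fst, x ∈ Γ := by rw [Measure.fst, hfst]; exact hΓμ
    filter_upwards [hac.ae_le hΓ', hac.ae_le hint.condKernel_ae,
      exists_condKernel_restrict_le_nsmul π hA] with x h₁ h₂ h₃ using ⟨h₁, h₂, h₃⟩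
  obtain ⟨T, hT, hTm, hT0⟩ := exists_measurable_superset_of_null (ae_iff.1 hgood)
  refine ⟨Tᶜ, hTm.compl, by simp [hmarg, hT0], fun N x q hx hq hsum => ?_⟩
  have hx' := fun i => not_not.1 fun h => hx i (hT h)
  choose m hm using fun i => (hx' i).2.2
  refine sum_integral_le_of_le_nsmul (fun i => (hx' i).2.1) hm (fun n r hr hkr => ?_) hsum
  have key := hΓmono (N * n) (fun j => x (finProdFinEquiv.symm j).1)
    (fun j => r (finProdFinEquiv.symm j)) (fun j => (hx' _).1) (fun j => hr _)
  rw [Equiv.sum_comp finProdFinEquiv.symm fun j => π.condKernel (x j.1),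
    Equiv.sum_comp finProdFinEquiv.symm r,
    Equiv.sum_comp finProdFinEquiv.symm fun j => ∫ y, c (x j.1) y ∂π.condKernel (x j.1),
    Equiv.sum_comp finProdFinEquiv.symm fun j => ∫ y, c (x j.1) y ∂r j] at key
  exact key hkr
end
end

section
/- Let $X$ be a Polish space and $\mathcal{M}_+(X)$ the space of finite Borel measures on $X$ with the topology of weak convergence. The map $T : \mathcal{M}_+(X)\times\mathcal{M}_+(X) \to \mathcal{M}_+(X)\times\mathcal{M}_+(X)$, $(p,q) \mapsto (q_{ac,p}, q_{s,p})$, assigning to $(p,q)$ the unique Lebesgue decomposition $q = q_{ac,p} + q_{s,p}$ with $q_{ac,p} \ll p$ and $q_{s,p} \perp p$, is Borel measurable. -/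
open MeasureTheory Filter Topology

noncomputable section

open scoped NNReal ENNReal BoundedContinuousFunction

lemma NNReal.tendsto_of_le_liminf_of_tendsto_add {ι : Type*} {L : Filter ι} {a b : ι → ℝ≥0}
    {x y : ℝ≥0} (ha : (x : ℝ≥0∞) ≤ liminf (fun i ↦ (a i : ℝ≥0∞)) L)
    (hb : (y : ℝ≥0∞) ≤ liminf (fun i ↦ (b i : ℝ≥0∞)) L)
    (hab : Tendsto (fun i ↦ a i + b i) L (𝓝 (x + y))) : Tendsto a L (𝓝 x) := by
  have eventually_lt {c : ι → ℝ≥0} {z : ℝ≥0} (hc : (z : ℝ≥0∞) ≤ liminf (fun i ↦ (c i : ℝ≥0∞)) L)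
      {r : ℝ} (hr : r < z) : ∀ᶠ i in L, r < c i := by
    rcases lt_or_ge r 0 with h0 | h0
    · exact Eventually.of_forall fun i ↦ h0.trans_le (c i).2
    · lift r to ℝ≥0 using h0
      have hr' : (r : ℝ≥0∞) < z := by exact_mod_cast hr
      filter_upwards [eventually_lt_of_lt_liminf (hr'.trans_le hc)] with i hi
      exact_mod_cast hi
  rw [← NNReal.tendsto_coe] at hab ⊢
  push_cast at hab
  refine tendsto_order.2 ⟨fun r hr ↦ eventually_lt ha hr, fun r hr ↦ ?_⟩
  have hy : (y : ℝ) - (r - x) / 2 < y := by linarith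
  have hxy : (x : ℝ) + y < x + y + (r - x) / 2 := by linarith
  filter_upwards [eventually_lt hb hy, (tendsto_order.1 hab).2 _ hxy] with i h1 h2
  linarith

namespace MeasureTheory.FiniteMeasure

variable {X : Type*} [MeasurableSpace X] [TopologicalSpace X]

/-- Portmanteau for sequences of finite measures: if the masses converge and the liminf on every
open set dominates the limit measure, then the sequence converges weakly. -/
lemma tendsto_of_forall_isOpen_le_liminf_of_tendsto_mass [OpensMeasurableSpace X]
    {μs : ℕ → FiniteMeasure X} {μ : FiniteMeasure X}
    (h_opens : ∀ G, IsOpen G →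
      (μ : Measure X) G ≤ liminf (fun n ↦ (μs n : Measure X) G) atTop)
    (h_mass : Tendsto (fun n ↦ (μs n).mass) atTop (𝓝 μ.mass)) :
    Tendsto μs atTop (𝓝 μ) := by
  have le_liminf (f : X →ᵇ ℝ≥0) : (μ.testAgainstNN f : ℝ≥0∞) ≤
      liminf (fun n ↦ ((μs n).testAgainstNN f : ℝ≥0∞)) atTop := by
    have := lintegral_le_liminf_lintegral_of_forall_isOpen_measure_le_liminf_measure
      (f := fun x ↦ (f x : ℝ)) (NNReal.continuous_coe.comp f.continuous) (fun x ↦ (f x).2) h_opens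
    simpa only [testAgainstNN_coe_eq, ENNReal.ofReal_coe_nnreal] using this
  rw [tendsto_iff_forall_testAgainstNN_tendsto]
  intro f
  set c := nndist f 0
  let g : X →ᵇ ℝ≥0 := BoundedContinuousFunction.const X c - f
  have hfg : f + g = BoundedContinuousFunction.const X c := by
    ext x
    have : f x ≤ c := BoundedContinuousFunction.NNReal.upper_bound f x
    simp [g, this]
  refine NNReal.tendsto_of_le_liminf_of_tendsto_add (le_liminf f) (le_liminf g) ?_
  simp_rw [← testAgainstNN_add, hfg, testAgainstNN_const]
  exact h_mass.const_mul c

lemma measurable_toMeasure_borel [TopologicalSpace.PseudoMetrizableSpace X] [BorelSpace X] :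
    Measurable[borel (FiniteMeasure X)] (fun μ : FiniteMeasure X ↦ (μ : Measure X)) := by
  let : MeasurableSpace (FiniteMeasure X) := borel (FiniteMeasure X)
  have : BorelSpace (FiniteMeasure X) := ⟨rfl⟩
  refine Measurable.measure_of_isPiSystem (S := {F | IsClosed F})
    (by rw [← borel_eq_generateFrom_isClosed]; exact BorelSpace.measurable_eq)
    (fun _ hs _ ht _ ↦ hs.inter ht) (fun F hF ↦ ?_) ?_
  · refine measurable_of_tendsto_metrizable (f := fun n (μ : FiniteMeasure X) ↦
      ∫⁻ x, (IsClosed.apprSeq hF n x : ℝ≥0∞) ∂(μ : Measure X)) (fun n ↦ ?_) ?_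
    · simp_rw [← testAgainstNN_coe_eq]
      exact (continuous_testAgainstNN_eval _).measurable.coe_nnreal_ennreal
    · exact tendsto_pi_nhds.2 fun μ ↦ HasOuterApproxClosed.tendsto_lintegral_apprSeq hF μ
  · simp_rw [← ennreal_mass]
    exact continuous_mass.measurable.coe_nnreal_ennreal

/-- The total mass, together with the measures of the finite unions of elements of the countable
basis of the space. -/
def massAndBasisMeasures [SecondCountableTopology X] (μ : FiniteMeasure X) :
    ℝ≥0 × (Finset (TopologicalSpace.countableBasis X) → ℝ≥0∞) :=
  (μ.mass, fun s ↦ (μ : Measure X) (⋃ U ∈ s, U))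

lemma measurable_massAndBasisMeasures [SecondCountableTopology X] [OpensMeasurableSpace X] :
    Measurable (massAndBasisMeasures (X := X)) := by
  refine .prodMk ?_ (measurable_pi_lambda _ fun s ↦ ?_)
  · exact ((Measure.measurable_coe MeasurableSet.univ).comp measurable_subtype_coe).ennreal_toNNReal
  · refine (Measure.measurable_coe ?_).comp measurable_subtype_coe
    exact (isOpen_biUnion fun U _ ↦
      TopologicalSpace.isOpen_of_mem_countableBasis U.2).measurableSet

lemma tendsto_of_tendsto_massAndBasisMeasures [SecondCountableTopology X] [OpensMeasurableSpace X]
    {μs : ℕ → FiniteMeasure X} {μ : FiniteMeasure X}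
    (h : Tendsto (fun n ↦ massAndBasisMeasures (μs n)) atTop (𝓝 (massAndBasisMeasures μ))) :
    Tendsto μs atTop (𝓝 μ) := by
  obtain ⟨h_mass, h_basis⟩ := (Prod.tendsto_iff _ _).1 h
  refine tendsto_of_forall_isOpen_le_liminf_of_tendsto_mass (fun G hG ↦ ?_) h_mass
  rw [tendsto_pi_nhds] at h_basis
  obtain ⟨S, hS, rfl⟩ := (TopologicalSpace.isBasis_countableBasis X).open_eq_sUnion hG
  let T : Set (Finset (TopologicalSpace.countableBasis X)) := {s | ∀ U ∈ s, (U : Set X) ∈ S}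
  have subset_sUnion {s} (hs : s ∈ T) : (⋃ U ∈ s, (U : Set X)) ⊆ ⋃₀ S :=
    Set.iUnion₂_subset fun U hU ↦ Set.subset_sUnion_of_mem (hs U hU)
  have sUnion_eq : ⋃₀ S = ⋃ s ∈ T, ⋃ U ∈ s, (U : Set X) := by
    refine (Set.sUnion_subset fun U hU ↦ ?_).antisymm (Set.iUnion₂_subset fun s ↦ subset_sUnion)
    refine Set.Subset.trans ?_ (Set.subset_biUnion_of_mem
      (show ({⟨U, hS hU⟩} : Finset _) ∈ T from
        fun V hV ↦ Finset.mem_singleton.1 hV ▸ hU))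
    simp
  classical
  have directed : DirectedOn (Function.onFun (· ⊆ ·)
      fun s : Finset (TopologicalSpace.countableBasis X) ↦ ⋃ U ∈ s, (U : Set X)) T := by
    refine fun s hs t ht ↦ ⟨s ∪ t, fun U hU ↦ ?_, ?_, ?_⟩
    · exact (Finset.mem_union.1 hU).elim (hs U) (ht U)
    · exact Set.biUnion_subset_biUnion_left fun U hU ↦ Finset.mem_union_left t hU
    · exact Set.biUnion_subset_biUnion_left fun U hU ↦ Finset.mem_union_right s hU
  conv_lhs => rw [sUnion_eq, measure_biUnion_eq_iSup T.to_countable directed]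
  refine iSup₂_le fun s hs ↦ ?_
  exact (h_basis s).liminf_eq.symm.trans_le <|
    liminf_le_liminf (Eventually.of_forall fun n ↦ measure_mono (subset_sUnion hs))

/-- On a separable metrizable space, the Borel σ-algebra of the weak topology on finite measures is
the one generated by the evaluations on measurable sets. -/
instance instBorelSpace [SecondCountableTopology X] [TopologicalSpace.PseudoMetrizableSpace X]
    [BorelSpace X] : BorelSpace (FiniteMeasure X) := by
  refine ⟨le_antisymm ?_ (MeasurableSpace.generateFrom_le fun G hG ↦ ?_)⟩
  · exact measurable_iff_comap_le.1 measurable_toMeasure_borel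
  · have hG' : IsOpen[.induced massAndBasisMeasures inferInstance] G := by
      refine (@isOpen_iff_mem_nhds _ (.induced massAndBasisMeasures inferInstance) G).2 fun μ hμ ↦ ?_
      rw [nhds_induced]
      have le_nhds : Filter.comap massAndBasisMeasures (𝓝 (massAndBasisMeasures μ)) ≤ 𝓝 μ :=
        tendsto_id'.1 <| tendsto_of_seq_tendsto fun μs hμs ↦
          tendsto_of_tendsto_massAndBasisMeasures (tendsto_comap_iff.1 hμs)
      exact le_nhds (IsOpen.mem_nhds hG hμ)
    obtain ⟨V, hV, rfl⟩ := hG'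
    exact measurable_massAndBasisMeasures hV.measurableSet

/-- The singular part is jointly measurable in a pair of finite measures. -/
lemma measurable_singularPart {X : Type*} [MeasurableSpace X]
    [MeasurableSpace.CountablyGenerated X] :
    Measurable (fun pq : FiniteMeasure X × FiniteMeasure X ↦
      (pq.2 : Measure X).singularPart (pq.1 : Measure X)) := by
  have measurable_mass : Measurable fun μ : FiniteMeasure X ↦ μ.mass :=
    ((Measure.measurable_coe MeasurableSet.univ).comp measurable_subtype_coe).ennreal_toNNReal
  have measurable_scaled : Measurable fun μ : FiniteMeasure X ↦
      (1 + μ.mass)⁻¹ • (μ : Measure X) := by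
    refine Measure.measurable_of_measurable_coe _ fun s hs ↦ ?_
    simp only [Measure.smul_apply, ENNReal.smul_def, smul_eq_mul]
    exact (measurable_mass.const_add 1).inv.coe_nnreal_ennreal.mul
      ((Measure.measurable_coe hs).comp measurable_subtype_coe)
  let ρ : ProbabilityTheory.Kernel (FiniteMeasure X) X := ⟨_, measurable_scaled⟩
  have : ProbabilityTheory.IsFiniteKernel ρ := by
    refine ⟨1, ENNReal.one_lt_top, fun μ ↦ ?_⟩
    change ((1 + μ.mass)⁻¹ • (μ : Measure X)) Set.univ ≤ 1
    rw [Measure.smul_apply, ← ennreal_mass, ENNReal.smul_def, smul_eq_mul, ← ENNReal.coe_mul,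
      ENNReal.coe_le_one_iff, inv_mul_le_iff₀ (by positivity), mul_one]
    exact le_add_self
  have key := ProbabilityTheory.Kernel.measurable_singularPart
    (ρ.comap (Prod.snd (α := FiniteMeasure X)) measurable_snd)
    (ρ.comap (Prod.fst (β := FiniteMeasure X)) measurable_fst)
  have unscale (pq : FiniteMeasure X × FiniteMeasure X) :
      (pq.2 : Measure X).singularPart (pq.1 : Measure X) =
        (1 + pq.2.mass) • (ρ pq.2).singularPart (ρ pq.1) := by
    change _ = (1 + pq.2.mass) • Measure.singularPart ((1 + pq.2.mass)⁻¹ • (pq.2 : Measure X))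
      ((1 + pq.1.mass)⁻¹ • (pq.1 : Measure X))
    rw [Measure.singularPart_smul, Measure.singularPart_smul_right _ _ _ (by positivity),
      smul_smul, mul_inv_cancel₀ (by positivity), one_smul]
  simp_rw [unscale]
  refine Measure.measurable_of_measurable_coe _ fun s hs ↦ ?_
  simp only [Measure.smul_apply, ENNReal.smul_def, smul_eq_mul]
  exact ((measurable_mass.comp measurable_snd).const_add 1).coe_nnreal_ennreal.mul
    ((Measure.measurable_coe hs).comp key)

/-- The absolutely continuous part is jointly measurable in a pair of finite measures. -/
lemma measurable_withDensity_rnDeriv {X : Type*} [MeasurableSpace X]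
    [MeasurableSpace.CountablyGenerated X] :
    Measurable (fun pq : FiniteMeasure X × FiniteMeasure X ↦
      (pq.1 : Measure X).withDensity ((pq.2 : Measure X).rnDeriv (pq.1 : Measure X))) := by
  refine Measure.measurable_of_measurable_coe _ fun s hs ↦ ?_
  have eq_sub (pq : FiniteMeasure X × FiniteMeasure X) :
      (pq.1 : Measure X).withDensity ((pq.2 : Measure X).rnDeriv (pq.1 : Measure X)) s =
        (pq.2 : Measure X) s - (pq.2 : Measure X).singularPart (pq.1 : Measure X) s := by
    refine ENNReal.eq_sub_of_add_eq (measure_ne_top _ _) ?_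
    rw [← Measure.add_apply, Measure.rnDeriv_add_singularPart]
  simp_rw [eq_sub]
  exact ((Measure.measurable_coe hs).comp (measurable_subtype_coe.comp measurable_snd)).sub
    ((Measure.measurable_coe hs).comp measurable_singularPart)

end MeasureTheory.FiniteMeasure

/-- **Measurability of the Lebesgue decomposition** (Proposition 6.4): on a Polish
space `X`, the map `(p,q) ↦ (q_{ac,p}, q_{s,p})` sending a pair of finite measures to
the (unique) Lebesgue decomposition of `q` with respect to `p` is Borel measurable for
the Borel σ-algebra generated by the topology of weak convergence on `ℳ₊(X)`. -/
theorem lebesgue_decomposition_measurable {X : Type*}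
    [MeasurableSpace X] [TopologicalSpace X] [PolishSpace X] [BorelSpace X] :
    letI : MeasurableSpace (FiniteMeasure X) := borel (FiniteMeasure X)
    Measurable (fun pq : FiniteMeasure X × FiniteMeasure X =>
      ((⟨(pq.1 : Measure X).withDensity ((pq.2 : Measure X).rnDeriv (pq.1 : Measure X)),
          isFiniteMeasure_of_le (pq.2 : Measure X)
            (Measure.withDensity_rnDeriv_le (pq.2 : Measure X) (pq.1 : Measure X))⟩ : FiniteMeasure X),
       (⟨(pq.2 : Measure X).singularPart (pq.1 : Measure X),
          inferInstance⟩ : FiniteMeasure X))) := by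
  rw [← BorelSpace.measurable_eq (α := FiniteMeasure X)]
  exact (FiniteMeasure.measurable_withDensity_rnDeriv.subtype_mk).prodMk
    FiniteMeasure.measurable_singularPart.subtype_mk
end
end

section
/- Let $X, Y$ be Polish spaces. Then the map $J : \mathcal{P}(X\times Y) \to \mathcal{P}(X\times\mathcal{P}(Y))$, $\pi \mapsto \delta_{\pi_x}(dp)\,\mathrm{proj}_X(\pi)(dx)$, maps relatively compact sets of $\mathcal{P}(X\times Y)$ (weak topology) to relatively compact sets of $\mathcal{P}(X\times\mathcal{P}(Y))$ (weak topology). -/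
open MeasureTheory Filter Topology

noncomputable section

open TopologicalSpace ProbabilityTheory
open scoped NNReal ENNReal

lemma ProbabilityMeasure.measurable_toMeasure {Y : Type*} [MeasurableSpace Y] :
    Measurable fun p : ProbabilityMeasure Y ↦ (p : Measure Y) :=
  measurable_subtype_coe

section WeakTopology

variable {Y : Type*} [MeasurableSpace Y] [TopologicalSpace Y]

lemma isOpen_setOf_lt_probabilityMeasure_apply [OpensMeasurableSpace Y] [HasOuterApproxClosed Y]
    {U : Set Y} (hU : IsOpen U) (r : ℝ≥0∞) :
    IsOpen {p : ProbabilityMeasure Y | r < (p : Measure Y) U} := by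
  rw [isOpen_iff_mem_nhds]
  intro p hp
  have h : (p : Measure Y) U ≤ (𝓝 p).liminf fun q : ProbabilityMeasure Y ↦ (q : Measure Y) U :=
    ProbabilityMeasure.le_liminf_measure_open_of_tendsto (μs := id) tendsto_id hU
  exact eventually_lt_of_lt_liminf (lt_of_lt_of_le hp h)

/-- A countable subbasis of the weak topology on probability measures, made of the sets of
measures giving more than a rational mass to a finite union of basic open sets. -/
def weakSubbasis (Y : Type*) [MeasurableSpace Y] [TopologicalSpace Y]
    [SecondCountableTopology Y] : Set (Set (ProbabilityMeasure Y)) :=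
  Set.range fun x : Finset (countableBasis Y) × ℚ ↦
    {p : ProbabilityMeasure Y |
      ((Real.toNNReal x.2 : ℝ≥0) : ℝ≥0∞) < (p : Measure Y) (⋃ t ∈ x.1, (t : Set Y))}

lemma countable_weakSubbasis [SecondCountableTopology Y] : (weakSubbasis Y).Countable :=
  Set.countable_range _

lemma isOpen_biUnion_countableBasis {Y : Type*} [TopologicalSpace Y] [SecondCountableTopology Y]
    (T : Finset (countableBasis Y)) : IsOpen (⋃ t ∈ T, (t : Set Y)) :=
  isOpen_biUnion fun t _ ↦ isOpen_of_mem_countableBasis t.2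

lemma probabilityMeasure_topology_eq_generateFrom [PseudoMetrizableSpace Y]
    [SecondCountableTopology Y] [BorelSpace Y] :
    (inferInstance : TopologicalSpace (ProbabilityMeasure Y)) =
      TopologicalSpace.generateFrom (weakSubbasis Y) := by
  refine le_antisymm (le_generateFrom ?_) ?_
  · rintro _ ⟨⟨T, q⟩, rfl⟩
    exact isOpen_setOf_lt_probabilityMeasure_apply (isOpen_biUnion_countableBasis T) _
  · rw [le_iff_nhds]
    intro p
    have hsc := @SecondCountableTopology.mk' _ (weakSubbasis Y) countable_weakSubbasis
    have hcg : (@nhds _ (TopologicalSpace.generateFrom (weakSubbasis Y)) p).IsCountablyGenerated :=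
      @FirstCountableTopology.nhds_generated_countable _ (.generateFrom (weakSubbasis Y))
        (@SecondCountableTopology.to_firstCountableTopology _ (.generateFrom (weakSubbasis Y)) hsc)
        p
    suffices h : Tendsto id (@nhds _ (TopologicalSpace.generateFrom (weakSubbasis Y)) p) (𝓝 p) from
      h
    refine tendsto_of_forall_isOpen_le_liminf' fun G hG ↦ ?_
    refine le_of_forall_lt fun a ha ↦ ?_
    obtain ⟨q, -, haq, hq⟩ := ENNReal.lt_iff_exists_rat_btwn.1 ha
    refine lt_of_lt_of_le haq ?_
    rw [← ProbabilityMeasure.ennreal_coeFn_eq_coeFn_toMeasure, ENNReal.coe_lt_coe] at hq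
    obtain ⟨T, hT, hqT, hTG⟩ := p.exists_lt_measure_biUnion_of_isOpen (S := countableBasis Y)
      (fun u hu x hx ↦ by
        obtain ⟨s, hs, hxs, hsu⟩ := (isBasis_countableBasis Y).exists_subset_of_mem_open hx hu
        exact ⟨s, hs, (isOpen_of_mem_countableBasis hs).mem_nhds hxs, hsu⟩) hG hq
    have hT' : (⋃ t ∈ T.attach.image (fun t ↦ (⟨t.1, hT t.1 t.2⟩ : countableBasis Y)),
        (t : Set Y)) = ⋃ t ∈ T, t := by
      ext x
      simp only [Finset.mem_image, Finset.mem_attach, true_and, Set.mem_iUnion, exists_prop]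
      exact ⟨fun ⟨_, ⟨t, rfl⟩, hx⟩ ↦ ⟨t.1, t.2, hx⟩, fun ⟨t, ht, hx⟩ ↦ ⟨_, ⟨⟨t, ht⟩, rfl⟩, hx⟩⟩
    refine le_liminf_of_le (by isBoundedDefault) ?_
    have hmem : {p' : ProbabilityMeasure Y | ((Real.toNNReal q : ℝ≥0) : ℝ≥0∞) <
        (p' : Measure Y) (⋃ t ∈ T, t)} ∈
        @nhds _ (TopologicalSpace.generateFrom (weakSubbasis Y)) p := by
      refine @IsOpen.mem_nhds (ProbabilityMeasure Y) (.generateFrom (weakSubbasis Y)) p _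
        (isOpen_generateFrom_of_mem ?_) ?_
      · exact ⟨(_, q), by rw [← hT']⟩
      · rw [← ENNReal.coe_lt_coe, ProbabilityMeasure.ennreal_coeFn_eq_coeFn_toMeasure] at hqT
        exact hqT
    filter_upwards [hmem] with p' hp'
    exact (le_of_lt hp').trans (measure_mono hTG)

lemma ProbabilityMeasure.secondCountableTopology [PseudoMetrizableSpace Y]
    [SecondCountableTopology Y] [BorelSpace Y] :
    SecondCountableTopology (ProbabilityMeasure Y) :=
  ⟨weakSubbasis Y, countable_weakSubbasis, probabilityMeasure_topology_eq_generateFrom⟩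

/-- The Giry σ-algebra on probability measures is the Borel σ-algebra of the weak topology. -/
instance ProbabilityMeasure.instBorelSpace [PseudoMetrizableSpace Y]
    [SecondCountableTopology Y] [BorelSpace Y] :
    BorelSpace (ProbabilityMeasure Y) := by
  refine ⟨le_antisymm ?_ ?_⟩
  · let : MeasurableSpace (ProbabilityMeasure Y) := borel _
    have : BorelSpace (ProbabilityMeasure Y) := ⟨rfl⟩
    refine measurable_iff_comap_le.1 ?_
    refine Measurable.measure_of_isPiSystem_of_isProbabilityMeasure
      (μ := fun p : ProbabilityMeasure Y ↦ (p : Measure Y))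
      (BorelSpace.measurable_eq (α := Y)) isPiSystem_isOpen fun U hU ↦ ?_
    exact measurable_of_Ioi fun r ↦ (isOpen_setOf_lt_probabilityMeasure_apply hU r).measurableSet
  · have := ProbabilityMeasure.secondCountableTopology (Y := Y)
    rw [borel_eq_generateFrom_of_subbasis probabilityMeasure_topology_eq_generateFrom]
    refine MeasurableSpace.generateFrom_le ?_
    rintro _ ⟨⟨T, q⟩, rfl⟩
    exact measurableSet_lt measurable_const
      ((Measure.measurable_coe (isOpen_biUnion_countableBasis T).measurableSet).comp
        measurable_subtype_coe)

/-- A set of measures on the space of probability measures is tight as soon as the set of its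
barycenters is tight. -/
lemma isTightMeasureSet_of_bind [PseudoMetrizableSpace Y] [T2Space Y]
    [SecondCountableTopology Y] [BorelSpace Y] {S : Set (Measure (ProbabilityMeasure Y))}
    (hS : IsTightMeasureSet
      ((fun P ↦ P.bind fun p : ProbabilityMeasure Y ↦ (p : Measure Y)) '' S)) :
    IsTightMeasureSet S := by
  rw [isTightMeasureSet_iff_exists_isCompact_measure_compl_le] at hS ⊢
  intro ε hε
  obtain ⟨δ, hδ, hδε⟩ := ENNReal.exists_pos_sum_of_countable hε.ne' ℕ
  obtain ⟨u, -, u_pos, u_lim⟩ := exists_seq_strictAnti_tendsto (0 : ℝ≥0)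
  choose K hK hKS using fun n ↦ hS ((u n : ℝ≥0∞) * δ n) (by
    exact_mod_cast mul_pos (u_pos n) (hδ n))
  refine ⟨{p | ∀ n, p (K n)ᶜ ≤ u n},
    isCompact_setOfPred_probabilityMeasure_mass_eq_compl_isCompact_le u_lim hK
      (Or.inl inferInstance), fun P hP ↦ ?_⟩
  have hsub : {p : ProbabilityMeasure Y | ∀ n, p (K n)ᶜ ≤ u n}ᶜ ⊆
      ⋃ n, {p : ProbabilityMeasure Y | (u n : ℝ≥0∞) ≤ (p : Measure Y) (K n)ᶜ} := by
    intro p hp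
    simp only [Set.mem_compl_iff, Set.mem_ofPred_eq, not_forall, not_le] at hp
    obtain ⟨n, hn⟩ := hp
    refine Set.mem_iUnion.2 ⟨n, ?_⟩
    rw [Set.mem_ofPred_eq, ← ProbabilityMeasure.ennreal_coeFn_eq_coeFn_toMeasure]
    exact_mod_cast hn.le
  refine (measure_mono hsub).trans ((measure_iUnion_le _).trans ?_)
  refine (ENNReal.tsum_le_tsum fun n ↦ ?_).trans hδε.le
  have hmeas : MeasurableSet (K n)ᶜ := (hK n).isClosed.measurableSet.compl
  have hbind : P.bind (fun p : ProbabilityMeasure Y ↦ (p : Measure Y)) (K n)ᶜ ≤ u n * δ n :=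
    hKS n _ ⟨P, hP, rfl⟩
  rw [Measure.bind_apply hmeas ProbabilityMeasure.measurable_toMeasure.aemeasurable] at hbind
  have hmarkov := (mul_meas_ge_le_lintegral (μ := P)
    ((Measure.measurable_coe hmeas).comp ProbabilityMeasure.measurable_toMeasure) (u n : ℝ≥0∞)).trans hbind
  exact (ENNReal.mul_le_mul_iff_right (by exact_mod_cast (u_pos n).ne') ENNReal.coe_ne_top).1
    hmarkov

end WeakTopology

section Disintegration

variable {X Y : Type*}
  [MeasurableSpace X]
  [MeasurableSpace Y] [TopologicalSpace Y] [PolishSpace Y] [BorelSpace Y] [Nonempty Y]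

/-- The disintegration of `π` with respect to its first marginal, as a map into the space of
probability measures. -/
def disintegration (π : ProbabilityMeasure (X × Y)) (x : X) : ProbabilityMeasure Y :=
  ⟨(π : Measure (X × Y)).condKernel x, inferInstance⟩

lemma measurable_disintegration (π : ProbabilityMeasure (X × Y)) :
    Measurable (disintegration π) :=
  (Kernel.measurable _).subtype_mk

/-- The law of `(x, π_x)` under the first marginal of `π`. -/
def disintegrationLaw (π : ProbabilityMeasure (X × Y)) :
    ProbabilityMeasure (X × ProbabilityMeasure Y) :=
  ⟨((π : Measure (X × Y)).map Prod.fst).map fun x ↦ (x, disintegration π x),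
    haveI := Measure.isProbabilityMeasure_map (μ := (π : Measure (X × Y)))
      measurable_fst.aemeasurable
    Measure.isProbabilityMeasure_map
      (measurable_id.prodMk (measurable_disintegration π)).aemeasurable⟩

lemma fst_disintegrationLaw (π : ProbabilityMeasure (X × Y)) :
    (disintegrationLaw π : Measure (X × ProbabilityMeasure Y)).fst =
      (π : Measure (X × Y)).map Prod.fst := by
  have hm : Measurable fun x ↦ (x, disintegration π x) :=
    measurable_id.prodMk (measurable_disintegration π)
  change (((π : Measure (X × Y)).map Prod.fst).map _).map Prod.fst = _
  rw [Measure.map_map measurable_fst hm]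
  exact Measure.map_id

lemma bind_snd_disintegrationLaw (π : ProbabilityMeasure (X × Y)) :
    (disintegrationLaw π : Measure (X × ProbabilityMeasure Y)).snd.bind
      (fun p : ProbabilityMeasure Y ↦ (p : Measure Y)) = (π : Measure (X × Y)).map Prod.snd := by
  have hm : Measurable fun x ↦ (x, disintegration π x) :=
    measurable_id.prodMk (measurable_disintegration π)
  change ((((π : Measure (X × Y)).map Prod.fst).map _).map Prod.snd).bind _ = _
  rw [Measure.map_map measurable_snd hm]
  ext s hs
  rw [Measure.bind_apply hs ProbabilityMeasure.measurable_toMeasure.aemeasurable,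
    lintegral_map (f := fun p : ProbabilityMeasure Y ↦ (p : Measure Y) s)
      ((Measure.measurable_coe hs).comp ProbabilityMeasure.measurable_toMeasure)
      (measurable_snd.comp hm)]
  have h : ((π : Measure (X × Y)).fst ⊗ₘ (π : Measure (X × Y)).condKernel).snd s =
      (π : Measure (X × Y)).snd s := by rw [Measure.disintegrate]
  rw [Measure.snd_compProd, Measure.bind_apply hs (Kernel.aemeasurable _)] at h
  exact h

variable [TopologicalSpace X] [PolishSpace X] [BorelSpace X]

lemma isCompact_closure_image_disintegrationLaw {S : Set (ProbabilityMeasure (X × Y))}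
    (hS : IsCompact (closure S)) :
    IsCompact (closure (disintegrationLaw '' S)) := by
  have hT : IsTightMeasureSet {(π : Measure (X × Y)) | π ∈ S} := by
    let := upgradeIsCompletelyMetrizable (X × Y)
    exact isTightMeasureSet_of_isCompact_closure hS
  refine isCompact_closure_of_isTightMeasureSet (IsTightMeasureSet.prodMk ?_ ?_)
  · refine (hT.map continuous_fst).subset ?_
    rintro _ ⟨_, ⟨_, ⟨π, hπ, rfl⟩, rfl⟩, rfl⟩
    exact ⟨_, ⟨π, hπ, rfl⟩, (fst_disintegrationLaw π).symm⟩
  · refine isTightMeasureSet_of_bind ((hT.map continuous_snd).subset ?_)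
    rintro _ ⟨_, ⟨_, ⟨_, ⟨π, hπ, rfl⟩, rfl⟩, rfl⟩, rfl⟩
    exact ⟨_, ⟨π, hπ, rfl⟩, (bind_snd_disintegrationLaw π).symm⟩

lemma exists_disintegrationLaw_of_borelSpace
    [m : MeasurableSpace (ProbabilityMeasure Y)] [hm : BorelSpace (ProbabilityMeasure Y)] :
    ∃ J : ProbabilityMeasure (X × Y) → ProbabilityMeasure (X × ProbabilityMeasure Y),
      (∀ π : ProbabilityMeasure (X × Y),
        (J π : Measure (X × ProbabilityMeasure Y)) =
          Measure.map
            (fun x => ((x, (⟨(π : Measure (X × Y)).condKernel x, inferInstance⟩ :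
              ProbabilityMeasure Y)) : X × ProbabilityMeasure Y))
            ((π : Measure (X × Y)).map Prod.fst)) ∧
      ∀ S : Set (ProbabilityMeasure (X × Y)),
        IsCompact (closure S) → IsCompact (closure (J '' S)) := by
  obtain rfl : m = MeasureTheory.ProbabilityMeasure.instMeasurableSpace :=
    hm.measurable_eq.trans (ProbabilityMeasure.instBorelSpace (Y := Y)).measurable_eq.symm
  exact ⟨disintegrationLaw, fun _ ↦ rfl, fun _ ↦ isCompact_closure_image_disintegrationLaw⟩

end Disintegration

/-- **The embedding `J` preserves relative compactness**: the map
`J : 𝒫(X×Y) → 𝒫(X×𝒫(Y))`, `π ↦ (x ↦ (x, π_x))_* proj_X(π)` (law of `(x, π_x)` under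
the first marginal, `π_x` a regular disintegration) maps relatively compact sets of
`𝒫(X×Y)` (weak topology) to relatively compact sets of `𝒫(X×𝒫(Y))` (weak topology). -/
theorem J_preserves_relative_compactness {X Y : Type*}
    [MeasurableSpace X] [TopologicalSpace X] [PolishSpace X] [BorelSpace X]
    [MeasurableSpace Y] [TopologicalSpace Y] [PolishSpace Y] [BorelSpace Y]
    [Nonempty Y] :
    letI : MeasurableSpace (ProbabilityMeasure Y) := borel (ProbabilityMeasure Y)
    haveI : BorelSpace (ProbabilityMeasure Y) := ⟨rfl⟩
    ∃ J : ProbabilityMeasure (X × Y) → ProbabilityMeasure (X × ProbabilityMeasure Y),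
      (∀ π : ProbabilityMeasure (X × Y),
        (J π : Measure (X × ProbabilityMeasure Y)) =
          Measure.map
            (fun x => ((x, (⟨(π : Measure (X × Y)).condKernel x, inferInstance⟩ :
              ProbabilityMeasure Y)) : X × ProbabilityMeasure Y))
            ((π : Measure (X × Y)).map Prod.fst)) ∧
      ∀ S : Set (ProbabilityMeasure (X × Y)),
        IsCompact (closure S) → IsCompact (closure (J '' S)) := by
  let : MeasurableSpace (ProbabilityMeasure Y) := borel (ProbabilityMeasure Y)
  have : BorelSpace (ProbabilityMeasure Y) := ⟨rfl⟩
  exact exists_disintegrationLaw_of_borelSpace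
end
end

section
/- Let $c, c_k : \mathbb{R}\times\mathbb{R}\to[0,\infty)$ be continuous with $c_k \to c$ uniformly, $c(x,y)\le r(1+|x|+|y|)$ for some $r>0$. Let $\mu_k\to\mu$, $\nu_k\to\nu$ in $\mathcal{W}_1$ with $\mu_k \leq_c \nu_k$ (convex order) for each $k$. Then $\lim_{k\to\infty} \inf_{\pi\in\Pi_M(\mu_k,\nu_k)}\int c_k\,d\pi = \inf_{\pi\in\Pi_M(\mu,\nu)}\int c\,d\pi$. -/
open MeasureTheory Filter Topology

noncomputable section

/-- `WrPow r p q` is the `r`-th power of the `r`-Wasserstein distance: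
`inf { ∫ d(y₁,y₂)^r dπ : π coupling of p, q }`. -/
noncomputable def WrPow {Y : Type*} [MeasurableSpace Y] [PseudoMetricSpace Y]
    (r : ℝ) (p q : Measure Y) : ℝ :=
  sInf {v | ∃ π : Measure (Y × Y), IsCoupling π p q ∧ v = ∫ z, dist z.1 z.2 ^ r ∂π}

/-- Convergence in the `r`-Wasserstein metric. -/
def TendstoWr {Y : Type*} [MeasurableSpace Y] [PseudoMetricSpace Y]
    (r : ℝ) (pk : ℕ → Measure Y) (p : Measure Y) : Prop :=
  Tendsto (fun k => WrPow r (pk k) p) atTop (nhds 0)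

/-- Finite `r`-th moment. -/
def FiniteMomentR {Y : Type*} [MeasurableSpace Y] [PseudoMetricSpace Y]
    (r : ℝ) (p : Measure Y) : Prop :=
  ∃ y0 : Y, Integrable (fun y => dist y y0 ^ r) p

/-- Membership in `𝒫_r(Y)`: a probability measure with finite `r`-th moment. -/
def MemPr {Y : Type*} [MeasurableSpace Y] [PseudoMetricSpace Y]
    (r : ℝ) (p : Measure Y) : Prop :=
  IsProbabilityMeasure p ∧ FiniteMomentR r p

/-- A martingale coupling of `μ` and `ν` on `ℝ`, encoded by a measurable Markov
disintegration kernel whose barycenter is the identity `μ`-a.s. -/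
def IsMartCoupling (μ ν : Measure ℝ) (π : Measure (ℝ × ℝ)) : Prop :=
  ∃ κ : ℝ → Measure ℝ, Measurable κ ∧ (∀ x, IsProbabilityMeasure (κ x)) ∧
    π = μ.bind (fun x => (κ x).map (fun y => (x, y))) ∧
    π.map Prod.snd = ν ∧ (∀ᵐ x ∂μ, ∫ y, y ∂(κ x) = x)

/-- The convex order on probability measures on `ℝ`. -/
def ConvexOrder (μ ν : Measure ℝ) : Prop :=
  ∀ φ : ℝ → ℝ, ConvexOn ℝ Set.univ φ → (∃ a b : ℝ, ∀ y, |φ y| ≤ a + b * |y|) →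
    ∫ y, φ y ∂μ ≤ ∫ y, φ y ∂ν

open ProbabilityTheory

/-- The potential function `z ↦ ∫ |y - z| dp(y)` of a measure on the line. -/
def pot (p : Measure ℝ) (z : ℝ) : ℝ := ∫ y, |y - z| ∂p

/-- Probability measures on the line with finite first moment. -/
structure IsP1 (p : Measure ℝ) : Prop where
  prob : IsProbabilityMeasure p
  int : Integrable (fun y : ℝ => y) p

/-- Martingale couplings, with the barycentre condition expressed through test functions. -/
structure IsMart (μ ν : Measure ℝ) (π : Measure (ℝ × ℝ)) : Prop where
  fst : π.map Prod.fst = μ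
  snd : π.map Prod.snd = ν
  mart : ∀ f : ℝ → ℝ, Measurable f → (∃ C, ∀ x, |f x| ≤ C) →
    ∫ z, f z.1 * (z.2 - z.1) ∂π = 0

lemma MemPr.isP1 {p : Measure ℝ} (h : MemPr 1 p) : IsP1 p := by
  obtain ⟨h1, y0, h2⟩ := h
  refine ⟨h1, ?_⟩
  simp only [Real.rpow_one, Real.dist_eq] at h2
  have h3 : Integrable (fun y : ℝ => y - y0) p := by
    rw [← integrable_norm_iff (by fun_prop)]
    exact h2
  refine (h3.add (integrable_const y0)).congr (ae_of_all _ fun y => ?_)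
  simp

lemma IsP1.integrable_abs_sub {p : Measure ℝ} (h : IsP1 p) (z : ℝ) :
    Integrable (fun y : ℝ => |y - z|) p := by
  have := h.prob
  exact (h.int.sub (integrable_const z)).abs

lemma isP1_map {Ω : Type*} [MeasurableSpace Ω] {P : Measure Ω} [IsProbabilityMeasure P]
    {X : Ω → ℝ} (hX : Measurable X) (hXi : Integrable X P) : IsP1 (P.map X) :=
  ⟨Measure.isProbabilityMeasure_map hX.aemeasurable,
    (integrable_map_measure (by fun_prop) hX.aemeasurable).2 hXi⟩

lemma pot_map {Ω : Type*} [MeasurableSpace Ω] {P : Measure Ω}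
    {X : Ω → ℝ} (hX : Measurable X) (z : ℝ) : pot (P.map X) z = ∫ ω, |X ω - z| ∂P := by
  rw [pot, integral_map hX.aemeasurable (by fun_prop)]

lemma IsP1.pot_le_pot_add {p : Measure ℝ} (h : IsP1 p) (z w : ℝ) :
    pot p z ≤ pot p w + |z - w| := by
  have := h.prob
  have h1 : pot p z ≤ ∫ y, (|y - w| + |z - w|) ∂p := by
    refine integral_mono (h.integrable_abs_sub z)
      ((h.integrable_abs_sub w).add (integrable_const _)) fun y => ?_
    have := abs_sub_le y w z
    rwa [abs_sub_comm w z] at this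
  rw [integral_add (h.integrable_abs_sub w) (integrable_const _)] at h1
  simpa [pot] using h1

lemma IsP1.lipschitz_pot {p : Measure ℝ} (h : IsP1 p) : LipschitzWith 1 (pot p) := by
  refine LipschitzWith.of_dist_le_mul fun z w => ?_
  rw [Real.dist_eq, Real.dist_eq, NNReal.coe_one, one_mul, abs_sub_le_iff]
  have h1 := h.pot_le_pot_add z w
  have h2 := h.pot_le_pot_add w z
  rw [abs_sub_comm w z] at h2
  constructor <;> linarith

lemma abs_integral_abs_sub_le {Ω : Type*} [MeasurableSpace Ω] {P : Measure Ω}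
    [IsProbabilityMeasure P] {X Y : Ω → ℝ} (hX : Integrable X P) (hY : Integrable Y P) (z : ℝ) :
    |∫ ω, |X ω - z| ∂P - ∫ ω, |Y ω - z| ∂P| ≤ ∫ ω, |X ω - Y ω| ∂P := by
  have h1 : Integrable (fun ω => |X ω - z|) P := (hX.sub (integrable_const z)).abs
  have h2 : Integrable (fun ω => |Y ω - z|) P := (hY.sub (integrable_const z)).abs
  rw [← integral_sub h1 h2]
  refine (abs_integral_le_integral_abs).trans ?_
  refine integral_mono (h1.sub h2).abs (hX.sub hY).abs fun ω => ?_
  have := abs_abs_sub_abs_le_abs_sub (X ω - z) (Y ω - z)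
  simpa using this

/-- A measure on the line is determined by its potential. -/
lemma IsP1.eq_of_pot_eq {p q : Measure ℝ} (hp : IsP1 p) (hq : IsP1 q)
    (h : ∀ z, pot p z = pot q z) : p = q := by
  have := hp.prob
  have := hq.prob
  -- the difference quotients of the potential converge to `2 P(Y ≤ z) - 1`
  have key : ∀ r : Measure ℝ, IsP1 r → ∀ z : ℝ,
      Tendsto (fun n : ℕ => (n + 1 : ℝ) * (pot r (z + 1 / (n + 1 : ℝ)) - pot r z)) atTop
        (𝓝 (∫ y, ((Set.Iic z).indicator (fun _ => (2 : ℝ)) y - 1) ∂r)) := by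
    intro r hr z
    have := hr.prob
    have h1 : ∀ n : ℕ, (n + 1 : ℝ) * (pot r (z + 1 / (n + 1 : ℝ)) - pot r z) =
        ∫ y, (n + 1 : ℝ) * (|y - (z + 1 / (n + 1 : ℝ))| - |y - z|) ∂r := by
      intro n
      rw [integral_const_mul, integral_sub (hr.integrable_abs_sub _) (hr.integrable_abs_sub _)]
      rfl
    simp_rw [h1]
    refine tendsto_integral_of_dominated_convergence (fun _ => (1 : ℝ))
      (fun n => by fun_prop) (integrable_const _) ?_ ?_
    · intro n
      refine ae_of_all _ fun y => ?_
      have hn : (0 : ℝ) < n + 1 := by positivity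
      rw [Real.norm_eq_abs, abs_mul, abs_of_pos hn]
      have h2 := abs_abs_sub_abs_le_abs_sub (y - (z + 1 / (n + 1 : ℝ))) (y - z)
      have h3 : |y - (z + 1 / (n + 1 : ℝ)) - (y - z)| = 1 / (n + 1 : ℝ) := by
        rw [show y - (z + 1 / (n + 1 : ℝ)) - (y - z) = -(1 / (n + 1 : ℝ)) by ring, abs_neg,
          abs_of_pos (by positivity)]
      rw [h3] at h2
      calc (n + 1 : ℝ) * _ ≤ (n + 1) * (1 / (n + 1 : ℝ)) := by gcongr
        _ = 1 := by field_simp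
    · refine ae_of_all _ fun y => ?_
      by_cases hy : y ≤ z
      · have : ∀ n : ℕ, (n + 1 : ℝ) * (|y - (z + 1 / (n + 1 : ℝ))| - |y - z|) = 1 := by
          intro n
          have hn : (0 : ℝ) < n + 1 := by positivity
          have hn' : 0 < 1 / (n + 1 : ℝ) := by positivity
          rw [abs_of_nonpos (by linarith), abs_of_nonpos (by linarith)]
          field_simp
          ring
        simp only [this, Set.indicator, Set.mem_Iic, hy, if_true]
        norm_num
      · push Not at hy
        have hev : ∀ᶠ n : ℕ in atTop, 1 / ((n : ℝ) + 1) < y - z :=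
          (tendsto_one_div_add_atTop_nhds_zero_nat (𝕜 := ℝ)).eventually_lt_const (by linarith)
        refine tendsto_const_nhds.congr' ?_
        filter_upwards [hev] with n hn
        have hn0 : (0 : ℝ) < n + 1 := by positivity
        rw [abs_of_nonneg (by linarith), abs_of_nonneg (by linarith)]
        simp only [Set.indicator, Set.mem_Iic, not_le.2 hy, if_false]
        field_simp
        ring
  refine Measure.ext_of_Iic p q fun z => ?_
  have h2 := tendsto_nhds_unique (key p hp z)
    ((key q hq z).congr fun n => by rw [h, h])
  have h3 : ∀ r : Measure ℝ, IsProbabilityMeasure r →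
      ∫ y, ((Set.Iic z).indicator (fun _ => (2 : ℝ)) y - 1) ∂r = 2 * r.real (Set.Iic z) - 1 := by
    intro r hr
    rw [integral_sub ((integrable_const _).indicator measurableSet_Iic) (integrable_const _),
      integral_indicator_const _ measurableSet_Iic]
    simp [mul_comm]
  rw [h3 p hp.prob, h3 q hq.prob] at h2
  have h4 : p.real (Set.Iic z) = q.real (Set.Iic z) := by linarith
  rwa [measureReal_def, measureReal_def,
    ENNReal.toReal_eq_toReal_iff' (measure_ne_top _ _) (measure_ne_top _ _)] at h4

section basic

variable {μ ν : Measure ℝ} {π : Measure (ℝ × ℝ)}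

lemma IsMart.prob (h : IsMart μ ν π) (hμ : IsP1 μ) : IsProbabilityMeasure π := by
  have := hμ.prob
  rw [← h.fst] at this
  exact (Measure.isProbabilityMeasure_map_iff (by fun_prop)).1 this

lemma IsMart.integrable_fst (h : IsMart μ ν π) (hμ : IsP1 μ) :
    Integrable (fun z : ℝ × ℝ => z.1) π := by
  have := hμ.int
  rw [← h.fst] at this
  exact this.comp_measurable measurable_fst

lemma IsMart.integrable_snd (h : IsMart μ ν π) (hν : IsP1 ν) :
    Integrable (fun z : ℝ × ℝ => z.2) π := by
  have := hν.int
  rw [← h.snd] at this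
  exact this.comp_measurable measurable_snd

lemma isMart_of_map {Ω : Type*} [MeasurableSpace Ω] {P : Measure Ω} {X Y : Ω → ℝ}
    (hX : Measurable X) (hY : Measurable Y)
    (h : ∀ f : ℝ → ℝ, Measurable f → (∃ C, ∀ x, |f x| ≤ C) →
      ∫ ω, f (X ω) * (Y ω - X ω) ∂P = 0) :
    IsMart (P.map X) (P.map Y) (P.map fun ω => (X ω, Y ω)) := by
  refine ⟨?_, ?_, fun f hf hb => ?_⟩
  · rw [Measure.map_map (by fun_prop) (by fun_prop)]; rfl
  · rw [Measure.map_map (by fun_prop) (by fun_prop)]; rfl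
  · rw [integral_map (by fun_prop) (by fun_prop)]
    exact h f hf hb

lemma integrable_bdd_mul {Ω : Type*} [MeasurableSpace Ω] {P : Measure Ω} {f g : Ω → ℝ}
    (hf : Measurable f) (hb : ∃ C, ∀ x, |f x| ≤ C) (hg : Integrable g P) :
    Integrable (fun ω => f ω * g ω) P := by
  obtain ⟨C, hC⟩ := hb
  exact hg.bdd_mul (c := C) hf.aestronglyMeasurable (ae_of_all _ hC)

lemma IsMart.integral_condKernel (h : IsMart μ ν π) (hμ : IsP1 μ) (hν : IsP1 ν)
    [IsFiniteMeasure π] :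
    ∀ᵐ x ∂μ, Integrable (fun y : ℝ => y) (π.condKernel x) ∧ ∫ y, y ∂(π.condKernel x) = x := by
  have := hμ.prob
  have hd : μ ⊗ₘ π.condKernel = π := by
    rw [← h.fst]; exact π.disintegrate π.condKernel
  have h1 : Integrable (fun z : ℝ × ℝ => z.2 - z.1) (μ ⊗ₘ π.condKernel) := by
    rw [hd]; exact (h.integrable_snd hν).sub (h.integrable_fst hμ)
  have h2 := h1.integral_compProd
  have hsnd : Integrable (fun z : ℝ × ℝ => z.2) (μ ⊗ₘ π.condKernel) := by
    rw [hd]; exact h.integrable_snd hν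
  have h4 : (fun x => ∫ y, y - x ∂(π.condKernel x)) =ᵐ[μ] 0 := by
    refine h2.ae_eq_zero_of_forall_setIntegral_eq_zero fun s hs _ => ?_
    have h5 := h.mart (s.indicator fun _ => 1) (measurable_const.indicator hs)
      ⟨1, fun x => by by_cases hx : x ∈ s <;> simp [hx]⟩
    nth_rw 1 [← hd] at h5
    rw [Measure.integral_compProd] at h5
    · rw [← h5, ← integral_indicator hs]
      congr 1 with x
      by_cases hx : x ∈ s <;> simp [hx]
    · exact integrable_bdd_mul ((measurable_const.indicator hs).comp measurable_fst)
        ⟨1, fun x => by by_cases hx : x.1 ∈ s <;> simp [hx]⟩ h1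
  have h6 := ((Measure.integrable_compProd_iff (by fun_prop)).1 hsnd).1
  filter_upwards [h4, h6] with x hx hi
  refine ⟨hi, ?_⟩
  rw [integral_sub hi (integrable_const _)] at hx
  simp only [integral_const, probReal_univ, smul_eq_mul, one_mul, Pi.zero_apply] at hx
  linarith

lemma isMartCoupling_iff (hμ : IsP1 μ) (hν : IsP1 ν) :
    IsMartCoupling μ ν π ↔ IsMart μ ν π := by
  have := hμ.prob
  constructor
  · rintro ⟨κ, hκ, hκp, hπ, hsnd, hb⟩
    let K : Kernel ℝ ℝ := ⟨κ, hκ⟩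
    have : IsMarkovKernel K := ⟨hκp⟩
    have hπ' : π = μ ⊗ₘ K := by
      rw [hπ]
      ext s hs
      rw [Measure.compProd_apply hs, Measure.bind_apply hs]
      · refine lintegral_congr fun x => ?_
        rw [Measure.map_apply (by fun_prop) hs]
        rfl
      · refine Measurable.aemeasurable (Measure.measurable_of_measurable_coe _ fun t ht => ?_)
        have : ∀ x, ((κ x).map fun y => (x, y)) t = K x (Prod.mk x ⁻¹' t) := fun x => by
          rw [Measure.map_apply (by fun_prop) ht]; rfl
        simp_rw [this]
        exact Kernel.measurable_kernel_prodMk_left ht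
    have hfst : π.map Prod.fst = μ := by
      rw [hπ']; exact Measure.fst_compProd μ K
    refine ⟨hfst, hsnd, fun f hf hfb => ?_⟩
    have hi1 : Integrable (fun z : ℝ × ℝ => z.1) π :=
      Integrable.comp_measurable (f := Prod.fst) (by rw [hfst]; exact hμ.int) measurable_fst
    have hi2 : Integrable (fun z : ℝ × ℝ => z.2) π :=
      Integrable.comp_measurable (f := Prod.snd) (by rw [hsnd]; exact hν.int) measurable_snd
    have hi3 : Integrable (fun z : ℝ × ℝ => f z.1 * (z.2 - z.1)) π :=
      integrable_bdd_mul (hf.comp measurable_fst) (hfb.imp fun C hC x => hC _) (hi2.sub hi1)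
    rw [hπ'] at hi2 hi3 ⊢
    rw [Measure.integral_compProd hi3]
    have h6 := ((Measure.integrable_compProd_iff (by fun_prop)).1 hi2).1
    refine integral_eq_zero_of_ae ?_
    filter_upwards [hb, h6] with x hx hi
    have hx' : ∫ y, y ∂(K x) = x := hx
    rw [integral_const_mul, integral_sub hi (integrable_const _), hx']
    simp
  · intro h
    have := h.prob hμ
    refine ⟨π.condKernel, Kernel.measurable _, fun x => inferInstance, ?_, h.snd, ?_⟩
    · have hd : μ ⊗ₘ π.condKernel = π := by
        rw [← h.fst]; exact π.disintegrate π.condKernel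
      nth_rw 1 [← hd]
      ext s hs
      rw [Measure.compProd_apply hs, Measure.bind_apply hs]
      · refine lintegral_congr fun x => ?_
        rw [Measure.map_apply (by fun_prop) hs]
      · refine Measurable.aemeasurable (Measure.measurable_of_measurable_coe _ fun t ht => ?_)
        have : ∀ x, ((π.condKernel x).map fun y => (x, y)) t = π.condKernel x (Prod.mk x ⁻¹' t) :=
          fun x => by rw [Measure.map_apply (by fun_prop) ht]
        simp_rw [this]
        exact Kernel.measurable_kernel_prodMk_left ht
    · filter_upwards [h.integral_condKernel hμ hν] with x hx using hx.2

/-- Extend a probability space carrying `Y ∼ μ` by a variable `Z` such that `(Y, Z) ∼ π`, keeping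
`Z` conditionally independent of everything else given `Y`. -/
lemma exists_glue {Ω : Type*} [MeasurableSpace Ω] {P : Measure Ω} [IsProbabilityMeasure P]
    {Y : Ω → ℝ} (hY : Measurable Y) [IsProbabilityMeasure π] (hπ : π.map Prod.fst = P.map Y) :
    ∃ Q : Measure (Ω × ℝ), Q.map Prod.fst = P ∧ Q.map (fun w => (Y w.1, w.2)) = π ∧
      ∀ h : ℝ × ℝ → ℝ, Integrable h π →
        (∀ f : ℝ → ℝ, Measurable f → (∃ C, ∀ x, |f x| ≤ C) → ∫ z, f z.1 * h z ∂π = 0) →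
        ∀ g : Ω → ℝ, Measurable g → (∃ C, ∀ x, |g x| ≤ C) →
          ∫ w, g w.1 * h (Y w.1, w.2) ∂Q = 0 := by
  have hd : P.map Y ⊗ₘ π.condKernel = π := by
    rw [← hπ]; exact π.disintegrate π.condKernel
  have : IsProbabilityMeasure (P.map Y) := Measure.isProbabilityMeasure_map hY.aemeasurable
  set K : Kernel Ω ℝ := π.condKernel.comap Y hY
  have hmap : (P ⊗ₘ K).map (fun w => (Y w.1, w.2)) = π := by
    refine Eq.trans ?_ hd
    ext s hs
    rw [Measure.map_apply (by fun_prop) hs, Measure.compProd_apply hs,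
      Measure.compProd_apply (hs.preimage (by fun_prop)),
      lintegral_map (Kernel.measurable_kernel_prodMk_left hs) hY]
    rfl
  have hfst : (P ⊗ₘ K).map Prod.fst = P := Measure.fst_compProd P K
  refine ⟨P ⊗ₘ K, hfst, hmap, fun h hi hm g hg hgb => ?_⟩
  have hi0 : Integrable h (P.map Y ⊗ₘ π.condKernel) := by rwa [hd]
  have hb : ∀ᵐ x ∂(P.map Y), ∫ y, h (x, y) ∂(π.condKernel x) = 0 := by
    refine Integrable.ae_eq_zero_of_forall_setIntegral_eq_zero hi0.integral_compProd
      fun s hs _ => ?_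
    have hs1 := hm (s.indicator fun _ => 1) (measurable_const.indicator hs)
      ⟨1, fun x => by by_cases hx : x ∈ s <;> simp [hx]⟩
    have i : Integrable (fun z : ℝ × ℝ => s.indicator (fun _ => (1 : ℝ)) z.1 * h z)
        (P.map Y ⊗ₘ π.condKernel) :=
      integrable_bdd_mul ((measurable_const.indicator hs).comp measurable_fst)
        ⟨1, fun x => by by_cases hx : x.1 ∈ s <;> simp [hx]⟩ hi0
    rw [← hd, Measure.integral_compProd i] at hs1
    rw [← hs1, ← integral_indicator hs]
    congr 1 with x
    by_cases hx : x ∈ s <;> simp [hx]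
  have hi1 : Integrable (fun w : Ω × ℝ => h (Y w.1, w.2)) (P ⊗ₘ K) := by
    rw [← hmap] at hi
    exact hi.comp_measurable (by fun_prop)
  have hi2 : Integrable (fun w : Ω × ℝ => g w.1 * h (Y w.1, w.2)) (P ⊗ₘ K) :=
    integrable_bdd_mul (hg.comp measurable_fst) (hgb.imp fun C hC x => hC _) hi1
  rw [Measure.integral_compProd hi2]
  refine integral_eq_zero_of_ae ?_
  filter_upwards [ae_of_ae_map hY.aemeasurable hb] with ω hω
  have h2 : ∫ y, h (Y ω, y) ∂(K ω) = 0 := hω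
  rw [integral_const_mul, h2]
  simp

/-- Gluing of a martingale coupling. -/
lemma IsMart.exists_glue {Ω : Type*} [MeasurableSpace Ω] {P : Measure Ω} [IsProbabilityMeasure P]
    {Y : Ω → ℝ} (hY : Measurable Y) (h : IsMart (P.map Y) ν π) (hμ : IsP1 (P.map Y))
    (hν : IsP1 ν) :
    ∃ Q : Measure (Ω × ℝ), Q.map Prod.fst = P ∧ Q.map (fun w => (Y w.1, w.2)) = π ∧
      ∀ g : Ω → ℝ, Measurable g → (∃ C, ∀ x, |g x| ≤ C) →
        ∫ w, g w.1 * (w.2 - Y w.1) ∂Q = 0 := by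
  have := h.prob hμ
  obtain ⟨Q, h1, h2, h3⟩ := _root_.exists_glue hY h.fst
  exact ⟨Q, h1, h2, h3 (fun z => z.2 - z.1) ((h.integrable_snd hν).sub (h.integrable_fst hμ))
    h.mart⟩

lemma IsMart.trans {ρ : Measure ℝ} {π' : Measure (ℝ × ℝ)} (h : IsMart μ ν π)
    (h' : IsMart ν ρ π') (hμ : IsP1 μ) (hν : IsP1 ν) (hρ : IsP1 ρ) :
    ∃ π'', IsMart μ ρ π'' := by
  have := h.prob hμ
  rw [← h.snd] at h' hν
  obtain ⟨Q, hQ1, hQ2, hQ3⟩ := h'.exists_glue measurable_snd hν hρ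
  have key := isMart_of_map (P := Q) (X := fun w => w.1.1) (Y := fun w => w.2)
    (by fun_prop) (by fun_prop) ?_
  · refine ⟨Q.map fun w => (w.1.1, w.2), ?_⟩
    have e1 : Q.map (fun w => w.1.1) = μ := by
      rw [← h.fst, ← hQ1, Measure.map_map (by fun_prop) (by fun_prop)]; rfl
    have e2 : Q.map (fun w => w.2) = ρ := by
      rw [← h'.snd, ← hQ2, Measure.map_map (by fun_prop) (by fun_prop)]; rfl
    rwa [e1, e2] at key
  · intro f hf hfb
    have hi0 : Integrable (fun z : ℝ × ℝ => z.2 - z.1) π' :=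
      (h'.integrable_snd hρ).sub (h'.integrable_fst hν)
    have hi1 : Integrable (fun w : (ℝ × ℝ) × ℝ => w.2 - w.1.2) Q := by
      rw [← hQ2] at hi0
      exact hi0.comp_measurable (by fun_prop)
    have hi2 : Integrable (fun z : ℝ × ℝ => z.2 - z.1) π := by
      refine Integrable.sub ?_ (h.integrable_fst hμ)
      exact hν.int.comp_measurable measurable_snd
    have hi3 : Integrable (fun w : (ℝ × ℝ) × ℝ => w.1.2 - w.1.1) Q := by
      rw [← hQ1] at hi2
      exact hi2.comp_measurable measurable_fst
    have h1 := hQ3 (fun w => f w.1) (by fun_prop) (hfb.imp fun C hC x => hC _)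
    have h2 : ∫ w, f w.1.1 * (w.1.2 - w.1.1) ∂Q = 0 := by
      rw [← h.mart f hf hfb, ← hQ1, integral_map (by fun_prop) (by fun_prop)]
    have h3 : ∀ w : (ℝ × ℝ) × ℝ, f w.1.1 * (w.2 - w.1.1) =
      f w.1.1 * (w.2 - w.1.2) + f w.1.1 * (w.1.2 - w.1.1) := fun w => by ring
    simp_rw [h3]
    rw [integral_add, h1, h2, add_zero]
    · exact integrable_bdd_mul (by fun_prop) (hfb.imp fun C hC x => hC _) hi1
    · exact integrable_bdd_mul (by fun_prop) (hfb.imp fun C hC x => hC _) hi3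

end basic

section gap

variable {μ ν : Measure ℝ} {π : Measure (ℝ × ℝ)}

/-- The excess of `|y - z|` over its tangent line at `x`. -/
def gap (z : ℝ) (w : ℝ × ℝ) : ℝ :=
  |w.2 - z| - |w.1 - z| - (if w.1 ≤ z then -1 else 1) * (w.2 - w.1)

lemma gap_nonneg (z : ℝ) (w : ℝ × ℝ) : 0 ≤ gap z w := by
  unfold gap
  split_ifs with h
  · rw [abs_of_nonpos (by linarith : w.1 - z ≤ 0)]
    linarith [neg_abs_le (w.2 - z)]
  · rw [abs_of_nonneg (by linarith : 0 ≤ w.1 - z)]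
    linarith [le_abs_self (w.2 - z)]

lemma measurable_sign_le (z : ℝ) : Measurable fun x : ℝ => if x ≤ z then (-1 : ℝ) else 1 :=
  Measurable.ite measurableSet_Iic measurable_const measurable_const

lemma sign_le_bdd (z : ℝ) : ∃ C, ∀ x : ℝ, |if x ≤ z then (-1 : ℝ) else 1| ≤ C :=
  ⟨1, fun x => by split_ifs <;> simp⟩

lemma IsMart.integral_gap (h : IsMart μ ν π) (hμ : IsP1 μ) (hν : IsP1 ν) (z : ℝ) :
    Integrable (gap z) π ∧ ∫ w, gap z w ∂π = pot ν z - pot μ z := by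
  have := h.prob hμ
  have i1 : Integrable (fun w : ℝ × ℝ => |w.2 - z|) π :=
    ((h.integrable_snd hν).sub (integrable_const z)).abs
  have i2 : Integrable (fun w : ℝ × ℝ => |w.1 - z|) π :=
    ((h.integrable_fst hμ).sub (integrable_const z)).abs
  have i3 : Integrable (fun w : ℝ × ℝ => (if w.1 ≤ z then (-1 : ℝ) else 1) * (w.2 - w.1)) π :=
    integrable_bdd_mul ((measurable_sign_le z).comp measurable_fst)
      ((sign_le_bdd z).imp fun C hC x => hC _) ((h.integrable_snd hν).sub (h.integrable_fst hμ))
  have i12 : Integrable (fun w : ℝ × ℝ => |w.2 - z| - |w.1 - z|) π := i1.sub i2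
  refine ⟨i12.sub i3, ?_⟩
  unfold gap
  rw [integral_sub i12 i3, integral_sub i1 i2, h.mart _ (measurable_sign_le z)
    (sign_le_bdd z), sub_zero, ← pot_map measurable_snd, ← pot_map measurable_fst, h.fst, h.snd]

lemma IsMart.pot_le (h : IsMart μ ν π) (hμ : IsP1 μ) (hν : IsP1 ν) (z : ℝ) :
    pot μ z ≤ pot ν z := by
  have h1 := (h.integral_gap hμ hν z).2
  have h2 : 0 ≤ ∫ w, gap z w ∂π := integral_nonneg (gap_nonneg z)
  linarith

lemma IsMart.integral_eq (h : IsMart μ ν π) (hμ : IsP1 μ) (hν : IsP1 ν) :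
    ∫ y, y ∂μ = ∫ y, y ∂ν := by
  have h1 := h.mart (fun _ => 1) measurable_const ⟨1, fun x => by simp⟩
  simp only [one_mul] at h1
  rw [integral_sub (h.integrable_snd hν) (h.integrable_fst hμ)] at h1
  rw [← h.fst, ← h.snd, integral_map (by fun_prop) (by fun_prop),
    integral_map (by fun_prop) (by fun_prop)]
  linarith

end gap

/-- Sweeping the mass of `p` inside `(a, b)` to the endpoints. -/
lemma IsP1.exists_balayage {p : Measure ℝ} (hp : IsP1 p) {a b : ℝ} (hab : a < b) :
    ∃ (p' : Measure ℝ) (π : Measure (ℝ × ℝ)), IsP1 p' ∧ IsMart p p' π ∧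
      (∀ z ∉ Set.Ioo a b, pot p' z = pot p z) ∧
      ∀ z ∈ Set.Icc a b, (b - a) * pot p' z = (b - z) * pot p a + (z - a) * pot p b := by
  have := hp.prob
  let ν : Measure ℝ := volume.restrict (Set.Icc 0 1)
  have : IsProbabilityMeasure ν := ⟨by simp [ν]⟩
  let Y : ℝ × ℝ → ℝ := fun w =>
    if w.1 ∈ Set.Ioo a b then (if w.2 ≤ (b - w.1) / (b - a) then a else b) else w.1
  have hY : Measurable Y := by
    refine Measurable.ite (measurableSet_Ioo.preimage measurable_fst) ?_ measurable_fst
    exact Measurable.ite (measurableSet_le (by fun_prop) (by fun_prop)) measurable_const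
      measurable_const
  have hfst : (p.prod ν).map Prod.fst = p := by simp [Measure.map_fst_prod]
  have hXi : Integrable (fun w : ℝ × ℝ => w.1) (p.prod ν) :=
    Integrable.comp_measurable (f := Prod.fst) (by rw [hfst]; exact hp.int) measurable_fst
  have hYi : Integrable Y (p.prod ν) := by
    refine ((hXi.abs.add (integrable_const |a|)).add (integrable_const |b|)).mono'
      hY.aestronglyMeasurable (ae_of_all _ fun w => ?_)
    simp only [Real.norm_eq_abs, Y, Pi.add_apply]
    have := abs_nonneg a
    have := abs_nonneg b
    have := abs_nonneg w.1
    split_ifs <;> linarith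
  have hYout : ∀ w, Y w ∉ Set.Ioo a b := by
    intro w
    simp only [Y]
    split_ifs with h1 h2
    · simp
    · simp
    · exact h1
  -- averaging over the auxiliary uniform variable
  have avg : ∀ (x : ℝ) (F : ℝ → ℝ), x ∈ Set.Ioo a b →
      ∫ u, F (Y (x, u)) ∂ν = ((b - x) * F a + (x - a) * F b) / (b - a) := by
    intro x F hx
    have hba : 0 < b - a := sub_pos.2 hab
    have h1 : ∀ u, F (Y (x, u)) = F b + (Set.Iic ((b - x) / (b - a))).indicator
        (fun _ => F a - F b) u := by
      intro u
      simp only [Y, hx, if_true, Set.indicator, Set.mem_Iic]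
      split_ifs <;> ring
    simp_rw [h1]
    rw [integral_add (integrable_const _) ((integrable_const _).indicator measurableSet_Iic),
      integral_indicator_const _ measurableSet_Iic]
    have hw0 : 0 ≤ (b - x) / (b - a) := div_nonneg (by linarith [hx.2]) hba.le
    have hw1 : (b - x) / (b - a) ≤ 1 := (div_le_one hba).2 (by linarith [hx.1])
    have h2 : ν.real (Set.Iic ((b - x) / (b - a))) = (b - x) / (b - a) := by
      rw [measureReal_restrict_apply measurableSet_Iic]
      have : Set.Iic ((b - x) / (b - a)) ∩ Set.Icc 0 1 = Set.Icc 0 ((b - x) / (b - a)) := by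
        ext u
        simp only [Set.mem_inter_iff, Set.mem_Iic, Set.mem_Icc]
        constructor
        · rintro ⟨h1, h2, h3⟩; exact ⟨h2, h1⟩
        · rintro ⟨h1, h2⟩; exact ⟨h2, h1, h2.trans hw1⟩
      rw [this, Real.volume_real_Icc_of_le hw0, sub_zero]
    rw [h2]
    simp only [integral_const, probReal_univ, smul_eq_mul]
    field_simp
    ring
  have avg' : ∀ (x : ℝ) (F : ℝ → ℝ), x ∉ Set.Ioo a b → ∫ u, F (Y (x, u)) ∂ν = F x := by
    intro x F hx
    have : ∀ u, Y (x, u) = x := fun u => if_neg hx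
    simp [this]
  have hpot : ∀ z ∉ Set.Ioo a b, ∫ w, |Y w - z| ∂(p.prod ν) = pot p z := by
    intro z hz
    have i : Integrable (fun w => |Y w - z|) (p.prod ν) := (hYi.sub (integrable_const z)).abs
    rw [integral_prod _ i, pot]
    congr 1 with x
    by_cases hx : x ∈ Set.Ioo a b
    · rw [avg x (fun y => |y - z|) hx, div_eq_iff (by linarith)]
      by_cases h1 : z ≤ a
      · rw [abs_of_nonneg (by linarith), abs_of_nonneg (by linarith),
          abs_of_nonneg (by linarith [hx.1])]
        ring
      · have h2 : b ≤ z := by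
          by_contra h3
          exact hz ⟨by linarith, by linarith⟩
        rw [abs_of_nonpos (by linarith), abs_of_nonpos (by linarith),
          abs_of_nonpos (by linarith [hx.2])]
        ring
    · exact avg' x (fun y => |y - z|) hx
  refine ⟨(p.prod ν).map Y, (p.prod ν).map fun w => (w.1, Y w), isP1_map hY hYi, ?_, ?_, ?_⟩
  · have h1 := isMart_of_map (P := p.prod ν) (X := Prod.fst) (Y := Y) measurable_fst hY ?_
    · rwa [hfst] at h1
    intro f hf hfb
    have h2 : Integrable (fun w : ℝ × ℝ => f w.1 * (Y w - w.1)) (p.prod ν) :=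
      integrable_bdd_mul (hf.comp measurable_fst) (hfb.imp fun C hC x => hC _) (hYi.sub hXi)
    rw [integral_prod _ h2]
    refine integral_eq_zero_of_ae (ae_of_all _ fun x => ?_)
    by_cases hx : x ∈ Set.Ioo a b
    · simp only [Pi.zero_apply]
      rw [avg x (fun y => f x * (y - x)) hx, div_eq_zero_iff]
      left; ring
    · simp only [Pi.zero_apply]
      rw [avg' x (fun y => f x * (y - x)) hx]; ring
  · intro z hz
    rw [pot_map hY, hpot z hz]
  · intro z hz
    rw [pot_map hY, ← hpot a (by simp), ← hpot b (by simp), ← integral_const_mul,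
      ← integral_const_mul, ← integral_const_mul, ← integral_add]
    · congr 1 with w
      by_cases h1 : Y w ≤ a
      · rw [abs_of_nonpos (by linarith [hz.1]), abs_of_nonpos (by linarith),
          abs_of_nonpos (by linarith)]
        ring
      · have h2 : b ≤ Y w := by
          by_contra h3
          exact hYout w ⟨by linarith, by linarith⟩
        rw [abs_of_nonneg (by linarith [hz.2]), abs_of_nonneg (by linarith),
          abs_of_nonneg (by linarith)]
        ring
    · exact ((hYi.sub (integrable_const _)).abs).const_mul _
    · exact ((hYi.sub (integrable_const _)).abs).const_mul _

lemma IsP1.mul_sub_le_pot {p : Measure ℝ} (hp : IsP1 p) {σ : ℝ} (hσ : σ = 1 ∨ σ = -1) (w : ℝ) :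
    σ * (w - ∫ y, y ∂p) ≤ pot p w := by
  have := hp.prob
  have h1 : σ * (w - ∫ y, y ∂p) = ∫ y, σ * (w - y) ∂p := by
    rw [integral_const_mul, integral_sub (integrable_const _) hp.int]
    simp
  rw [h1]
  refine integral_mono (((integrable_const w).sub hp.int).const_mul σ)
    (hp.integrable_abs_sub w) fun y => ?_
  rcases hσ with rfl | rfl
  · have := neg_abs_le (y - w); simp only; linarith
  · have := le_abs_self (y - w); simp only; linarith

section strassen

variable {p q : Measure ℝ}

/-- Slope of a tangent line to the potential at `z`. -/
def potSlope (q : Measure ℝ) (z : ℝ) : ℝ := ∫ y, (if y ≤ z then (1 : ℝ) else -1) ∂q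

lemma integrable_sign [IsProbabilityMeasure q] (z : ℝ) :
    Integrable (fun y : ℝ => if y ≤ z then (1 : ℝ) else -1) q := by
  refine (integrable_const (1 : ℝ)).mono' (Measurable.aestronglyMeasurable
    (Measurable.ite measurableSet_Iic measurable_const measurable_const)) (ae_of_all _ fun y => ?_)
  split_ifs <;> simp

lemma IsP1.tangent_le (hq : IsP1 q) (z w : ℝ) :
    pot q z + potSlope q z * (w - z) ≤ pot q w := by
  have := hq.prob
  have i := (integrable_sign (q := q) z).mul_const (w - z)
  rw [pot, potSlope, ← integral_mul_const, ← integral_add (hq.integrable_abs_sub z) i]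
  refine integral_mono ((hq.integrable_abs_sub z).add i) (hq.integrable_abs_sub w) fun y => ?_
  simp only
  split_ifs with h
  · rw [abs_of_nonpos (by linarith : y - z ≤ 0)]
    linarith [neg_abs_le (y - w)]
  · rw [abs_of_nonneg (by linarith : 0 ≤ y - z)]
    linarith [le_abs_self (y - w)]

lemma exists_tangent_le_pot (hp : IsP1 p) (hq : IsP1 q) (hm : ∫ y, y ∂p = ∫ y, y ∂q)
    {z : ℝ} (hz : pot p z < pot q z) {σ : ℝ} (hσ : σ = 1 ∨ σ = -1) :
    ∃ t, 0 < t ∧ pot q z + potSlope q z * (σ * t) ≤ pot p (z + σ * t) := by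
  have := hq.prob
  have hσ2 : σ * σ = 1 := by rcases hσ with rfl | rfl <;> norm_num
  have i : Integrable (fun y => 1 - σ * (if y ≤ z then (1 : ℝ) else -1)) q :=
    (integrable_const _).sub ((integrable_sign z).const_mul σ)
  have e : ∫ y, (1 - σ * (if y ≤ z then (1 : ℝ) else -1)) ∂q = 1 - σ * potSlope q z := by
    rw [integral_sub (integrable_const _) ((integrable_sign z).const_mul σ), integral_const_mul]
    simp [potSlope]
  have hn : ∀ y, 0 ≤ 1 - σ * (if y ≤ z then (1 : ℝ) else -1) := by
    intro y
    rcases hσ with rfl | rfl <;> split_ifs <;> norm_num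
  have hle : 0 ≤ 1 - σ * potSlope q z := e ▸ integral_nonneg hn
  rcases hle.eq_or_lt with h0 | h0
  · exfalso
    rw [← e, eq_comm, integral_eq_zero_iff_of_nonneg hn i] at h0
    have h1 : pot q z = ∫ y, σ * (z - y) ∂q := by
      refine integral_congr_ae ?_
      filter_upwards [h0] with y hy
      simp only [Pi.zero_apply] at hy
      split_ifs at hy with h
      · have : σ = 1 := by linarith
        rw [this, abs_of_nonpos (by linarith)]; ring
      · have : σ = -1 := by linarith
        rw [this, abs_of_nonneg (by linarith)]; ring
    rw [integral_const_mul, integral_sub (integrable_const _) hq.int] at h1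
    simp only [integral_const, probReal_univ, smul_eq_mul, one_mul] at h1
    have h2 := hp.mul_sub_le_pot hσ z
    rw [hm] at h2
    linarith
  · set A := pot q z - σ * (z - ∫ y, y ∂p)
    refine ⟨(|A| + 1) / (1 - σ * potSlope q z), by positivity, ?_⟩
    set t := (|A| + 1) / (1 - σ * potSlope q z) with ht
    have h1 : t * (1 - σ * potSlope q z) = |A| + 1 := by rw [ht]; field_simp
    have h2 := hp.mul_sub_le_pot hσ (z + σ * t)
    have h3 : σ * (z + σ * t - ∫ y, y ∂p) = σ * (z - ∫ y, y ∂p) + t := by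
      linear_combination t * hσ2
    rw [h3] at h2
    have h4 := le_abs_self A
    have h5 : A = pot q z - σ * (z - ∫ y, y ∂p) := rfl
    nlinarith

lemma exists_step (hp : IsP1 p) (hq : IsP1 q) (hm : ∫ y, y ∂p = ∫ y, y ∂q)
    (hle : ∀ z, pot p z ≤ pot q z) (z : ℝ) :
    ∃ (p' : Measure ℝ) (π : Measure (ℝ × ℝ)), IsP1 p' ∧ IsMart p p' π ∧
      (∀ w, pot p' w ≤ pot q w) ∧ pot p' z = pot q z := by
  rcases (hle z).eq_or_lt with h | h
  · refine ⟨p, p.map fun x => (x, x), hp, ?_, hle, h⟩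
    have := isMart_of_map (P := p) (X := id) (Y := id) measurable_id measurable_id ?_
    · simpa using this
    · intro f _ _; simp
  · have hcont : Continuous fun w => pot p w - (pot q z + potSlope q z * (w - z)) :=
      hp.lipschitz_pot.continuous.sub (by fun_prop)
    obtain ⟨t, ht, htb⟩ := exists_tangent_le_pot hp hq hm h (σ := 1) (by simp)
    obtain ⟨s, hs, hsb⟩ := exists_tangent_le_pot hp hq hm h (σ := -1) (by simp)
    obtain ⟨b, hb, hb0⟩ := intermediate_value_Icc (by linarith : z ≤ z + 1 * t)
      hcont.continuousOn (show (0 : ℝ) ∈ Set.Icc _ _ from ⟨by linarith, by linarith⟩)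
    obtain ⟨a, ha, ha0⟩ := intermediate_value_Icc' (by linarith : z + -1 * s ≤ z)
      hcont.continuousOn (show (0 : ℝ) ∈ Set.Icc _ _ from ⟨by linarith, by linarith⟩)
    simp only at hb0 ha0
    have hzb : z < b := by
      rcases hb.1.eq_or_lt with h1 | h1
      · rw [← h1] at hb0; linarith
      · exact h1
    have haz : a < z := by
      rcases ha.2.eq_or_lt with h1 | h1
      · rw [h1] at ha0; linarith
      · exact h1
    have hab : a < b := haz.trans hzb
    obtain ⟨p', π, h1, h2, h3, h4⟩ := hp.exists_balayage hab
    have h5 : ∀ w ∈ Set.Icc a b, pot p' w = pot q z + potSlope q z * (w - z) := by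
      intro w hw
      have h6 := h4 w hw
      have h7 : pot p a = pot q z + potSlope q z * (a - z) := by linarith
      have h8 : pot p b = pot q z + potSlope q z * (b - z) := by linarith
      rw [h7, h8] at h6
      have h9 : b - a ≠ 0 := by linarith
      apply mul_left_cancel₀ h9
      rw [h6]; ring
    refine ⟨p', π, h1, h2, fun w => ?_, ?_⟩
    · by_cases hw : w ∈ Set.Icc a b
      · rw [h5 w hw]; exact hq.tangent_le z w
      · rw [h3 w fun h6 => hw (Set.Ioo_subset_Icc_self h6)]; exact hle w
    · rw [h5 z ⟨haz.le, hzb.le⟩]; ring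

lemma exists_steps (hp : IsP1 p) (hq : IsP1 q) (hm : ∫ y, y ∂p = ∫ y, y ∂q)
    (hle : ∀ z, pot p z ≤ pot q z) (u : ℕ → ℝ) (n : ℕ) :
    ∃ (p' : Measure ℝ) (π : Measure (ℝ × ℝ)), IsP1 p' ∧ IsMart p p' π ∧
      (∀ w, pot p' w ≤ pot q w) ∧ ∀ i < n, pot p' (u i) = pot q (u i) := by
  induction n with
  | zero =>
    obtain ⟨p', π, h1, h2, h3, -⟩ := exists_step hp hq hm hle 0
    exact ⟨p', π, h1, h2, h3, by simp⟩
  | succ n ih =>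
    obtain ⟨p₁, π₁, h1, h2, h3, h4⟩ := ih
    obtain ⟨p₂, π₂, h5, h6, h7, h8⟩ := exists_step h1 hq
      ((h2.integral_eq hp h1).symm.trans hm) h3 (u n)
    obtain ⟨π, h9⟩ := h2.trans h6 hp h1 h5
    refine ⟨p₂, π, h5, h9, h7, fun i hi => ?_⟩
    rcases Nat.lt_succ_iff_lt_or_eq.1 hi with h | rfl
    · exact le_antisymm (h7 _) ((h4 i h).symm.le.trans (h6.pot_le h1 h5 _))
    · exact h8

end strassen

section tails

lemma max_abs_sub_eq {R : ℝ} (hR : 0 ≤ R) (y : ℝ) :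
    max (|y| - R) 0 = (|y - R| + |y - -R|) / 2 - R := by
  rcases le_total |y| R with h | h
  · obtain ⟨h1, h2⟩ := abs_le.1 h
    rw [max_eq_right (by linarith), abs_of_nonpos (by linarith), abs_of_nonneg (by linarith)]
    ring
  · rw [max_eq_left (by linarith)]
    rcases le_abs.1 h with h1 | h1
    · rw [abs_of_nonneg (by linarith : 0 ≤ y), abs_of_nonneg (by linarith),
        abs_of_nonneg (by linarith)]
      ring
    · rw [abs_of_nonpos (by linarith : y ≤ 0), abs_of_nonpos (by linarith),
        abs_of_nonpos (by linarith)]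
      ring

lemma IsP1.integral_tail {p : Measure ℝ} (hp : IsP1 p) {R : ℝ} (hR : 0 ≤ R) :
    Integrable (fun y : ℝ => max (|y| - R) 0) p ∧
      ∫ y, max (|y| - R) 0 ∂p = (pot p R + pot p (-R)) / 2 - R := by
  have := hp.prob
  simp_rw [max_abs_sub_eq hR]
  have i1 : Integrable (fun y : ℝ => |y - R| + |y - -R|) p :=
    (hp.integrable_abs_sub R).add (hp.integrable_abs_sub (-R))
  have i2 : Integrable (fun y : ℝ => (|y - R| + |y - -R|) / 2) p := i1.div_const 2
  refine ⟨i2.sub (integrable_const R), ?_⟩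
  rw [integral_sub i2 (integrable_const R), integral_div,
    integral_add (hp.integrable_abs_sub R) (hp.integrable_abs_sub (-R))]
  simp [pot]

lemma IsP1.tendsto_tail {p : Measure ℝ} (hp : IsP1 p) :
    Tendsto (fun R : ℕ => (pot p R + pot p (-R)) / 2 - R) atTop (𝓝 0) := by
  have h1 : Tendsto (fun R : ℕ => ∫ y, max (|y| - R) 0 ∂p) atTop (𝓝 (∫ _, (0 : ℝ) ∂p)) := by
    refine tendsto_integral_of_dominated_convergence (fun y => |y|)
      (fun n => by fun_prop) hp.int.abs (fun n => ae_of_all _ fun y => ?_)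
      (ae_of_all _ fun y => ?_)
    · rw [Real.norm_of_nonneg (le_max_right _ _)]
      exact max_le (by linarith [(Nat.cast_nonneg n : (0 : ℝ) ≤ n)]) (abs_nonneg y)
    · refine tendsto_const_nhds.congr' ?_
      filter_upwards [eventually_ge_atTop ⌈|y|⌉₊] with n hn
      rw [max_eq_right]
      linarith [(Nat.ceil_le.1 hn : |y| ≤ n)]
  rw [integral_zero] at h1
  exact h1.congr fun R => (hp.integral_tail (Nat.cast_nonneg R)).2

end tails

section compactness

variable {ι : Type*} {𝒰 : Ultrafilter ι}

/-- The amount by which the coordinates exceed `R`. -/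
def excess (R : ℝ) (z : ℝ × ℝ) : ℝ := max (|z.1| - R) 0 + max (|z.2| - R) 0

lemma continuous_excess (R : ℝ) : Continuous (excess R) := by
  unfold excess; fun_prop

lemma excess_nonneg (R : ℝ) (z : ℝ × ℝ) : 0 ≤ excess R z :=
  add_nonneg (le_max_right _ _) (le_max_right _ _)

lemma tendsto_of_bounded {P : ι → ProbabilityMeasure (ℝ × ℝ)} {ρ : ProbabilityMeasure (ℝ × ℝ)}
    (h : Tendsto P 𝒰 (𝓝 ρ)) {f : ℝ × ℝ → ℝ} (hf : Continuous f) {C : ℝ} (hC : ∀ z, |f z| ≤ C) :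
    Tendsto (fun n => ∫ z, f z ∂(P n : Measure (ℝ × ℝ))) 𝒰
      (𝓝 (∫ z, f z ∂(ρ : Measure (ℝ × ℝ)))) :=
  ProbabilityMeasure.tendsto_iff_forall_integral_tendsto.1 h
    (BoundedContinuousFunction.ofNormedAddCommGroup f hf C hC)

lemma integrable_of_tendsto_of_nonneg {P : ι → ProbabilityMeasure (ℝ × ℝ)}
    {ρ : ProbabilityMeasure (ℝ × ℝ)} (h : Tendsto P 𝒰 (𝓝 ρ)) {g : ℝ × ℝ → ℝ} (hg : Continuous g)
    (hg0 : ∀ z, 0 ≤ g z) (hgi : ∀ n, Integrable g (P n : Measure (ℝ × ℝ))) {T : ℝ}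
    (hT : Tendsto (fun n => ∫ z, g z ∂(P n : Measure (ℝ × ℝ))) 𝒰 (𝓝 T)) :
    Integrable g (ρ : Measure (ℝ × ℝ)) ∧ ∫ z, g z ∂(ρ : Measure (ℝ × ℝ)) ≤ T := by
  have hT0 : 0 ≤ T := ge_of_tendsto' hT fun n => integral_nonneg hg0
  have hb : ∀ (K : ℕ) z, |min (g z) K| ≤ K := fun K z => by
    rw [abs_of_nonneg (le_min (hg0 z) (Nat.cast_nonneg K))]; exact min_le_right _ _
  have hc : ∀ K : ℕ, Continuous fun z => min (g z) (K : ℝ) := fun K => by fun_prop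
  have hmi : ∀ (K : ℕ) (Q : ProbabilityMeasure (ℝ × ℝ)),
      Integrable (fun z => min (g z) (K : ℝ)) (Q : Measure (ℝ × ℝ)) := fun K Q =>
    (integrable_const (K : ℝ)).mono' (hc K).aestronglyMeasurable (ae_of_all _ (hb K))
  have h1 : ∀ K : ℕ, ∫ z, min (g z) (K : ℝ) ∂(ρ : Measure (ℝ × ℝ)) ≤ T := fun K =>
    le_of_tendsto_of_tendsto' (tendsto_of_bounded h (hc K) (hb K)) hT fun n =>
      integral_mono (hmi K _) (hgi n) fun z => min_le_left _ _
  have h2 : ∫⁻ z, ENNReal.ofReal (g z) ∂(ρ : Measure (ℝ × ℝ)) ≤ ENNReal.ofReal T := by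
    refine le_of_tendsto' (lintegral_tendsto_of_tendsto_of_monotone
      (f := fun (K : ℕ) z => ENNReal.ofReal (min (g z) (K : ℝ)))
      (fun K => (hc K).measurable.ennreal_ofReal.aemeasurable)
      (ae_of_all _ fun z K L hKL => ENNReal.ofReal_le_ofReal
        (min_le_min_left _ (Nat.cast_le.2 hKL)))
      (ae_of_all _ fun z => tendsto_const_nhds.congr' ?_)) fun K => ?_
    · filter_upwards [eventually_ge_atTop ⌈g z⌉₊] with n hn
      rw [min_eq_left (Nat.ceil_le.1 hn)]
    · rw [← ofReal_integral_eq_lintegral_ofReal (hmi K ρ)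
        (ae_of_all _ fun z => le_min (hg0 z) (Nat.cast_nonneg K))]
      exact ENNReal.ofReal_le_ofReal (h1 K)
  refine ⟨⟨hg.aestronglyMeasurable, ?_⟩, ?_⟩
  · rw [hasFiniteIntegral_iff_ofReal (ae_of_all _ hg0)]
    exact h2.trans_lt ENNReal.ofReal_lt_top
  · rw [integral_eq_lintegral_of_nonneg_ae (ae_of_all _ hg0) hg.aestronglyMeasurable]
    exact ENNReal.toReal_le_of_le_ofReal hT0 h2

lemma exists_tendsto_of_excess {P : ι → ProbabilityMeasure (ℝ × ℝ)} {M : ℝ}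
    (hi : ∀ n, Integrable (excess 0) (P n : Measure (ℝ × ℝ)))
    (hM : ∀ᶠ n in 𝒰, ∫ z, excess 0 z ∂(P n : Measure (ℝ × ℝ)) ≤ M) :
    ∃ ρ : ProbabilityMeasure (ℝ × ℝ), Tendsto P 𝒰 (𝓝 ρ) := by
  have hM0 : 0 ≤ M := by
    obtain ⟨n, hn⟩ := hM.exists
    exact (integral_nonneg (excess_nonneg 0)).trans hn
  have hu : Tendsto (fun n : ℕ => Real.toNNReal (M / ((n : ℝ) + 1))) atTop (𝓝 0) := by
    have := (tendsto_const_div_atTop_nhds_zero_nat M).comp (tendsto_add_atTop_nat 1)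
    have h2 := (continuous_real_toNNReal.tendsto 0).comp this
    rw [Real.toNNReal_zero] at h2
    refine h2.congr fun n => ?_
    simp
  have hS := isCompact_setOfPred_probabilityMeasure_mass_eq_compl_isCompact_le hu
    (K := fun n : ℕ => Metric.closedBall (0 : ℝ × ℝ) ((n : ℝ) + 1))
    (fun n => isCompact_closedBall _ _) (Or.inl inferInstance)
  obtain ⟨ρ, -, hρ⟩ := hS.ultrafilter_le_nhds (𝒰.map P) (by
    rw [le_principal_iff]
    change ∀ᶠ n in 𝒰, P n ∈ _
    filter_upwards [hM] with n hn k
    have hk : (0 : ℝ) < (k : ℝ) + 1 := by positivity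
    have h1 := mul_meas_ge_le_integral_of_nonneg (ae_of_all _ (excess_nonneg 0)) (hi n)
      ((k : ℝ) + 1)
    have h2 : (P n : Measure (ℝ × ℝ)).real (Metric.closedBall (0 : ℝ × ℝ) ((k : ℝ) + 1))ᶜ ≤
        (P n : Measure (ℝ × ℝ)).real {x | (k : ℝ) + 1 ≤ excess 0 x} := by
      refine measureReal_mono fun z hz => ?_
      simp only [Set.mem_compl_iff, Metric.mem_closedBall, dist_zero_right, not_le,
        Prod.norm_def, lt_max_iff, Real.norm_eq_abs] at hz
      have := abs_nonneg z.1
      have := abs_nonneg z.2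
      simp only [Set.mem_ofPred_eq, excess, sub_zero]
      rw [max_eq_left (abs_nonneg z.1), max_eq_left (abs_nonneg z.2)]
      rcases hz with hz | hz <;> linarith
    rw [← NNReal.coe_le_coe, Real.coe_toNNReal _ (by positivity)]
    change (P n : Measure (ℝ × ℝ)).real _ ≤ _
    rw [le_div_iff₀ hk]
    nlinarith)
  exact ⟨ρ, hρ⟩

lemma tendsto_of_excess {P : ι → ProbabilityMeasure (ℝ × ℝ)} {ρ : ProbabilityMeasure (ℝ × ℝ)}
    (h : Tendsto P 𝒰 (𝓝 ρ)) {T : ℕ → ℝ}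
    (hi : ∀ (R : ℕ) n, Integrable (excess R) (P n : Measure (ℝ × ℝ)))
    (hT : ∀ R : ℕ, Tendsto (fun n => ∫ z, excess R z ∂(P n : Measure (ℝ × ℝ))) 𝒰 (𝓝 (T R)))
    (hT0 : Tendsto T atTop (𝓝 0)) {f : ℝ × ℝ → ℝ} (hf : Continuous f) {C : ℝ}
    (hC : ∀ z, |f z| ≤ C * (1 + |z.1| + |z.2|)) :
    Tendsto (fun n => ∫ z, f z ∂(P n : Measure (ℝ × ℝ))) 𝒰
      (𝓝 (∫ z, f z ∂(ρ : Measure (ℝ × ℝ)))) := by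
  have hC0 : 0 ≤ C := by
    have := (abs_nonneg _).trans (hC 0)
    simpa using this
  have hρ := fun R : ℕ => integrable_of_tendsto_of_nonneg h (continuous_excess R)
    (excess_nonneg R) (hi R) (hT R)
  have hfi : ∀ Q : ProbabilityMeasure (ℝ × ℝ), Integrable (excess (0 : ℕ)) (Q : Measure (ℝ × ℝ)) →
      Integrable f (Q : Measure (ℝ × ℝ)) := fun Q hQ => by
    refine (((integrable_const (1 : ℝ)).add hQ).const_mul C).mono' hf.aestronglyMeasurable
      (ae_of_all _ fun z => (hC z).trans (le_of_eq ?_))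
    simp [excess, add_assoc]
  -- truncation at a level adapted to `R`
  let F : ℕ → ℝ × ℝ → ℝ := fun R z => max (-(C * (1 + 2 * R))) (min (f z) (C * (1 + 2 * R)))
  have hFc : ∀ R, Continuous (F R) := fun R => by fun_prop
  have hL : ∀ R : ℕ, 0 ≤ C * (1 + 2 * (R : ℝ)) := fun R => by positivity
  have hFb : ∀ R z, |F R z| ≤ C * (1 + 2 * R) := fun R z => by
    have := hL R
    exact abs_le.2 ⟨le_max_left _ _, max_le (by linarith) (min_le_right _ _)⟩
  have hFd : ∀ R z, |f z - F R z| ≤ C * excess R z := fun R z => by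
    have h0 := hL R
    have h1 : 0 ≤ C * excess R z := mul_nonneg hC0 (excess_nonneg _ _)
    have h2 : C * (1 + |z.1| + |z.2|) - C * (1 + 2 * R) ≤ C * excess R z := by
      rw [← mul_sub]
      refine mul_le_mul_of_nonneg_left ?_ hC0
      have := le_max_left (|z.1| - (R : ℝ)) 0
      have := le_max_left (|z.2| - (R : ℝ)) 0
      unfold excess; linarith
    obtain ⟨h3, h4⟩ := abs_le.1 (hC z)
    simp only [F]
    rcases le_total (f z) (C * (1 + 2 * R)) with h5 | h5
    · rw [min_eq_left h5]
      rcases le_total (-(C * (1 + 2 * R))) (f z) with h6 | h6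
      · rw [max_eq_right h6, sub_self, abs_zero]; exact h1
      · rw [max_eq_left h6, abs_of_nonpos (by linarith)]; linarith
    · rw [min_eq_right h5, max_eq_right (by linarith), abs_of_nonneg (by linarith)]; linarith
  have hFint : ∀ (Q : ProbabilityMeasure (ℝ × ℝ)) (R : ℕ),
      Integrable f (Q : Measure (ℝ × ℝ)) → Integrable (excess R) (Q : Measure (ℝ × ℝ)) →
      |∫ z, f z ∂(Q : Measure (ℝ × ℝ)) - ∫ z, F R z ∂(Q : Measure (ℝ × ℝ))| ≤
        C * ∫ z, excess R z ∂(Q : Measure (ℝ × ℝ)) := fun Q R hQf hQ => by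
    have h1 : Integrable (F R) (Q : Measure (ℝ × ℝ)) :=
      (integrable_const (C * (1 + 2 * (R : ℝ)))).mono' (hFc R).aestronglyMeasurable
        (ae_of_all _ (hFb R))
    rw [← integral_sub hQf h1, ← integral_const_mul]
    exact (abs_integral_le_integral_abs).trans
      (integral_mono (hQf.sub h1).abs (hQ.const_mul C) (hFd R))
  rw [Metric.tendsto_nhds]
  intro ε hε
  have hT1 : ∀ᶠ R in atTop, C * T R < ε / 6 := by
    have := (hT0.const_mul C)
    rw [mul_zero] at this
    exact this.eventually_lt_const (by positivity)
  obtain ⟨R, hR⟩ := hT1.exists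
  filter_upwards [((hT R).const_mul C).eventually_lt_const hR,
    Metric.tendsto_nhds.1 (tendsto_of_bounded h (hFc R) (hFb R)) (ε / 6) (by positivity)]
    with n hn1 hn2
  have h1 := hFint (P n) R (hfi _ (hi 0 n)) (hi R n)
  have h2 := hFint ρ R (hfi _ (hρ 0).1) (hρ R).1
  have h3 := mul_le_mul_of_nonneg_left (hρ R).2 hC0
  rw [Real.dist_eq] at hn2 ⊢
  rw [abs_le] at h1 h2
  rw [abs_lt] at hn2 ⊢
  constructor <;> linarith [h1.1, h1.2, h2.1, h2.2, hn2.1, hn2.2]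

end compactness

section

variable {μ ν : Measure ℝ} {π : Measure (ℝ × ℝ)}

lemma isMart_of_continuous [IsProbabilityMeasure π] (hμ : π.map Prod.fst = μ)
    (hν : π.map Prod.snd = ν) (h1 : Integrable (fun z : ℝ × ℝ => z.1) π)
    (h2 : Integrable (fun z : ℝ × ℝ => z.2) π)
    (h : ∀ f : ℝ → ℝ, Continuous f → (∃ C, ∀ x, |f x| ≤ C) → ∫ z, f z.1 * (z.2 - z.1) ∂π = 0) :
    IsMart μ ν π := by
  refine ⟨hμ, hν, ?_⟩
  have : IsProbabilityMeasure μ := by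
    rw [← hμ]; exact Measure.isProbabilityMeasure_map (by fun_prop)
  have hd : μ ⊗ₘ π.condKernel = π := by
    rw [← hμ]; exact π.disintegrate π.condKernel
  have key : ∀ f : ℝ → ℝ, Measurable f → (∃ C, ∀ x, |f x| ≤ C) →
      ∫ z, f z.1 * (z.2 - z.1) ∂π = ∫ x, f x * ∫ y, (y - x) ∂(π.condKernel x) ∂μ := by
    intro f hf hb
    have i : Integrable (fun z : ℝ × ℝ => f z.1 * (z.2 - z.1)) (μ ⊗ₘ π.condKernel) := by
      rw [hd]
      exact integrable_bdd_mul (hf.comp measurable_fst) (hb.imp fun C hC x => hC _) (h2.sub h1)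
    conv_lhs => rw [← hd]
    rw [Measure.integral_compProd i]
    simp_rw [integral_const_mul]
  have i0 : Integrable (fun z : ℝ × ℝ => z.2 - z.1) (μ ⊗ₘ π.condKernel) := by
    rw [hd]; exact h2.sub h1
  have hz : ∀ᵐ x ∂μ, ∫ y, (y - x) ∂(π.condKernel x) = 0 := by
    refine ae_eq_zero_of_integral_contDiff_smul_eq_zero
      (i0.integral_compProd).locallyIntegrable fun g hg hgc => ?_
    have hb : ∃ C, ∀ x, |g x| ≤ C := hgc.exists_bound_of_continuous hg.continuous
    simp only [smul_eq_mul]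
    rw [← key g hg.continuous.measurable hb]
    exact h g hg.continuous hb
  intro f hf hb
  rw [key f hf hb]
  refine integral_eq_zero_of_ae ?_
  filter_upwards [hz] with x hx
  simp [hx]

lemma IsMart.integral_excess (h : IsMart μ ν π) (hμ : IsP1 μ) (hν : IsP1 ν) {R : ℝ} (hR : 0 ≤ R) :
    Integrable (excess R) π ∧ ∫ z, excess R z ∂π =
      (pot μ R + pot μ (-R)) / 2 - R + ((pot ν R + pot ν (-R)) / 2 - R) := by
  have i1 : Integrable (fun z : ℝ × ℝ => max (|z.1| - R) 0) π :=
    Integrable.comp_measurable (f := Prod.fst) (g := fun y : ℝ => max (|y| - R) 0)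
      (by rw [h.fst]; exact (hμ.integral_tail hR).1) measurable_fst
  have i2 : Integrable (fun z : ℝ × ℝ => max (|z.2| - R) 0) π :=
    Integrable.comp_measurable (f := Prod.snd) (g := fun y : ℝ => max (|y| - R) 0)
      (by rw [h.snd]; exact (hν.integral_tail hR).1) measurable_snd
  refine ⟨i1.add i2, ?_⟩
  unfold excess
  rw [integral_add i1 i2, ← (hμ.integral_tail hR).2, ← (hν.integral_tail hR).2]
  congr 1
  · rw [← h.fst, integral_map (by fun_prop) (by fun_prop)]
  · rw [← h.snd, integral_map (by fun_prop) (by fun_prop)]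

end

/-- Martingale couplings are compact, with convergence against functions of linear growth. -/
lemma IsMart.exists_limit {ι : Type*} (𝒰 : Ultrafilter ι) {pn qn : ι → Measure ℝ}
    {πn : ι → Measure (ℝ × ℝ)} {p q : Measure ℝ} (hpn : ∀ n, IsP1 (pn n)) (hqn : ∀ n, IsP1 (qn n))
    (hp : IsP1 p) (hq : IsP1 q) (hpl : ∀ z, Tendsto (fun n => pot (pn n) z) 𝒰 (𝓝 (pot p z)))
    (hql : ∀ z, Tendsto (fun n => pot (qn n) z) 𝒰 (𝓝 (pot q z)))
    (h : ∀ n, IsMart (pn n) (qn n) (πn n)) :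
    ∃ π, IsMart p q π ∧ ∀ (f : ℝ × ℝ → ℝ) (C : ℝ), Continuous f →
      (∀ z, |f z| ≤ C * (1 + |z.1| + |z.2|)) →
      Tendsto (fun n => ∫ z, f z ∂(πn n)) 𝒰 (𝓝 (∫ z, f z ∂π)) := by
  let P : ι → ProbabilityMeasure (ℝ × ℝ) := fun n => ⟨πn n, (h n).prob (hpn n)⟩
  let T : ℕ → ℝ := fun R => (pot p R + pot p (-R)) / 2 - R + ((pot q R + pot q (-R)) / 2 - R)
  have hi : ∀ (R : ℕ) n, Integrable (excess R) (P n : Measure (ℝ × ℝ)) := fun R n =>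
    ((h n).integral_excess (hpn n) (hqn n) (Nat.cast_nonneg R)).1
  have hT : ∀ R : ℕ, Tendsto (fun n => ∫ z, excess R z ∂(P n : Measure (ℝ × ℝ))) 𝒰
      (𝓝 (T R)) := fun R => by
    refine Tendsto.congr (fun n =>
      ((h n).integral_excess (hpn n) (hqn n) (Nat.cast_nonneg R)).2.symm) ?_
    exact ((((hpl _).add (hpl _)).div_const 2).sub_const _).add
      ((((hql _).add (hql _)).div_const 2).sub_const _)
  have hT0 : Tendsto T atTop (𝓝 0) := by
    simpa using hp.tendsto_tail.add hq.tendsto_tail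
  obtain ⟨ρ, hρ⟩ := exists_tendsto_of_excess (𝒰 := 𝒰) (P := P) (M := T 0 + 1)
    (fun n => by simpa using hi 0 n) (by
      have := (hT 0).eventually_lt_const (lt_add_one (T 0))
      simp only [Nat.cast_zero] at this
      filter_upwards [this] with n hn using hn.le)
  have lim : ∀ (f : ℝ × ℝ → ℝ) (C : ℝ), Continuous f → (∀ z, |f z| ≤ C * (1 + |z.1| + |z.2|)) →
      Tendsto (fun n => ∫ z, f z ∂(πn n)) 𝒰 (𝓝 (∫ z, f z ∂(ρ : Measure (ℝ × ℝ)))) :=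
    fun f C hf hC => tendsto_of_excess hρ hi hT hT0 hf hC
  have hρi := (integrable_of_tendsto_of_nonneg hρ (continuous_excess _)
    (excess_nonneg _) (hi 0) (hT 0)).1
  simp only [Nat.cast_zero] at hρi
  have i1 : Integrable (fun z : ℝ × ℝ => z.1) (ρ : Measure (ℝ × ℝ)) := by
    refine hρi.mono' (by fun_prop) (ae_of_all _ fun z => ?_)
    simp [excess]
  have i2 : Integrable (fun z : ℝ × ℝ => z.2) (ρ : Measure (ℝ × ℝ)) := by
    refine hρi.mono' (by fun_prop) (ae_of_all _ fun z => ?_)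
    simp [excess]
  have e1 : (ρ : Measure (ℝ × ℝ)).map Prod.fst = p := by
    refine (isP1_map measurable_fst i1).eq_of_pot_eq hp fun z => ?_
    rw [pot_map measurable_fst]
    refine tendsto_nhds_unique (lim (fun w => |w.1 - z|) (1 + |z|) (by fun_prop) fun w => ?_) ?_
    · rw [abs_abs]
      have := abs_sub w.1 z
      nlinarith [abs_nonneg z, abs_nonneg w.1, abs_nonneg w.2,
        mul_nonneg (abs_nonneg z) (abs_nonneg w.1), mul_nonneg (abs_nonneg z) (abs_nonneg w.2)]
    · refine (hpl z).congr fun n => ?_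
      rw [← (h n).fst, pot_map measurable_fst]
  have e2 : (ρ : Measure (ℝ × ℝ)).map Prod.snd = q := by
    refine (isP1_map measurable_snd i2).eq_of_pot_eq hq fun z => ?_
    rw [pot_map measurable_snd]
    refine tendsto_nhds_unique (lim (fun w => |w.2 - z|) (1 + |z|) (by fun_prop) fun w => ?_) ?_
    · rw [abs_abs]
      have := abs_sub w.2 z
      nlinarith [abs_nonneg z, abs_nonneg w.1, abs_nonneg w.2,
        mul_nonneg (abs_nonneg z) (abs_nonneg w.1), mul_nonneg (abs_nonneg z) (abs_nonneg w.2)]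
    · refine (hql z).congr fun n => ?_
      rw [← (h n).snd, pot_map measurable_snd]
  refine ⟨ρ, isMart_of_continuous e1 e2 i1 i2 fun f hf hb => ?_, lim⟩
  obtain ⟨C, hC⟩ := hb
  have hC0 : 0 ≤ C := (abs_nonneg _).trans (hC 0)
  refine tendsto_nhds_unique (lim (fun w => f w.1 * (w.2 - w.1)) C (by fun_prop) fun w => ?_)
    (tendsto_const_nhds.congr fun n => ((h n).mart f hf.measurable ⟨C, hC⟩).symm)
  rw [abs_mul]
  refine mul_le_mul (hC _) ?_ (abs_nonneg _) hC0
  have := abs_sub w.2 w.1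
  linarith

/-- Strassen's theorem on the line, in terms of potentials. -/
lemma exists_isMart {p q : Measure ℝ} (hp : IsP1 p) (hq : IsP1 q)
    (hm : ∫ y, y ∂p = ∫ y, y ∂q) (hle : ∀ z, pot p z ≤ pot q z) : ∃ π, IsMart p q π := by
  choose p' π h1 h2 h3 h4 using exists_steps hp hq hm hle (TopologicalSpace.denseSeq ℝ)
  have hlim : ∀ z, Tendsto (fun n => pot (p' n) z) atTop (𝓝 (pot q z)) := by
    intro z
    rw [Metric.tendsto_atTop]
    intro ε hε
    obtain ⟨i, hi⟩ := (TopologicalSpace.denseRange_denseSeq ℝ).exists_dist_lt z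
      (show 0 < ε / 2 by positivity)
    refine ⟨i + 1, fun n hn => ?_⟩
    have e := h4 n i (by omega)
    have h5 := (h1 n).pot_le_pot_add (TopologicalSpace.denseSeq ℝ i) z
    have h6 := hq.pot_le_pot_add z (TopologicalSpace.denseSeq ℝ i)
    rw [Real.dist_eq] at hi ⊢
    rw [abs_sub_comm] at h5
    rw [abs_lt]
    constructor <;> linarith [h3 n z]
  obtain ⟨π, hπ, -⟩ := IsMart.exists_limit (hyperfilter ℕ) (pn := fun _ => p) (fun _ => hp) h1
    hp hq (fun z => tendsto_const_nhds)
    (fun z => (hlim z).mono_left Nat.hyperfilter_le_atTop) h2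
  exact ⟨π, hπ⟩

section noncrossing

variable {μ ν : Measure ℝ} {π : Measure (ℝ × ℝ)}

/-- Moving from `x` to `y` does not cross any point of `Z`. -/
def NoCross (Z : Set ℝ) (x y : ℝ) : Prop := ∀ z ∈ Z, (x ≤ z → y ≤ z) ∧ (z ≤ x → z ≤ y)

lemma exists_countable_noCross (Z : Set ℝ) :
    ∃ D ⊆ Z, D.Countable ∧ ∀ x y, NoCross D x y → NoCross Z x y := by
  obtain ⟨D, hDZ, hD, hDd⟩ :=
    (TopologicalSpace.IsSeparable.of_separableSpace Z).exists_countable_dense_subset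
  set A := {x ∈ Z | 𝓝[Z ∩ Set.Ioi x] x = ⊥}
  set B := {x ∈ Z | 𝓝[Z ∩ Set.Iio x] x = ⊥}
  have near : ∀ {s : Set ℝ}, IsOpen s → (Z ∩ s).Nonempty → ∃ d ∈ D, d ∈ s := by
    rintro s hs ⟨z, hz, hzs⟩
    obtain ⟨d, hd1, hd2⟩ := mem_closure_iff.1 (hDd hz) s hs hzs
    exact ⟨d, hd2, hd1⟩
  refine ⟨D ∪ A ∪ B, Set.union_subset (Set.union_subset hDZ fun x hx => hx.1) fun x hx => hx.1,
    (hD.union countable_setOfPred_isolated_right_within).union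
      countable_setOfPred_isolated_left_within, fun x y h z hz => ⟨fun hxz => ?_, fun hzx => ?_⟩⟩
  · by_cases hA : 𝓝[Z ∩ Set.Ioi z] z = ⊥
    · exact (h z (Or.inl (Or.inr ⟨hz, hA⟩))).1 hxz
    · refine le_of_forall_pos_le_add fun ε hε => ?_
      have : (Z ∩ Set.Ioo z (z + ε)).Nonempty := by
        by_contra h0
        refine hA (empty_mem_iff_bot.1 ?_)
        rw [mem_nhdsWithin_iff_exists_mem_nhds_inter]
        refine ⟨Set.Iio (z + ε), Iio_mem_nhds (by linarith), ?_⟩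
        rintro w ⟨h1, h2, h3⟩
        exact h0 ⟨w, h2, h3, h1⟩
      obtain ⟨d, hd, hd1, hd2⟩ := near isOpen_Ioo this
      exact ((h d (Or.inl (Or.inl hd))).1 (hxz.trans hd1.le)).trans hd2.le
  · by_cases hB : 𝓝[Z ∩ Set.Iio z] z = ⊥
    · exact (h z (Or.inr ⟨hz, hB⟩)).2 hzx
    · refine le_of_forall_pos_le_add fun ε hε => ?_
      have : (Z ∩ Set.Ioo (z - ε) z).Nonempty := by
        by_contra h0
        refine hB (empty_mem_iff_bot.1 ?_)
        rw [mem_nhdsWithin_iff_exists_mem_nhds_inter]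
        refine ⟨Set.Ioi (z - ε), Ioi_mem_nhds (by linarith), ?_⟩
        rintro w ⟨h1, h2, h3⟩
        exact h0 ⟨w, h2, h1, h3⟩
      obtain ⟨d, hd, hd1, hd2⟩ := near isOpen_Ioo this
      linarith [(h d (Or.inl (Or.inl hd))).2 (hd2.le.trans hzx)]

lemma gap_eq_zero_iff (z : ℝ) (w : ℝ × ℝ) :
    gap z w = 0 ↔ (w.1 ≤ z → w.2 ≤ z) ∧ (z < w.1 → z ≤ w.2) := by
  unfold gap
  split_ifs with h
  · rw [abs_of_nonpos (by linarith : w.1 - z ≤ 0)]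
    simp only [h, not_lt.2 h, forall_const, false_imp_iff, and_true]
    rcases le_total w.2 z with h1 | h1
    · rw [abs_of_nonpos (by linarith)]; exact ⟨fun _ => h1, fun _ => by ring⟩
    · rw [abs_of_nonneg (by linarith)]; exact ⟨fun h => by linarith, fun h => by linarith⟩
  · rw [abs_of_nonneg (by linarith : 0 ≤ w.1 - z)]
    simp only [h, not_le.1 h, forall_const, false_imp_iff, true_and]
    rcases le_total w.2 z with h1 | h1
    · rw [abs_of_nonpos (by linarith)]; exact ⟨fun h => by linarith, fun h => by linarith⟩
    · rw [abs_of_nonneg (by linarith)]; exact ⟨fun _ => h1, fun _ => by ring⟩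

lemma IsMart.ae_of_pot_eq (h : IsMart μ ν π) (hμ : IsP1 μ) (hν : IsP1 ν) {z : ℝ}
    (hz : pot μ z = pot ν z) :
    ∀ᵐ w ∂π, (w.1 ≤ z → w.2 ≤ z) ∧ (z ≤ w.1 → z ≤ w.2) := by
  obtain ⟨hi, he⟩ := h.integral_gap hμ hν z
  rw [hz, sub_self, integral_eq_zero_iff_of_nonneg (gap_nonneg z) hi] at he
  have hm : Measurable (Set.indicator {z} fun _ : ℝ => (-1 : ℝ)) :=
    measurable_const.indicator (measurableSet_singleton z)
  have hb : ∃ C, ∀ x, |Set.indicator {z} (fun _ : ℝ => (-1 : ℝ)) x| ≤ C :=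
    ⟨1, fun x => by by_cases hx : x ∈ ({z} : Set ℝ) <;> simp [Set.indicator, hx]⟩
  have h1 := h.mart _ hm hb
  have i : Integrable (fun w : ℝ × ℝ => Set.indicator {z} (fun _ : ℝ => (-1 : ℝ)) w.1 *
      (w.2 - w.1)) π :=
    integrable_bdd_mul (hm.comp measurable_fst)
      (hb.imp fun C hC x => hC _) ((h.integrable_snd hν).sub (h.integrable_fst hμ))
  rw [integral_eq_zero_iff_of_nonneg_ae ?_ i] at h1
  · filter_upwards [he, h1] with w hw1 hw2
    obtain ⟨h3, h4⟩ := (gap_eq_zero_iff z w).1 hw1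
    refine ⟨h3, fun h5 => ?_⟩
    rcases h5.lt_or_eq with h6 | h6
    · exact h4 h6
    · simp only [h6, Pi.zero_apply, Set.mem_singleton_iff, Set.indicator_of_mem] at hw2
      linarith
  · filter_upwards [he] with w hw
    obtain ⟨h3, h4⟩ := (gap_eq_zero_iff z w).1 hw
    by_cases h6 : w.1 = z
    · have := h3 h6.le
      simp only [Pi.zero_apply, h6, Set.mem_singleton_iff, Set.indicator_of_mem]
      linarith
    · simp [h6]

lemma IsMart.ae_noCross (h : IsMart μ ν π) (hμ : IsP1 μ) (hν : IsP1 ν) :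
    ∀ᵐ w ∂π, NoCross {z | pot μ z = pot ν z} w.1 w.2 := by
  obtain ⟨D, hDZ, hD, hn⟩ := exists_countable_noCross {z | pot μ z = pot ν z}
  have : ∀ᵐ w ∂π, ∀ z ∈ D, (w.1 ≤ z → w.2 ≤ z) ∧ (z ≤ w.1 → z ≤ w.2) :=
    (ae_ball_iff hD).2 fun z hz => h.ae_of_pot_eq hμ hν (hDZ hz)
  filter_upwards [this] with w hw using hn _ _ hw

lemma NoCross.eq {Z : Set ℝ} {x y : ℝ} (h : NoCross Z x y) (hx : x ∈ Z) : y = x :=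
  le_antisymm ((h x hx).1 le_rfl) ((h x hx).2 le_rfl)

end noncrossing

/-- Martingale couplings of two measures that are both close to `ν` are close to the diagonal. -/
lemma IsP1.exists_near_diagonal {ν : Measure ℝ} (hν : IsP1 ν) {ε : ℝ} (hε : 0 < ε) :
    ∃ τ > 0, ∀ (p q : Measure ℝ) (M : Measure (ℝ × ℝ)), IsP1 p → IsP1 q → IsMart p q M →
      (∀ z, |pot p z - pot ν z| ≤ τ) → (∀ z, |pot q z - pot ν z| ≤ τ) →
      ∫ z, |z.2 - z.1| ∂M ≤ ε := by
  by_contra! hcon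
  have hτ : ∀ n : ℕ, (0 : ℝ) < 1 / ((n : ℝ) + 1) := fun n => by positivity
  choose p q M hp hq hM hpt hqt hlt using fun n : ℕ => hcon _ (hτ n)
  have lim : ∀ {a : ℕ → ℝ} {b : ℝ}, (∀ n, |a n - b| ≤ 1 / ((n : ℝ) + 1)) →
      Tendsto a (hyperfilter ℕ : Filter ℕ) (𝓝 b) := fun hab =>
    (tendsto_iff_dist_tendsto_zero.2 (squeeze_zero (fun _ => dist_nonneg) hab
      tendsto_one_div_add_atTop_nhds_zero_nat)).mono_left Nat.hyperfilter_le_atTop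
  obtain ⟨π, hπ, hl⟩ := IsMart.exists_limit (hyperfilter ℕ) hp hq hν hν
    (fun z => lim fun n => hpt n z) (fun z => lim fun n => hqt n z) hM
  have h1 := hl (fun z => |z.2 - z.1|) 1 (by fun_prop) fun z => by
    rw [abs_abs]; have := abs_sub z.2 z.1; linarith
  have h2 : ∫ z, |z.2 - z.1| ∂π = 0 := by
    refine integral_eq_zero_of_ae ?_
    filter_upwards [hπ.ae_noCross hν hν] with z hz
    have := hz.eq (by simp)
    simp [this]
  rw [h2] at h1
  have := ge_of_tendsto' h1 fun n => (hlt n).le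
  linarith

section truncation

variable {μ ν : Measure ℝ} {π : Measure (ℝ × ℝ)}

/-- Regression of the displacement on the first coordinate, given that the displacement is large. -/
lemma exists_regression [IsFiniteMeasure π] (hi : Integrable (fun z : ℝ × ℝ => z.2 - z.1) π) :
    ∃ N : ℝ → ℝ, Measurable N ∧ Integrable (fun z : ℝ × ℝ => N z.1) π ∧
      ∫ z, |N z.1| ∂π ≤ ∫ z, |z.2 - z.1| ∂π ∧
      ∀ f : ℝ → ℝ, Measurable f → (∃ C, ∀ x, |f x| ≤ C) →
        ∫ z, f z.1 * (z.2 - z.1 - N z.1) ∂π = 0 := by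
  have hle : MeasurableSpace.comap (Prod.fst : ℝ × ℝ → ℝ) inferInstance ≤ Prod.instMeasurableSpace :=
    measurable_fst.comap_le
  obtain ⟨N, hN, hNe⟩ := (stronglyMeasurable_condExp (m := .comap Prod.fst inferInstance) (μ := π)
    (f := fun z : ℝ × ℝ => z.2 - z.1)).measurable.exists_eq_measurable_comp
  have hNe' : ∀ z : ℝ × ℝ, N z.1 =
      (π[fun z : ℝ × ℝ => z.2 - z.1 | .comap Prod.fst inferInstance]) z := fun z => by
    rw [hNe]; rfl
  have hNi : Integrable (fun z : ℝ × ℝ => N z.1) π := by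
    simp_rw [hNe']; exact integrable_condExp
  refine ⟨N, hN, hNi, ?_, fun f hf hb => ?_⟩
  · simp_rw [hNe']; exact integral_abs_condExp_le _
  · have i1 := integrable_bdd_mul (P := π) (hf.comp measurable_fst)
      (hb.imp fun C hC x => hC _) hi
    have i2 := integrable_bdd_mul (P := π) (hf.comp measurable_fst)
      (hb.imp fun C hC x => hC _) hNi
    simp only [Function.comp_apply] at i1 i2
    simp_rw [mul_sub (f _) (_ - _)]
    rw [integral_sub i1 i2, sub_eq_zero]
    obtain ⟨C, hC⟩ := hb
    have h1 := condExp_stronglyMeasurable_mul_of_bound (m := .comap Prod.fst inferInstance) hle (μ := π)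
      (f := fun z : ℝ × ℝ => f z.1) (g := fun z : ℝ × ℝ => z.2 - z.1)
      (hf.comp (comap_measurable Prod.fst)).stronglyMeasurable hi C (ae_of_all _ fun z => hC _)
    have h2 := integral_condExp (m := .comap Prod.fst inferInstance) hle (μ := π)
      (f := (fun z : ℝ × ℝ => f z.1) * fun z : ℝ × ℝ => z.2 - z.1)
    rw [integral_congr_ae h1] at h2
    simp only [Pi.mul_apply, ← hNe'] at h2
    exact h2.symm

lemma IsMart.exists_truncation (h : IsMart μ ν π) (hμ : IsP1 μ) (hν : IsP1 ν) {ε : ℝ}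
    (hε : 0 < ε) :
    ∃ (T : ℝ × ℝ → ℝ) (ρ : ℝ → ℝ), Measurable T ∧ Measurable ρ ∧ Integrable T π ∧
      IsMart μ (π.map T) (π.map fun z => (z.1, T z)) ∧ (∀ z, pot (π.map T) z ≤ pot ν z) ∧
      (∀ z, |T z - z.1| ≤ ρ z.1) ∧ ∫ z, |T z - z.2| ∂π ≤ ε := by
  have := h.prob hμ
  have i0 : Integrable (fun z : ℝ × ℝ => z.2 - z.1) π :=
    (h.integrable_snd hν).sub (h.integrable_fst hμ)
  have hA : ∀ R : ℝ, MeasurableSet {z : ℝ × ℝ | R < |z.2 - z.1|} := fun R =>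
    measurableSet_lt (by fun_prop) (by fun_prop)
  have hlim : Tendsto (fun n : ℕ => ∫ z in {z : ℝ × ℝ | (n : ℝ) < |z.2 - z.1|}, |z.2 - z.1| ∂π)
      atTop (𝓝 0) := by
    have h1 : Tendsto (fun n : ℕ => ∫ z, {z : ℝ × ℝ | (n : ℝ) < |z.2 - z.1|}.indicator
        (fun z => |z.2 - z.1|) z ∂π) atTop (𝓝 (∫ _, (0 : ℝ) ∂π)) := by
      refine tendsto_integral_of_dominated_convergence (fun z => |z.2 - z.1|)
        (fun n => (Measurable.indicator (by fun_prop) (hA n)).aestronglyMeasurable) i0.abs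
        (fun n => ae_of_all _ fun z => ?_) (ae_of_all _ fun z => ?_)
      · refine (norm_indicator_le_norm_self _ _).trans ?_
        simp
      · refine tendsto_const_nhds.congr' ?_
        filter_upwards [eventually_ge_atTop ⌈|z.2 - z.1|⌉₊] with n hn
        rw [Set.indicator_of_notMem]
        exact not_lt.2 (Nat.ceil_le.1 hn)
    simp_rw [integral_indicator (hA _), integral_zero] at h1
    exact h1
  obtain ⟨R, hR⟩ := (hlim.eventually_lt_const (show 0 < ε / 2 by positivity)).exists
  set A := {z : ℝ × ℝ | (R : ℝ) < |z.2 - z.1|}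
  obtain ⟨N, hN, hNi, hNle, hNm⟩ := exists_regression (π := π.restrict A) i0.restrict
  let D : ℝ × ℝ → ℝ := A.indicator fun z => z.2 - z.1 - N z.1
  have hDm : Measurable D := Measurable.indicator (by fun_prop) (hA R)
  have hDi : Integrable D π := (integrable_indicator_iff (hA R)).2 (i0.restrict.sub hNi)
  have hD0 : ∀ f : ℝ → ℝ, Measurable f → (∃ C, ∀ x, |f x| ≤ C) → ∫ z, f z.1 * D z ∂π = 0 := by
    intro f hf hb
    rw [← hNm f hf hb, ← integral_indicator (hA R)]
    congr 1 with z
    by_cases hz : z ∈ A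
    · rw [Set.indicator_of_mem hz]; simp [D, hz]
    · rw [Set.indicator_of_notMem hz]; simp [D, hz]
  let T : ℝ × ℝ → ℝ := fun z => z.2 - D z
  have hT : Measurable T := by fun_prop
  have hTi : Integrable T π := (h.integrable_snd hν).sub hDi
  have hTA : ∀ z ∈ A, T z = z.1 + N z.1 := fun z hz => by
    simp only [T, D, hz, Set.indicator_of_mem]; ring
  have hTA' : ∀ z ∉ A, T z = z.2 := fun z hz => by simp [T, D, hz]
  refine ⟨T, fun x => max R |N x|, hT, by fun_prop, hTi, ?_, ?_, fun z => ?_, ?_⟩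
  · have h1 := isMart_of_map (P := π) measurable_fst hT fun f hf hb => ?_
    · rwa [h.fst] at h1
    have i1 := integrable_bdd_mul (P := π) (hf.comp measurable_fst)
      (hb.imp fun C hC x => hC _) i0
    have i2 := integrable_bdd_mul (P := π) (hf.comp measurable_fst)
      (hb.imp fun C hC x => hC _) hDi
    simp only [Function.comp_apply] at i1 i2
    have e : ∀ z : ℝ × ℝ, f z.1 * (T z - z.1) = f z.1 * (z.2 - z.1) - f z.1 * D z := fun z => by
      simp only [T]; ring
    simp_rw [e]
    rw [integral_sub i1 i2, h.mart f hf hb, hD0 f hf hb, sub_zero]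
  · have h1 := isMart_of_map (P := π) hT measurable_snd fun f hf hb => ?_
    · rw [h.snd] at h1
      exact h1.pot_le (isP1_map hT hTi) hν
    rw [← hD0 (fun x => f (x + N x)) (hf.comp (by fun_prop)) (hb.imp fun C hC x => hC _)]
    congr 1 with z
    by_cases hz : z ∈ A
    · rw [hTA z hz]; simp [D, hz]; left; ring
    · rw [hTA' z hz]; simp [D, hz]
  · by_cases hz : z ∈ A
    · rw [hTA z hz]; simp
    · rw [hTA' z hz]
      exact (not_lt.1 hz).trans (le_max_left _ _)
  · have e : ∀ z, |T z - z.2| = A.indicator (fun z => |z.2 - z.1 - N z.1|) z := fun z => by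
      by_cases hz : z ∈ A
      · rw [hTA z hz, Set.indicator_of_mem hz, abs_sub_comm]
        congr 1; ring
      · simp [hTA' z hz, hz]
    simp_rw [e]
    rw [integral_indicator (hA R)]
    have h1 : ∫ z in A, |z.2 - z.1 - N z.1| ∂π ≤ ∫ z in A, (|z.2 - z.1| + |N z.1|) ∂π :=
      integral_mono (i0.restrict.sub hNi).abs (i0.restrict.abs.add hNi.abs) fun z => abs_sub _ _
    rw [integral_add i0.restrict.abs hNi.abs] at h1
    linarith

end truncation

section contraction

lemma isClosed_noCross (Z : Set ℝ) (x : ℝ) : IsClosed {y | NoCross Z x y} := by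
  have : {y | NoCross Z x y} = (⋂ z ∈ Z ∩ Set.Ici x, Set.Iic z) ∩
      ⋂ z ∈ Z ∩ Set.Iic x, Set.Ici z := by
    ext y
    simp only [NoCross, Set.mem_inter_iff, Set.mem_iInter, Set.mem_Iic, Set.mem_Ici, and_imp]
    exact ⟨fun h => ⟨fun z hz => (h z hz).1, fun z hz => (h z hz).2⟩,
      fun h z hz => ⟨h.1 z hz, h.2 z hz⟩⟩
  rw [this]
  exact (isClosed_biInter fun _ _ => isClosed_Iic).inter (isClosed_biInter fun _ _ => isClosed_Ici)

lemma exists_lower_bound_of_noCross {U : ℝ → ℝ} (hU : ∀ a b, |U a - U b| ≤ 2 * |a - b|)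
    (h0 : ∀ a, 0 ≤ U a) {x : ℝ} (hx : U x ≠ 0) (ρ : ℝ) {η : ℝ} (hη : 0 < η) (hη1 : η < 1) :
    ∃ n₀ : ℕ, ∀ n ≥ n₀, ∀ y, NoCross {z | U z = 0} x y → |y - x| ≤ ρ →
      |y - x| ≤ (n : ℝ) + 1 ∧ ∀ t ∈ Set.Icc (0 : ℝ) 1, ∀ s ∈ Set.Icc (-1 : ℝ) 1,
        1 / ((n : ℝ) + 1) ≤ U (x + t * ((1 - η) * (y - x)) + s * (1 / ((n : ℝ) + 1))) := by
  have hUc : Continuous U := by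
    refine (LipschitzWith.of_dist_le_mul (K := 2) fun a b => ?_).continuous
    simpa [Real.dist_eq] using hU a b
  set S := {y | NoCross {z | U z = 0} x y} ∩ Metric.closedBall x ρ
  have hS : IsCompact S := (isCompact_closedBall x ρ).inter_left (isClosed_noCross _ x)
  set K := (fun w : ℝ × ℝ => x + w.2 * ((1 - η) * (w.1 - x))) '' (S ×ˢ Set.Icc 0 1)
  have hK : IsCompact K := (hS.prod isCompact_Icc).image (by fun_prop)
  have hpos : ∀ k ∈ K, 0 < U k := by
    rintro k ⟨⟨y, t⟩, ⟨⟨hy, -⟩, ht0, ht1⟩, rfl⟩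
    refine (h0 _).lt_of_ne fun hk => ?_
    have h1 := hy _ hk.symm
    simp only at ht0 ht1 h1 hk
    rcases lt_trichotomy x y with h | h | h
    · have h2 : 0 ≤ t * ((1 - η) * (y - x)) :=
        mul_nonneg ht0 (mul_nonneg (by linarith) (by linarith))
      have h3 := h1.1 (by linarith)
      have h4 := mul_le_of_le_one_left (mul_nonneg (by linarith : 0 ≤ 1 - η)
        (by linarith : 0 ≤ y - x)) ht1
      nlinarith
    · subst h
      simp only [sub_self, mul_zero, add_zero] at hk
      exact hx hk.symm
    · have h2 : 0 ≤ t * ((1 - η) * (x - y)) :=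
        mul_nonneg ht0 (mul_nonneg (by linarith) (by linarith))
      have h5 : t * ((1 - η) * (y - x)) = -(t * ((1 - η) * (x - y))) := by ring
      have h3 := h1.2 (by linarith)
      have h4 := mul_le_of_le_one_left (mul_nonneg (by linarith : 0 ≤ 1 - η)
        (by linarith : 0 ≤ x - y)) ht1
      nlinarith
  obtain ⟨m, hm, hmK⟩ : ∃ m > 0, ∀ k ∈ K, m ≤ U k := by
    rcases K.eq_empty_or_nonempty with h | h
    · exact ⟨1, one_pos, by simp [h]⟩
    · obtain ⟨k, hk, hkm⟩ := hK.exists_isMinOn h hUc.continuousOn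
      exact ⟨U k, hpos k hk, fun k' hk' => hkm hk'⟩
  obtain ⟨n₀, hn₀⟩ := exists_nat_gt (max ρ (3 / m))
  refine ⟨n₀, fun n hn y hy hyρ => ⟨?_, fun t ht s hs => ?_⟩⟩
  · have : (n₀ : ℝ) ≤ n := Nat.cast_le.2 hn
    linarith [le_max_left ρ (3 / m)]
  · have h1 : (n₀ : ℝ) ≤ n := Nat.cast_le.2 hn
    have h2 : 3 / m < (n : ℝ) + 1 := by linarith [le_max_right ρ (3 / m)]
    have h3 : 0 < (n : ℝ) + 1 := by positivity
    have h4 : 3 * (1 / ((n : ℝ) + 1)) < m := by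
      rw [div_lt_iff₀ hm] at h2
      rw [mul_one_div, div_lt_iff₀ h3]; linarith
    have hδ : 0 < 1 / ((n : ℝ) + 1) := by positivity
    set δ := 1 / ((n : ℝ) + 1)
    have h5 := hmK (x + t * ((1 - η) * (y - x)))
      ⟨(y, t), ⟨⟨hy, by rwa [Metric.mem_closedBall, Real.dist_eq]⟩, ht⟩, rfl⟩
    have h6 := hU (x + t * ((1 - η) * (y - x)) + s * δ) (x + t * ((1 - η) * (y - x)))
    rw [add_sub_cancel_left, abs_mul, abs_of_pos hδ] at h6
    have h7 : |s| ≤ 1 := abs_le.2 hs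
    have h8 := (abs_le.1 h6).1
    nlinarith

variable {μ ν : Measure ℝ} {π : Measure (ℝ × ℝ)}

/-- Starting points whose transitions, shortened by the factor `1 - η`, stay where the potentials
of the marginals are separated exhaust the part of the line that is moved at all. -/
lemma IsMart.exists_exhaustion (h : IsMart μ ν π) (hμ : IsP1 μ) (hν : IsP1 ν) {ρ : ℝ → ℝ}
    (hρ : ∀ᵐ w ∂π, |w.2 - w.1| ≤ ρ w.1) {η : ℝ} (hη : 0 < η) (hη1 : η < 1) :
    ∃ G : ℕ → Set ℝ, (∀ n, MeasurableSet (G n)) ∧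
      (∀ n : ℕ, ∀ᵐ w ∂π, w.1 ∈ G n → |w.2 - w.1| ≤ (n : ℝ) + 1 ∧
        ∀ t ∈ Set.Icc (0 : ℝ) 1, ∀ s ∈ Set.Icc (-1 : ℝ) 1, 1 / ((n : ℝ) + 1) ≤
          pot ν (w.1 + t * ((1 - η) * (w.2 - w.1)) + s * (1 / ((n : ℝ) + 1))) -
          pot μ (w.1 + t * ((1 - η) * (w.2 - w.1)) + s * (1 / ((n : ℝ) + 1)))) ∧
      ∀ᵐ w ∂π, w.2 = w.1 ∨ ∀ᶠ n in atTop, w.1 ∈ G n := by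
  have := h.prob hμ
  have := hμ.prob
  set U : ℝ → ℝ := fun z => pot ν z - pot μ z
  have hU : ∀ a b, |U a - U b| ≤ 2 * |a - b| := fun a b => by
    have h1 := hν.lipschitz_pot.dist_le_mul a b
    have h2 := hμ.lipschitz_pot.dist_le_mul a b
    simp only [Real.dist_eq, NNReal.coe_one, one_mul] at h1 h2
    have h3 : U a - U b = (pot ν a - pot ν b) - (pot μ a - pot μ b) := by simp only [U]; ring
    rw [h3]
    linarith [abs_sub (pot ν a - pot ν b) (pot μ a - pot μ b)]
  have hU0 : ∀ a, 0 ≤ U a := fun a => sub_nonneg.2 (h.pot_le hμ hν a)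
  have hUc : Continuous U := hν.lipschitz_pot.continuous.sub hμ.lipschitz_pot.continuous
  have hZ : {z | pot μ z = pot ν z} = {z | U z = 0} := by
    ext z
    simp only [U, Set.mem_ofPred_eq, sub_eq_zero, eq_comm]
  have hnc := h.ae_noCross hμ hν
  rw [hZ] at hnc
  let B : ℕ → Set (ℝ × ℝ) := fun n => {w | |w.2 - w.1| ≤ (n : ℝ) + 1} ∩
    ⋂ t ∈ Set.Icc (0 : ℝ) 1, ⋂ s ∈ Set.Icc (-1 : ℝ) 1, {w | 1 / ((n : ℝ) + 1) ≤
      U (w.1 + t * ((1 - η) * (w.2 - w.1)) + s * (1 / ((n : ℝ) + 1)))}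
  have hB : ∀ n, MeasurableSet (B n) := fun n => IsClosed.measurableSet <|
    (isClosed_le (by fun_prop) (by fun_prop)).inter <| isClosed_biInter fun t _ =>
      isClosed_biInter fun s _ => isClosed_le (by fun_prop) (by fun_prop)
  have hBmem : ∀ n w, w ∈ B n ↔ |w.2 - w.1| ≤ (n : ℝ) + 1 ∧
      ∀ t ∈ Set.Icc (0 : ℝ) 1, ∀ s ∈ Set.Icc (-1 : ℝ) 1, 1 / ((n : ℝ) + 1) ≤
        U (w.1 + t * ((1 - η) * (w.2 - w.1)) + s * (1 / ((n : ℝ) + 1))) := fun n w => by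
    simp only [B, Set.mem_inter_iff, Set.mem_iInter, Set.mem_ofPred_eq]
  have hd : μ ⊗ₘ π.condKernel = π := by
    rw [← h.fst]; exact π.disintegrate π.condKernel
  have hGm : ∀ n, MeasurableSet {x | π.condKernel x (Prod.mk x ⁻¹' (B n)ᶜ) = 0} := fun n =>
    (Kernel.measurable_kernel_prodMk_left (hB n).compl) (measurableSet_singleton 0)
  refine ⟨fun n => {x | π.condKernel x (Prod.mk x ⁻¹' (B n)ᶜ) = 0}, hGm, fun n => ?_, ?_⟩
  · suffices H : ∀ᵐ w ∂(μ ⊗ₘ π.condKernel),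
        w.1 ∈ {x | π.condKernel x (Prod.mk x ⁻¹' (B n)ᶜ) = 0} → w ∈ B n by
      rw [hd] at H
      exact H.mono fun w hw hx => (hBmem n w).1 (hw hx)
    rw [Measure.ae_compProd_iff]
    · refine ae_of_all _ fun x => ?_
      by_cases hx : π.condKernel x (Prod.mk x ⁻¹' (B n)ᶜ) = 0
      · exact (measure_eq_zero_iff_ae_notMem.1 hx).mono fun y hy _ => not_not.1 hy
      · exact ae_of_all _ fun y hy => absurd hy hx
    · exact (measurable_fst (hGm n)).imp (hB n)
  · have h1 : ∀ᵐ x ∂μ, ∀ᵐ y ∂(π.condKernel x), NoCross {z | U z = 0} x y ∧ |y - x| ≤ ρ x := by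
      rw [← hd] at hnc hρ
      filter_upwards [Measure.ae_ae_of_ae_compProd hnc, Measure.ae_ae_of_ae_compProd hρ]
        with x h1 h2
      filter_upwards [h1, h2] with y h1 h2 using ⟨h1, h2⟩
    have h2 : ∀ᵐ x ∂μ, U x = 0 ∨
        ∀ᶠ n in atTop, x ∈ {x | π.condKernel x (Prod.mk x ⁻¹' (B n)ᶜ) = 0} := by
      filter_upwards [h1] with x hx
      by_cases hUx : U x = 0
      · exact Or.inl hUx
      refine Or.inr ?_
      obtain ⟨n₀, hn₀⟩ := exists_lower_bound_of_noCross hU hU0 hUx (ρ x) hη hη1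
      filter_upwards [eventually_ge_atTop n₀] with n hn
      refine measure_eq_zero_iff_ae_notMem.2 (hx.mono fun y hy => not_not.2 ?_)
      exact (hBmem n (x, y)).2 (hn₀ n hn y hy.1 hy.2)
    rw [← h.fst] at h2
    filter_upwards [ae_of_ae_map measurable_fst.aemeasurable h2, hnc] with w h2 h3
    exact h2.imp (fun h2 => h3.eq h2) id

lemma IsMart.exists_contraction (h : IsMart μ ν π) (hμ : IsP1 μ) (hν : IsP1 ν) {ε : ℝ}
    (hε : 0 < ε) :
    ∃ (F : ℝ × ℝ → ℝ) (S : Set ℝ) (δ C η : ℝ), 0 < δ ∧ 0 < C ∧ 0 < η ∧ Measurable F ∧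
      Integrable F π ∧
      (∀ f : ℝ → ℝ, Measurable f → (∃ C, ∀ x, |f x| ≤ C) → ∫ z, f z.1 * F z ∂π = 0) ∧
      ∫ z, |z.1 + F z - z.2| ∂π ≤ ε ∧
      (∀ᵐ z ∂π, |F z| ≤ C ∧ (F z = 0 ∨ ∀ t ∈ Set.Icc (0 : ℝ) 1, ∀ s ∈ Set.Icc (-1 : ℝ) 1,
        z.1 + t * F z + s * δ ∈ S)) ∧
      ∀ z ∈ S, ∫ w, |w.1 + F w - z| ∂π ≤ pot ν z - η := by
  have := h.prob hμ
  obtain ⟨T, ρ, hT, hρm, hTi, hM, hpot, hρ, hTε⟩ := h.exists_truncation hμ hν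
    (show 0 < ε / 3 by positivity)
  have hνT : IsP1 (π.map T) := isP1_map hT hTi
  have hi1 := h.integrable_fst hμ
  have hDi : Integrable (fun z => T z - z.1) π := hTi.sub hi1
  have hI0 : 0 ≤ ∫ z, |T z - z.1| ∂π := integral_nonneg fun z => abs_nonneg _
  obtain ⟨θ, hθ, hθ1, hθI⟩ : ∃ θ : ℝ, 0 < θ ∧ θ < 1 ∧ θ * ∫ z, |T z - z.1| ∂π ≤ ε / 3 := by
    refine ⟨min (1 / 2) (ε / 3 / (∫ z, |T z - z.1| ∂π + 1)), by positivity,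
      (min_le_left _ _).trans_lt (by norm_num), ?_⟩
    calc _ ≤ ε / 3 / (∫ z, |T z - z.1| ∂π + 1) * (∫ z, |T z - z.1| ∂π + 1) := by
          gcongr
          · exact min_le_right _ _
          · linarith
      _ = ε / 3 := by field_simp
  have hXT : Measurable fun z : ℝ × ℝ => (z.1, T z) := by fun_prop
  obtain ⟨G, hG, hGB, hGe⟩ := hM.exists_exhaustion hμ hνT (ρ := ρ)
    ((ae_map_iff hXT.aemeasurable (measurableSet_le (by fun_prop) (by fun_prop))).2
      (ae_of_all _ hρ)) hθ hθ1
  replace hGe := ae_of_ae_map hXT.aemeasurable hGe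
  have hlim : Tendsto (fun n : ℕ => ∫ z, (Prod.fst ⁻¹' (G n)ᶜ).indicator
      (fun z => |T z - z.1|) z ∂π) atTop (𝓝 (∫ _, (0 : ℝ) ∂π)) := by
    refine tendsto_integral_of_dominated_convergence (fun z => |T z - z.1|)
      (fun n => (Measurable.indicator (by fun_prop)
        (measurable_fst (hG n).compl)).aestronglyMeasurable) hDi.abs
      (fun n => ae_of_all _ fun z => ?_) ?_
    · refine (norm_indicator_le_norm_self _ _).trans ?_
      simp
    · filter_upwards [hGe] with z hz
      refine tendsto_const_nhds.congr' ?_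
      rcases hz with hz | hz
      · refine Eventually.of_forall fun n => ?_
        replace hz : T z = z.1 := hz
        simp [Set.indicator, hz]
      · filter_upwards [hz] with n hn
        rw [Set.indicator_of_notMem]
        exact fun hz => hz hn
  rw [integral_zero] at hlim
  obtain ⟨n, hn⟩ := (hlim.eventually_lt_const (show 0 < ε / 3 by positivity)).exists
  have hGBn := ae_of_ae_map hXT.aemeasurable (hGB n)
  simp only at hGBn
  have hpre : MeasurableSet (Prod.fst ⁻¹' G n : Set (ℝ × ℝ)) := measurable_fst (hG n)
  set F : ℝ × ℝ → ℝ := (Prod.fst ⁻¹' G n).indicator fun z => (1 - θ) * (T z - z.1)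
  have hFG : ∀ z : ℝ × ℝ, z.1 ∈ G n → F z = (1 - θ) * (T z - z.1) := fun z hz =>
    Set.indicator_of_mem (s := Prod.fst ⁻¹' G n) hz _
  have hFG' : ∀ z : ℝ × ℝ, z.1 ∉ G n → F z = 0 := fun z hz =>
    Set.indicator_of_notMem (s := Prod.fst ⁻¹' G n) hz _
  have hFm : Measurable F := Measurable.indicator (by fun_prop) hpre
  have hFi : Integrable F π := (hDi.const_mul _).indicator hpre
  have hmart : ∀ f : ℝ → ℝ, Measurable f → (∃ C, ∀ x, |f x| ≤ C) →
      ∫ z, f z.1 * (T z - z.1) ∂π = 0 := fun f hf hb => by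
    rw [← hM.mart f hf hb, integral_map hXT.aemeasurable (by fun_prop)]
  have hδ : 0 < 1 / ((n : ℝ) + 1) := by positivity
  refine ⟨F, {z | 1 / ((n : ℝ) + 1) ≤ pot (π.map T) z - pot μ z}, 1 / ((n : ℝ) + 1), n + 1,
    θ * (1 / ((n : ℝ) + 1)), hδ, by positivity, by positivity, hFm, hFi, fun f hf hb => ?_, ?_, ?_,
    fun z hz => ?_⟩
  · have h1 := hmart (fun x => (1 - θ) * (G n).indicator f x) ((hf.indicator (hG n)).const_mul _) ?_
    · rw [← h1]
      congr 1 with z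
      by_cases hz : z.1 ∈ G n
      · rw [hFG z hz, Set.indicator_of_mem hz]; ring
      · rw [hFG' z hz, Set.indicator_of_notMem hz]; ring
    · obtain ⟨C, hC⟩ := hb
      refine ⟨C, fun x => ?_⟩
      rw [abs_mul, abs_of_pos (by linarith : 0 < 1 - θ)]
      have h2 : |(G n).indicator f x| ≤ C := by
        by_cases hx : x ∈ G n
        · rw [Set.indicator_of_mem hx]; exact hC x
        · rw [Set.indicator_of_notMem hx, abs_zero]; exact (abs_nonneg _).trans (hC x)
      nlinarith [abs_nonneg ((G n).indicator f x)]
  · have i2 : Integrable (fun z => (Prod.fst ⁻¹' (G n)ᶜ).indicator (fun z => |T z - z.1|) z) π :=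
      hDi.abs.indicator (measurable_fst (hG n).compl)
    have i1 : Integrable (fun z => |T z - z.2|) π := (hTi.sub (h.integrable_snd hν)).abs
    have i3 : Integrable (fun z => θ * |T z - z.1|) π := hDi.abs.const_mul θ
    have i13 : Integrable (fun z => |T z - z.2| + θ * |T z - z.1|) π := i1.add i3
    have key : ∫ z, |z.1 + F z - z.2| ∂π ≤ ∫ z, (|T z - z.2| + θ * |T z - z.1| +
        (Prod.fst ⁻¹' (G n)ᶜ).indicator (fun z => |T z - z.1|) z) ∂π := by
      refine integral_mono ((hi1.add hFi).sub (h.integrable_snd hν)).abs (i13.add i2) fun z => ?_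
      by_cases hz : z.1 ∈ G n
      · rw [Set.indicator_of_notMem (s := Prod.fst ⁻¹' (G n)ᶜ) fun h => h hz, hFG z hz, add_zero,
          show z.1 + (1 - θ) * (T z - z.1) - z.2 = (T z - z.2) - θ * (T z - z.1) by ring]
        refine (abs_sub _ _).trans_eq ?_
        rw [abs_mul, abs_of_pos hθ]
      · rw [Set.indicator_of_mem (s := Prod.fst ⁻¹' (G n)ᶜ) hz, hFG' z hz, add_zero,
          show z.1 - z.2 = (T z - z.2) - (T z - z.1) by ring]
        have := abs_sub (T z - z.2) (T z - z.1)
        have : 0 ≤ θ * |T z - z.1| := by positivity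
        linarith
    rw [integral_add i13 i2, integral_add i1 i3, integral_const_mul] at key
    linarith
  · filter_upwards [hGBn] with z hz
    by_cases hzG : z.1 ∈ G n
    · obtain ⟨h1, h2⟩ := hz hzG
      rw [hFG z hzG]
      refine ⟨?_, Or.inr h2⟩
      rw [abs_mul, abs_of_pos (by linarith : 0 < 1 - θ)]
      nlinarith [abs_nonneg (T z - z.1)]
    · rw [hFG' z hzG]
      exact ⟨by rw [abs_zero]; positivity, Or.inl rfl⟩
  · have i1 : Integrable (fun w => (1 - θ) * |T w - z|) π :=
      ((hTi.sub (integrable_const z)).abs).const_mul _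
    have i2 : Integrable (fun w : ℝ × ℝ => θ * |w.1 - z|) π :=
      ((hi1.sub (integrable_const z)).abs).const_mul _
    have hsm : Measurable fun x => (1 - θ) * (G n)ᶜ.indicator
        (fun x => if x ≤ z then (-1 : ℝ) else 1) x :=
      ((measurable_sign_le z).indicator (hG n).compl).const_mul _
    have hsb : ∃ C, ∀ x, |(1 - θ) * (G n)ᶜ.indicator
        (fun x => if x ≤ z then (-1 : ℝ) else 1) x| ≤ C := by
      refine ⟨1, fun x => ?_⟩
      simp only [Set.indicator]
      split_ifs <;> simp only [mul_neg, mul_one, mul_zero, abs_neg, abs_zero, zero_le_one] <;>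
        rw [abs_of_pos] <;> linarith
    have i3 : Integrable (fun w : ℝ × ℝ => ((1 - θ) * (G n)ᶜ.indicator
        (fun x => if x ≤ z then (-1 : ℝ) else 1) w.1) * (T w - w.1)) π :=
      integrable_bdd_mul (hsm.comp measurable_fst) (hsb.imp fun C hC w => hC _) hDi
    have i12 : Integrable (fun w : ℝ × ℝ => (1 - θ) * |T w - z| + θ * |w.1 - z|) π := i1.add i2
    have key : ∫ w, |w.1 + F w - z| ∂π ≤ ∫ w, ((1 - θ) * |T w - z| + θ * |w.1 - z| -
        ((1 - θ) * (G n)ᶜ.indicator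
          (fun x => if x ≤ z then (-1 : ℝ) else 1) w.1) * (T w - w.1)) ∂π := by
      refine integral_mono ((hi1.add hFi).sub (integrable_const z)).abs (i12.sub i3) fun w => ?_
      by_cases hw : w.1 ∈ G n
      · simp only [Set.indicator, Set.mem_compl_iff, hw, not_true, if_false, mul_zero, zero_mul,
          sub_zero]
        rw [hFG w hw, show w.1 + (1 - θ) * (T w - w.1) - z = (1 - θ) * (T w - z) + θ * (w.1 - z)
          by ring]
        refine (abs_add_le _ _).trans_eq ?_
        rw [abs_mul, abs_mul, abs_of_pos hθ, abs_of_pos (by linarith : 0 < 1 - θ)]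
      · have h1 := gap_nonneg z (w.1, T w)
        simp only [gap] at h1
        simp only [Set.indicator, Set.mem_compl_iff, hw, not_false_iff, if_true]
        rw [hFG' w hw, add_zero]
        have h2 := mul_nonneg (by linarith : 0 ≤ 1 - θ) h1
        nlinarith
    rw [integral_sub i12 i3, integral_add i1 i2, hmart _ hsm hsb, integral_const_mul,
      integral_const_mul, ← pot_map hT, ← pot_map measurable_fst, h.fst] at key
    have h1 := hpot z
    simp only [Set.mem_ofPred_eq] at hz
    have h2 := mul_le_mul_of_nonneg_left hz hθ.le
    linarith

end contraction

section stability

variable {μ ν : Measure ℝ} {π : Measure (ℝ × ℝ)}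

/-- Martingale couplings can be approximated when the marginals are perturbed. -/
lemma IsMart.exists_near (h : IsMart μ ν π) (hμ : IsP1 μ) (hν : IsP1 ν) {ε : ℝ} (hε : 0 < ε) :
    ∃ τ > 0, ∀ (μ' ν' : Measure ℝ) (θ : Measure (ℝ × ℝ)), IsP1 μ' → IsP1 ν' →
      ∫ y, y ∂μ' = ∫ y, y ∂ν' → (∀ z, pot μ' z ≤ pot ν' z) → θ.map Prod.fst = μ' →
      θ.map Prod.snd = μ → ∫ z, |z.1 - z.2| ∂θ ≤ τ → (∀ z, |pot ν' z - pot ν z| ≤ τ) →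
      ∃ Q : Measure ((ℝ × ℝ) × (ℝ × ℝ)), IsMart μ' ν' (Q.map Prod.fst) ∧ Q.map Prod.snd = π ∧
        ∫ w, (|w.1.1 - w.2.1| + |w.1.2 - w.2.2|) ∂Q ≤ ε := by
  have := h.prob hμ
  have := hμ.prob
  obtain ⟨τN, hτN, hnear⟩ := hν.exists_near_diagonal (show 0 < ε / 4 by positivity)
  obtain ⟨F, S, δ, C, η, hδ, hC, hη, hFm, hFi, hF0, hFε, hFS, hpot⟩ := h.exists_contraction hμ hν
    (show 0 < min (τN / 2) (ε / 4) by positivity)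
  set m := min (min (τN / 2) (ε / 4)) (η / 2)
  have hm0 : 0 < m := by positivity
  have hm1 : m ≤ τN / 2 := (min_le_left _ _).trans (min_le_left _ _)
  have hm2 : m ≤ ε / 4 := (min_le_left _ _).trans (min_le_right _ _)
  have hm3 : m ≤ η / 2 := min_le_right _ _
  have hK : 1 < 1 + C / δ := by linarith [div_pos hC hδ]
  have hK0 : 0 < 1 + C / δ := by linarith
  have hτm : m / (1 + C / δ) ≤ m := div_le_self hm0.le hK.le
  refine ⟨m / (1 + C / δ), by positivity, fun μ' ν' θ hμ' hν' hmean hle hθ1 hθ2 hθ hνν' => ?_⟩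
  have := hμ'.prob
  have hθP : IsProbabilityMeasure θ := by
    have : IsProbabilityMeasure (θ.map Prod.fst) := by rwa [hθ1]
    exact Measure.isProbabilityMeasure_of_map Prod.fst
  obtain ⟨Q₁, hQ1, hQ2, hQ3⟩ :=
    _root_.exists_glue (P := θ) measurable_snd (π := π) (by rw [h.fst, hθ2])
  have hQ₁P : IsProbabilityMeasure Q₁ := by
    have : IsProbabilityMeasure (Q₁.map Prod.fst) := by rwa [hQ1]
    exact Measure.isProbabilityMeasure_of_map Prod.fst
  have hpair : Measurable fun w : (ℝ × ℝ) × ℝ => (w.1.2, w.2) := by fun_prop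
  have iX' : Integrable (fun w : (ℝ × ℝ) × ℝ => w.1.1) Q₁ := by
    have := hμ'.int
    rw [← hθ1, ← hQ1, Measure.map_map measurable_fst measurable_fst] at this
    exact this.comp_measurable (by fun_prop)
  have toQ : ∀ g : ℝ × ℝ → ℝ, Integrable g π → Integrable (fun w => g (w.1.2, w.2)) Q₁ :=
    fun g hg => by
      rw [← hQ2] at hg
      exact hg.comp_measurable hpair
  have iF := toQ F hFi
  have iX := toQ _ (h.integrable_fst hμ)
  have iY := toQ _ (h.integrable_snd hν)
  simp only at iX iY
  let D : Set (ℝ × ℝ) := {w | |w.1 - w.2| ≤ δ}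
  have hD : MeasurableSet D := measurableSet_le (by fun_prop) measurable_const
  let χ : ℝ × ℝ → ℝ := D.indicator fun _ => 1
  have hχ : Measurable χ := measurable_const.indicator hD
  have hχ1 : ∀ w ∈ D, χ w = 1 := fun w hw => Set.indicator_of_mem hw _
  have hχ0 : ∀ w ∉ D, χ w = 0 := fun w hw => Set.indicator_of_notMem hw _
  have hχb : ∀ w, |χ w| ≤ 1 := fun w => by
    by_cases hw : w ∈ D
    · simp [hχ1 w hw]
    · simp [hχ0 w hw]
  let Y' : (ℝ × ℝ) × ℝ → ℝ := fun w => w.1.1 + χ w.1 * F (w.1.2, w.2)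
  have hY' : Measurable Y' := by fun_prop
  have iχF : Integrable (fun w : (ℝ × ℝ) × ℝ => χ w.1 * F (w.1.2, w.2)) Q₁ :=
    integrable_bdd_mul (hχ.comp measurable_fst) ⟨1, fun w => hχb _⟩ iF
  have iY' : Integrable Y' Q₁ := iX'.add iχF
  have hFS' : ∀ᵐ w ∂Q₁, |F (w.1.2, w.2)| ≤ C ∧ (F (w.1.2, w.2) = 0 ∨
      ∀ t ∈ Set.Icc (0 : ℝ) 1, ∀ s ∈ Set.Icc (-1 : ℝ) 1,
        w.1.2 + t * F (w.1.2, w.2) + s * δ ∈ S) := by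
    rw [← hQ2] at hFS
    exact ae_of_ae_map hpair.aemeasurable hFS
  have hX'X : ∫ w, |w.1.1 - w.1.2| ∂Q₁ = ∫ z, |z.1 - z.2| ∂θ := by
    rw [← hQ1, integral_map measurable_fst.aemeasurable (by fun_prop)]
  have hclose : ∫ w, |Y' w - (w.1.2 + F (w.1.2, w.2))| ∂Q₁ ≤ m := by
    have h1 : ∫ w, |Y' w - (w.1.2 + F (w.1.2, w.2))| ∂Q₁ ≤
        ∫ w, (1 + C / δ) * |w.1.1 - w.1.2| ∂Q₁ := by
      refine integral_mono_ae (iY'.sub (iX.add iF)).abs ((iX'.sub iX).abs.const_mul _) ?_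
      filter_upwards [hFS'] with w hw
      simp only [Y']
      by_cases hwD : w.1 ∈ D
      · rw [hχ1 _ hwD, one_mul, add_sub_add_right_eq_sub]
        nlinarith [abs_nonneg (w.1.1 - w.1.2)]
      · rw [hχ0 _ hwD, zero_mul, add_zero, ← sub_sub]
        have h2 : δ < |w.1.1 - w.1.2| := not_le.1 hwD
        have h3 : C ≤ C / δ * |w.1.1 - w.1.2| := by
          rw [div_mul_eq_mul_div, le_div_iff₀ hδ]
          exact mul_le_mul_of_nonneg_left h2.le hC.le
        linarith [abs_sub (w.1.1 - w.1.2) (F (w.1.2, w.2)), hw.1]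
    rw [integral_const_mul, hX'X] at h1
    rw [le_div_iff₀ hK0] at hθ
    linarith
  have hFY : ∫ w, |w.1.2 + F (w.1.2, w.2) - w.2| ∂Q₁ ≤ min (τN / 2) (ε / 4) := by
    rw [← hQ2, integral_map hpair.aemeasurable (by fun_prop)] at hFε
    exact hFε
  have iXF : Integrable (fun w : (ℝ × ℝ) × ℝ => w.1.2 + F (w.1.2, w.2)) Q₁ := iX.add iF
  have hY'Y : ∫ w, |Y' w - w.2| ∂Q₁ ≤ m + min (τN / 2) (ε / 4) := by
    have i1 : Integrable (fun w => |Y' w - (w.1.2 + F (w.1.2, w.2))|) Q₁ := (iY'.sub iXF).abs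
    have i2 : Integrable (fun w : (ℝ × ℝ) × ℝ => |w.1.2 + F (w.1.2, w.2) - w.2|) Q₁ :=
      (iXF.sub iY).abs
    have h1 : ∫ w, |Y' w - w.2| ∂Q₁ ≤
        ∫ w, (|Y' w - (w.1.2 + F (w.1.2, w.2))| + |w.1.2 + F (w.1.2, w.2) - w.2|) ∂Q₁ :=
      integral_mono (iY'.sub iY).abs (i1.add i2) fun w => abs_sub_le _ _ _
    rw [integral_add i1 i2] at h1
    linarith
  have eX' : Q₁.map (fun w => w.1.1) = μ' := by
    rw [← hθ1, ← hQ1, Measure.map_map measurable_fst measurable_fst]; rfl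
  have eY : Q₁.map (fun w => w.2) = ν := by
    rw [← h.snd, ← hQ2, Measure.map_map measurable_snd hpair]; rfl
  have hp : IsP1 (Q₁.map Y') := isP1_map hY' iY'
  have hmart1 : ∀ f : ℝ → ℝ, Measurable f → (∃ C, ∀ x, |f x| ≤ C) →
      ∫ w, f w.1.1 * (Y' w - w.1.1) ∂Q₁ = 0 := fun f hf hb => by
    rw [← hQ3 F hFi hF0 (fun w => f w.1 * χ w) (by fun_prop) ?_]
    · congr 1 with w
      simp only [Y']; ring
    · obtain ⟨K, hK⟩ := hb
      refine ⟨K, fun w => ?_⟩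
      rw [abs_mul]
      nlinarith [hK w.1, hχb w, abs_nonneg (f w.1), abs_nonneg (χ w)]
  have hM1 := isMart_of_map (P := Q₁) (X := fun w => w.1.1) (Y := Y') (by fun_prop) hY' hmart1
  rw [eX'] at hM1
  have hple : ∀ z, pot (Q₁.map Y') z ≤ pot ν' z := by
    intro z
    have hz1 := abs_le.1 (hνν' z)
    by_cases hz : z ∈ S
    · have h1 := hpot z hz
      rw [← hQ2, integral_map hpair.aemeasurable (by fun_prop)] at h1
      simp only at h1
      have h2 := (abs_le.1 (abs_integral_abs_sub_le iY' iXF z)).2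
      rw [pot_map hY']
      linarith
    · obtain ⟨hg1, hg2⟩ := hM1.integral_gap hμ' hp z
      rw [integral_map (by fun_prop) hg1.aestronglyMeasurable] at hg2
      have h0 : (fun w : (ℝ × ℝ) × ℝ => gap z (w.1.1, Y' w)) =ᵐ[Q₁] 0 := by
        filter_upwards [hFS'] with w hw
        rw [Pi.zero_apply, gap_eq_zero_iff]
        simp only [Y']
        by_cases hwD : w.1 ∈ D
        · rw [hχ1 _ hwD, one_mul]
          rcases hw.2 with hw | hw
          · rw [hw, add_zero]; exact ⟨id, le_of_lt⟩
          have hs : (w.1.1 - w.1.2) / δ ∈ Set.Icc (-1 : ℝ) 1 := by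
            have := abs_le.1 (show |w.1.1 - w.1.2| ≤ δ from hwD)
            rw [Set.mem_Icc, le_div_iff₀ hδ, div_le_iff₀ hδ]
            constructor <;> linarith
          have ht : ∀ t ∈ Set.Icc (0 : ℝ) 1, w.1.1 + t * F (w.1.2, w.2) ≠ z := by
            intro t ht he
            refine hz ?_
            have := hw t ht _ hs
            rwa [div_mul_cancel₀ _ hδ.ne',
              show ∀ a b c : ℝ, a + b + (c - a) = c + b from fun a b c => by ring, he] at this
          constructor
          · intro h1
            by_contra! h2
            have hF : 0 < F (w.1.2, w.2) := by linarith
            refine ht ((z - w.1.1) / F (w.1.2, w.2)) ⟨by apply div_nonneg <;> linarith, ?_⟩ ?_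
            · rw [div_le_one hF]; linarith
            · rw [div_mul_cancel₀ _ hF.ne']; ring
          · intro h1
            by_contra! h2
            have hF : F (w.1.2, w.2) < 0 := by linarith
            refine ht ((z - w.1.1) / F (w.1.2, w.2))
              ⟨div_nonneg_of_nonpos (by linarith) hF.le, ?_⟩ ?_
            · rw [div_le_one_of_neg hF]; linarith
            · rw [div_mul_cancel₀ _ hF.ne]; ring
        · rw [hχ0 _ hwD, zero_mul, add_zero]
          exact ⟨id, le_of_lt⟩
      rw [integral_congr_ae h0] at hg2
      simp only [Pi.zero_apply, integral_zero] at hg2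
      linarith [hle z]
  obtain ⟨M, hM⟩ := exists_isMart hp hν' ((hM1.integral_eq hμ' hp).symm.trans hmean) hple
  have hMε : ∫ z, |z.2 - z.1| ∂M ≤ ε / 4 := by
    refine hnear _ _ M hp hν' hM (fun z => ?_) fun z => (hνν' z).trans (by linarith)
    rw [pot_map hY', ← eY, pot_map (by fun_prop)]
    refine (abs_integral_abs_sub_le iY' iY z).trans (hY'Y.trans ?_)
    linarith [min_le_left (τN / 2) (ε / 4)]
  obtain ⟨Q₂, hQ4, hQ5, hQ6⟩ := hM.exists_glue hY' hp hν'
  have hpair' : Measurable fun w : ((ℝ × ℝ) × ℝ) × ℝ => (Y' w.1, w.2) := by fun_prop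
  have toQ₂ : ∀ g : (ℝ × ℝ) × ℝ → ℝ, Integrable g Q₁ → Integrable (fun w => g w.1) Q₂ :=
    fun g hg => by
      rw [← hQ4] at hg
      exact hg.comp_measurable measurable_fst
  have hint : ∀ g : (ℝ × ℝ) × ℝ → ℝ, Measurable g → ∫ w, g w.1 ∂Q₂ = ∫ w, g w ∂Q₁ :=
    fun g hg => by rw [← hQ4, integral_map measurable_fst.aemeasurable hg.aestronglyMeasurable]
  have iY'' : Integrable (fun w : ((ℝ × ℝ) × ℝ) × ℝ => w.2) Q₂ := by
    have := hM.integrable_snd hν'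
    rw [← hQ5] at this
    exact this.comp_measurable hpair'
  refine ⟨Q₂.map fun w => ((w.1.1.1, w.2), (w.1.1.2, w.1.2)), ?_, ?_, ?_⟩
  · rw [Measure.map_map measurable_fst (by fun_prop)]
    have key := isMart_of_map (P := Q₂) (X := fun w => w.1.1.1) (Y := fun w => w.2)
      (by fun_prop) (by fun_prop) fun f hf hb => ?_
    · have e1 : Q₂.map (fun w => w.1.1.1) = μ' := by
        rw [← eX', ← hQ4, Measure.map_map (by fun_prop) (by fun_prop)]; rfl
      have e2 : Q₂.map (fun w => w.2) = ν' := by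
        rw [← hM.snd, ← hQ5, Measure.map_map (by fun_prop) (by fun_prop)]; rfl
      rwa [e1, e2] at key
    have h1 := hQ6 (fun w => f w.1.1) (by fun_prop) (hb.imp fun C hC w => hC _)
    have h2 := hint (fun w => f w.1.1 * (Y' w - w.1.1)) (by fun_prop)
    rw [hmart1 f hf hb] at h2
    have i1 : Integrable (fun w : ((ℝ × ℝ) × ℝ) × ℝ => f w.1.1.1 * (w.2 - Y' w.1)) Q₂ :=
      integrable_bdd_mul (by fun_prop) (hb.imp fun C hC w => hC _) (iY''.sub (toQ₂ _ iY'))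
    have i2 : Integrable (fun w : ((ℝ × ℝ) × ℝ) × ℝ => f w.1.1.1 * (Y' w.1 - w.1.1.1)) Q₂ :=
      integrable_bdd_mul (by fun_prop) (hb.imp fun C hC w => hC _)
        ((toQ₂ _ iY').sub (toQ₂ _ iX'))
    rw [← add_zero (0 : ℝ)]
    nth_rw 1 [← h1]
    nth_rw 1 [← h2]
    rw [← integral_add i1 i2]
    congr 1 with w
    ring
  · rw [Measure.map_map measurable_snd (by fun_prop), ← hQ2, ← hQ4,
      Measure.map_map (by fun_prop) (by fun_prop)]
    rfl
  · rw [integral_map (by fun_prop) (by fun_prop)]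
    simp only
    have i1 : Integrable (fun w : ((ℝ × ℝ) × ℝ) × ℝ => |w.1.1.1 - w.1.1.2|) Q₂ :=
      ((toQ₂ _ iX').sub (toQ₂ _ iX)).abs
    have i2 : Integrable (fun w : ((ℝ × ℝ) × ℝ) × ℝ => |w.2 - Y' w.1|) Q₂ :=
      (iY''.sub (toQ₂ _ iY')).abs
    have i3 : Integrable (fun w : ((ℝ × ℝ) × ℝ) × ℝ => |Y' w.1 - w.1.2|) Q₂ :=
      ((toQ₂ _ iY').sub (toQ₂ _ iY)).abs
    have i4 : Integrable (fun w : ((ℝ × ℝ) × ℝ) × ℝ => |w.2 - w.1.2|) Q₂ :=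
      (iY''.sub (toQ₂ _ iY)).abs
    have h1 : ∫ w, |w.2 - w.1.2| ∂Q₂ ≤ ∫ w, (|w.2 - Y' w.1| + |Y' w.1 - w.1.2|) ∂Q₂ :=
      integral_mono i4 (i2.add i3) fun w => abs_sub_le _ _ _
    rw [integral_add i2 i3, hint (fun w => |Y' w - w.2|) (by fun_prop)] at h1
    rw [← hQ5, integral_map hpair'.aemeasurable (by fun_prop)] at hMε
    rw [integral_add i1 i4, hint (fun w => |w.1.1 - w.1.2|) (by fun_prop), hX'X]
    simp only at hMε
    linarith [min_le_right (τN / 2) (ε / 4)]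

end stability

section value

variable {μ ν : Measure ℝ} {π : Measure (ℝ × ℝ)}

lemma integrable_of_linear_growth {f : ℝ × ℝ → ℝ} {C : ℝ} [IsFiniteMeasure π]
    (hi1 : Integrable (fun z : ℝ × ℝ => z.1) π) (hi2 : Integrable (fun z : ℝ × ℝ => z.2) π)
    (hf : Continuous f) (hg : ∀ z, |f z| ≤ C * (1 + |z.1| + |z.2|)) : Integrable f π :=
  ((((integrable_const (1 : ℝ)).add hi1.abs).add hi2.abs).const_mul C).mono'
    hf.aestronglyMeasurable (ae_of_all _ hg)

/-- The cost is nearly monotone under `L¹`-small perturbations of the coupling. -/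
lemma exists_integral_le_add {c : ℝ × ℝ → ℝ} (hc : Continuous c) {r : ℝ} (hr : 0 < r)
    (hg : ∀ z, |c z| ≤ r * (1 + |z.1| + |z.2|)) [IsFiniteMeasure π] (hpos : ∀ z, 0 ≤ c z)
    (hi1 : Integrable (fun z : ℝ × ℝ => z.1) π) (hi2 : Integrable (fun z : ℝ × ℝ => z.2) π)
    (hP : π.real Set.univ ≤ 1) {ε : ℝ} (hε : 0 < ε) :
    ∃ γ > 0, ∀ Q : Measure ((ℝ × ℝ) × (ℝ × ℝ)), Q.map Prod.snd = π →
      Integrable (fun w => |w.1.1 - w.2.1| + |w.1.2 - w.2.2|) Q →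
      ∫ w, (|w.1.1 - w.2.1| + |w.1.2 - w.2.2|) ∂Q ≤ γ →
      ∫ z, c z ∂(Q.map Prod.fst) ≤ ∫ z, c z ∂π + ε := by
  let b : ℝ × ℝ → ℝ := fun z => r * (1 + |z.1| + |z.2|)
  have hb : Measurable b := by fun_prop
  have hbi : Integrable b π := (((integrable_const (1 : ℝ)).add hi1.abs).add hi2.abs).const_mul r
  have hb0 : ∀ z, 0 ≤ b z := fun z => by positivity
  let A : ℕ → Set (ℝ × ℝ) := fun n => {z | (n : ℝ) < ‖z‖}
  have hA : ∀ n, MeasurableSet (A n) := fun n => measurableSet_lt measurable_const (by fun_prop)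
  have hlim : Tendsto (fun n : ℕ => ∫ z, (A n).indicator b z ∂π) atTop (𝓝 (∫ _, (0 : ℝ) ∂π)) := by
    refine tendsto_integral_of_dominated_convergence b
      (fun n => (hb.indicator (hA n)).aestronglyMeasurable) hbi
      (fun n => ae_of_all _ fun z => ?_) (ae_of_all _ fun z => ?_)
    · refine (norm_indicator_le_norm_self _ _).trans_eq ?_
      rw [Real.norm_of_nonneg (hb0 z)]
    · refine tendsto_const_nhds.congr' ?_
      filter_upwards [eventually_ge_atTop ⌈‖z‖⌉₊] with n hn
      rw [Set.indicator_of_notMem]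
      exact not_lt.2 (Nat.ceil_le.1 hn)
  rw [integral_zero] at hlim
  obtain ⟨n, hn⟩ := (hlim.eventually_lt_const (show 0 < ε / 3 by positivity)).exists
  have hu := (isCompact_closedBall (0 : ℝ × ℝ) n).uniformContinuousAt_of_continuousAt c
    (fun a _ => hc.continuousAt) (Metric.dist_mem_uniformity (show 0 < ε / 3 by positivity))
  obtain ⟨δ, hδ, hδu⟩ := Metric.mem_uniformity_dist.1 hu
  set L := r * (1 + 2 * n) / δ + r with hL
  have hL0 : 0 < L := by positivity
  have hpt : ∀ z z' : ℝ × ℝ, c z' ≤ c z + ε / 3 + (A n).indicator b z +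
      L * (|z'.1 - z.1| + |z'.2 - z.2|) := by
    intro z z'
    set d := |z'.1 - z.1| + |z'.2 - z.2| with hd
    have hd0 : 0 ≤ d := by positivity
    have h0 := hpos z
    have h1 : c z' ≤ b z + r * d := by
      refine (le_abs_self _).trans ((hg z').trans ?_)
      have e1 : |z'.1| ≤ |z.1| + |z'.1 - z.1| := by
        simpa using abs_add_le z.1 (z'.1 - z.1)
      have e2 : |z'.2| ≤ |z.2| + |z'.2 - z.2| := by
        simpa using abs_add_le z.2 (z'.2 - z.2)
      simp only [b]
      rw [← mul_add]
      refine mul_le_mul_of_nonneg_left ?_ hr.le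
      linarith
    have hrL : r * d ≤ L * d := by
      refine mul_le_mul_of_nonneg_right ?_ hd0
      have : 0 ≤ r * (1 + 2 * n) / δ := by positivity
      linarith
    by_cases hz : z ∈ A n
    · rw [Set.indicator_of_mem hz]
      linarith
    · rw [Set.indicator_of_notMem hz, add_zero]
      have hz' : ‖z‖ ≤ n := not_lt.1 hz
      by_cases hdδ : d < δ
      · have h2 : dist z z' < δ := by
          rw [Prod.dist_eq, max_lt_iff, dist_comm, dist_comm z.2, Real.dist_eq, Real.dist_eq]
          constructor
          · linarith [abs_nonneg (z'.2 - z.2)]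
          · linarith [abs_nonneg (z'.1 - z.1)]
        have h3 : dist (c z) (c z') < ε / 3 := hδu h2 (by simpa using hz')
        rw [Real.dist_eq, abs_sub_comm] at h3
        have := (abs_lt.1 h3).2
        have : 0 ≤ L * d := by positivity
        linarith
      · have h2 : r * (1 + 2 * n) ≤ r * (1 + 2 * n) / δ * d := by
          rw [div_mul_eq_mul_div, le_div_iff₀ hδ]
          exact mul_le_mul_of_nonneg_left (not_lt.1 hdδ) (by positivity)
        have h3 : b z ≤ r * (1 + 2 * n) := by
          refine mul_le_mul_of_nonneg_left ?_ hr.le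
          have e1 : |z.1| ≤ ‖z‖ := norm_fst_le z
          have e2 : |z.2| ≤ ‖z‖ := norm_snd_le z
          linarith
        have h4 : L * d = r * (1 + 2 * n) / δ * d + r * d := by rw [hL]; ring
        linarith
  refine ⟨ε / 3 / L, by positivity, fun Q hQ hQi hQd => ?_⟩
  have toQ : ∀ g : ℝ × ℝ → ℝ, Integrable g π → Integrable (fun w => g w.2) Q := fun g hg => by
    rw [← hQ] at hg
    exact hg.comp_measurable measurable_snd
  have hint : ∀ g : ℝ × ℝ → ℝ, Measurable g → ∫ w, g w.2 ∂Q = ∫ z, g z ∂π := fun g hg => by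
    rw [← hQ, integral_map measurable_snd.aemeasurable hg.aestronglyMeasurable]
  have hci := integrable_of_linear_growth hi1 hi2 hc hg
  have i1 : Integrable (fun w : (ℝ × ℝ) × (ℝ × ℝ) => c w.2 + ε / 3) Q :=
    toQ _ (hci.add (integrable_const _))
  have i2 : Integrable (fun w : (ℝ × ℝ) × (ℝ × ℝ) => (A n).indicator b w.2) Q :=
    toQ _ (hbi.indicator (hA n))
  have i12 : Integrable (fun w : (ℝ × ℝ) × (ℝ × ℝ) => c w.2 + ε / 3 + (A n).indicator b w.2) Q :=
    i1.add i2
  have i3 : Integrable (fun w : (ℝ × ℝ) × (ℝ × ℝ) =>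
    L * (|w.1.1 - w.2.1| + |w.1.2 - w.2.2|)) Q := hQi.const_mul L
  rw [integral_map measurable_fst.aemeasurable hc.aestronglyMeasurable]
  have key : ∫ w, c w.1 ∂Q ≤ ∫ w, (c w.2 + ε / 3 + (A n).indicator b w.2 +
      L * (|w.1.1 - w.2.1| + |w.1.2 - w.2.2|)) ∂Q :=
    integral_mono_of_nonneg (ae_of_all _ fun w => hpos _) (i12.add i3)
      (ae_of_all _ fun w => hpt w.2 w.1)
  rw [integral_add i12 i3, integral_add i1 i2, hint (fun z => c z + ε / 3) (by fun_prop),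
    hint _ (hb.indicator (hA n)), integral_add hci (integrable_const _), integral_const,
    integral_const_mul, smul_eq_mul] at key
  rw [le_div_iff₀ hL0] at hQd
  nlinarith

lemma eventually_exists_coupling {μk : ℕ → Measure ℝ} (hμk : ∀ k, IsP1 (μk k)) (hμ : IsP1 μ)
    (h : TendstoWr 1 μk μ) {γ : ℝ} (hγ : 0 < γ) :
    ∀ᶠ k in atTop, ∃ θ : Measure (ℝ × ℝ), θ.map Prod.fst = μk k ∧ θ.map Prod.snd = μ ∧
      ∫ z, |z.1 - z.2| ∂θ ≤ γ := by
  filter_upwards [h.eventually_lt_const hγ] with k hk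
  have := (hμk k).prob
  have := hμ.prob
  have hne : {v | ∃ π : Measure (ℝ × ℝ), IsCoupling π (μk k) μ ∧
      v = ∫ z, dist z.1 z.2 ^ (1 : ℝ) ∂π}.Nonempty :=
    ⟨_, (μk k).prod μ, ⟨by simp [Measure.map_fst_prod], by simp [Measure.map_snd_prod]⟩, rfl⟩
  obtain ⟨v, ⟨θ, ⟨h1, h2⟩, rfl⟩, hv⟩ := exists_lt_of_csInf_lt hne hk
  simp only [Real.rpow_one, Real.dist_eq] at hv
  exact ⟨θ, h1, h2, hv.le⟩

lemma abs_pot_sub_pot_le {p q : Measure ℝ} {θ : Measure (ℝ × ℝ)} (hp : IsP1 p) (hq : IsP1 q)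
    (h1 : θ.map Prod.fst = p) (h2 : θ.map Prod.snd = q) :
    (∀ z, |pot p z - pot q z| ≤ ∫ w, |w.1 - w.2| ∂θ) ∧
      |∫ y, y ∂p - ∫ y, y ∂q| ≤ ∫ w, |w.1 - w.2| ∂θ := by
  subst h1 h2
  have := hp.prob
  have : IsProbabilityMeasure θ := Measure.isProbabilityMeasure_of_map Prod.fst
  have i1 : Integrable (fun w : ℝ × ℝ => w.1) θ := hp.int.comp_measurable measurable_fst
  have i2 : Integrable (fun w : ℝ × ℝ => w.2) θ := hq.int.comp_measurable measurable_snd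
  refine ⟨fun z => ?_, ?_⟩
  · rw [pot_map measurable_fst, pot_map measurable_snd]
    exact abs_integral_abs_sub_le i1 i2 z
  · rw [integral_map (by fun_prop) (by fun_prop), integral_map (by fun_prop) (by fun_prop),
      ← integral_sub i1 i2]
    exact abs_integral_le_integral_abs

lemma ConvexOrder.pot_le (h : ConvexOrder μ ν) (z : ℝ) : pot μ z ≤ pot ν z := by
  refine h (fun y => |y - z|) ?_ ⟨|z|, 1, fun y => ?_⟩
  · simpa [Real.dist_eq] using convexOn_univ_dist z
  · rw [abs_abs, one_mul, add_comm]
    exact abs_sub y z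

lemma ConvexOrder.integral_eq (h : ConvexOrder μ ν) : ∫ y, y ∂μ = ∫ y, y ∂ν := by
  refine le_antisymm (h (fun y => y) (convexOn_id convex_univ) ⟨0, 1, fun y => by simp⟩) ?_
  have := h (fun y => -y) (concaveOn_id convex_univ).neg ⟨0, 1, fun y => by simp⟩
  rw [integral_neg, integral_neg] at this
  linarith

end value

/-- **Corollary 1.2 (stability of the value of martingale optimal transport)**:
under uniform convergence `c_k → c`, linear growth of `c`, `W₁`-convergence of the
marginals and convex ordering `μ_k ≤_c ν_k`, the optimal values of the martingale
transport problems converge. -/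
theorem MOT_value_stability
    (c : ℝ → ℝ → ℝ) (ck : ℕ → ℝ → ℝ → ℝ)
    (hc : Continuous (Function.uncurry c))
    (hck : ∀ k, Continuous (Function.uncurry (ck k)))
    (hcpos : ∀ x y, 0 ≤ c x y) (hckpos : ∀ k x y, 0 ≤ ck k x y)
    (hunif : TendstoUniformly (fun k z => ck k z.1 z.2)
      (fun z : ℝ × ℝ => c z.1 z.2) atTop)
    (r : ℝ) (hr : 0 < r) (hgrowth : ∀ x y, c x y ≤ r * (1 + |x| + |y|))
    (μk νk : ℕ → Measure ℝ) (μ ν : Measure ℝ)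
    (hμk : ∀ k, MemPr 1 (μk k)) (hνk : ∀ k, MemPr 1 (νk k))
    (hμ : MemPr 1 μ) (hν : MemPr 1 ν)
    (hconvμ : TendstoWr 1 μk μ) (hconvν : TendstoWr 1 νk ν)
    (horder : ∀ k, ConvexOrder (μk k) (νk k)) :
    Tendsto (fun k =>
        sInf {v | ∃ π : Measure (ℝ × ℝ), IsMartCoupling (μk k) (νk k) π ∧
          v = ∫ z, ck k z.1 z.2 ∂π}) atTop
      (nhds (sInf {v | ∃ π : Measure (ℝ × ℝ), IsMartCoupling μ ν π ∧
        v = ∫ z, c z.1 z.2 ∂π})) := by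
  have hμk' := fun k => (hμk k).isP1
  have hνk' := fun k => (hνk k).isP1
  have hμ' := hμ.isP1
  have hν' := hν.isP1
  simp only [isMartCoupling_iff (hμk' _) (hνk' _), isMartCoupling_iff hμ' hν']
  have hcg : ∀ z : ℝ × ℝ, |Function.uncurry c z| ≤ r * (1 + |z.1| + |z.2|) := fun z =>
    (abs_of_nonneg (hcpos z.1 z.2)).le.trans (hgrowth z.1 z.2)
  have hci : ∀ {p q : Measure ℝ} {π : Measure (ℝ × ℝ)}, IsP1 p → IsP1 q → IsMart p q π →
      Integrable (Function.uncurry c) π := fun hp hq h => by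
    have := h.prob hp
    exact integrable_of_linear_growth (h.integrable_fst hp) (h.integrable_snd hq) hc hcg
  have hunif' : ∀ ε > 0, ∀ᶠ k in atTop, ∀ (p q : Measure ℝ) (π : Measure (ℝ × ℝ)), IsP1 p →
      IsP1 q → IsMart p q π → |∫ z, ck k z.1 z.2 ∂π - ∫ z, c z.1 z.2 ∂π| ≤ ε := by
    intro ε hε
    filter_upwards [Metric.tendstoUniformly_iff.1 hunif ε hε] with k hk p q π hp hq h
    have := h.prob hp
    have hd : ∀ z : ℝ × ℝ, |ck k z.1 z.2 - c z.1 z.2| ≤ ε := fun z => by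
      have := hk z
      rw [dist_comm, Real.dist_eq] at this
      exact this.le
    have i1 : Integrable (fun z : ℝ × ℝ => c z.1 z.2) π := hci hp hq h
    have i2 : Integrable (fun z : ℝ × ℝ => ck k z.1 z.2 - c z.1 z.2) π :=
      Integrable.of_bound ((hck k).sub hc).aestronglyMeasurable ε (ae_of_all _ hd)
    have i3 : Integrable (fun z : ℝ × ℝ => ck k z.1 z.2) π :=
      (i2.add i1).congr (ae_of_all _ fun z => sub_add_cancel _ _)
    rw [← integral_sub i3 i1]
    have := norm_integral_le_of_norm_le_const (μ := π)
      (f := fun z : ℝ × ℝ => ck k z.1 z.2 - c z.1 z.2) (C := ε) (ae_of_all _ hd)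
    simpa using this
  have hpotμ : ∀ z, Tendsto (fun k => pot (μk k) z) atTop (𝓝 (pot μ z)) := fun z => by
    refine Metric.tendsto_nhds.2 fun ε hε => ?_
    filter_upwards [eventually_exists_coupling hμk' hμ' hconvμ (half_pos hε)] with k ⟨θ, h1, h2, h3⟩
    rw [Real.dist_eq]
    linarith [(abs_pot_sub_pot_le (hμk' k) hμ' h1 h2).1 z]
  have hpotν : ∀ z, Tendsto (fun k => pot (νk k) z) atTop (𝓝 (pot ν z)) := fun z => by
    refine Metric.tendsto_nhds.2 fun ε hε => ?_
    filter_upwards [eventually_exists_coupling hνk' hν' hconvν (half_pos hε)] with k ⟨θ, h1, h2, h3⟩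
    rw [Real.dist_eq]
    linarith [(abs_pot_sub_pot_le (hνk' k) hν' h1 h2).1 z]
  have hmean : ∫ y, y ∂μ = ∫ y, y ∂ν := by
    refine eq_of_forall_dist_le fun ε hε => ?_
    obtain ⟨k, ⟨θ, h1, h2, h3⟩, ⟨θ', h1', h2', h3'⟩⟩ :=
      ((eventually_exists_coupling hμk' hμ' hconvμ (half_pos hε)).and
        (eventually_exists_coupling hνk' hν' hconvν (half_pos hε))).exists
    have e1 := abs_le.1 (abs_pot_sub_pot_le (hμk' k) hμ' h1 h2).2
    have e2 := abs_le.1 (abs_pot_sub_pot_le (hνk' k) hν' h1' h2').2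
    have e3 := (horder k).integral_eq
    rw [Real.dist_eq, abs_le]
    constructor <;> linarith
  have hne : {v | ∃ π : Measure (ℝ × ℝ), IsMart μ ν π ∧ v = ∫ z, c z.1 z.2 ∂π}.Nonempty := by
    obtain ⟨π, hπ⟩ := exists_isMart hμ' hν' hmean fun z =>
      le_of_tendsto_of_tendsto' (hpotμ z) (hpotν z) fun k => (horder k).pot_le z
    exact ⟨_, π, hπ, rfl⟩
  have hnek : ∀ k, {v | ∃ π : Measure (ℝ × ℝ), IsMart (μk k) (νk k) π ∧
      v = ∫ z, ck k z.1 z.2 ∂π}.Nonempty := fun k => by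
    obtain ⟨π, hπ⟩ := exists_isMart (hμk' k) (hνk' k) (horder k).integral_eq (horder k).pot_le
    exact ⟨_, π, hπ, rfl⟩
  have hbdd : BddBelow {v | ∃ π : Measure (ℝ × ℝ), IsMart μ ν π ∧ v = ∫ z, c z.1 z.2 ∂π} :=
    ⟨0, by rintro v ⟨π, -, rfl⟩; exact integral_nonneg fun z => hcpos _ _⟩
  have hbddk : ∀ k, BddBelow {v | ∃ π : Measure (ℝ × ℝ), IsMart (μk k) (νk k) π ∧
      v = ∫ z, ck k z.1 z.2 ∂π} := fun k =>
    ⟨0, by rintro v ⟨π, -, rfl⟩; exact integral_nonneg fun z => hckpos _ _ _⟩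
  rw [tendsto_order]
  constructor
  · intro a ha
    by_contra hcon
    let S : Set ℕ := {k | sInf {v | ∃ π : Measure (ℝ × ℝ), IsMart (μk k) (νk k) π ∧
        v = ∫ z, ck k z.1 z.2 ∂π} ≤ a}
    have hfreq : ∃ᶠ k in atTop, k ∈ S := by
      rw [not_eventually] at hcon
      exact hcon.mono fun k hk => not_lt.1 hk
    have hnb : (atTop ⊓ 𝓟 S).NeBot := frequently_mem_iff_neBot.1 hfreq
    obtain ⟨𝒰, h𝒰⟩ : ∃ 𝒰 : Ultrafilter ℕ, (𝒰 : Filter ℕ) ≤ atTop ⊓ 𝓟 S :=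
      ⟨Ultrafilter.of _, Ultrafilter.of_le _⟩
    have h1 : (𝒰 : Filter ℕ) ≤ atTop := h𝒰.trans inf_le_left
    have h2 : S ∈ (𝒰 : Filter ℕ) := le_principal_iff.1 (h𝒰.trans inf_le_right)
    set ε := (sInf {v | ∃ π : Measure (ℝ × ℝ), IsMart μ ν π ∧ v = ∫ z, c z.1 z.2 ∂π} - a) / 3
      with hε
    have hε0 : 0 < ε := by rw [hε]; linarith
    have hex : ∀ k, ∃ π, IsMart (μk k) (νk k) π ∧ ∫ z, ck k z.1 z.2 ∂π <
        sInf {v | ∃ π : Measure (ℝ × ℝ), IsMart (μk k) (νk k) π ∧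
          v = ∫ z, ck k z.1 z.2 ∂π} + ε := fun k => by
      obtain ⟨v, ⟨π, hπ, rfl⟩, hv⟩ := exists_lt_of_csInf_lt (hnek k) (lt_add_of_pos_right _ hε0)
      exact ⟨π, hπ, hv⟩
    choose πk hπk hπk' using hex
    obtain ⟨π, hπ, hlim⟩ := IsMart.exists_limit 𝒰 hμk' hνk' hμ' hν'
      (fun z => (hpotμ z).mono_left h1) (fun z => (hpotν z).mono_left h1) hπk
    have h3 : ∫ z, Function.uncurry c z ∂π ≤ a + 2 * ε := by
      refine le_of_tendsto (hlim _ r hc hcg) ?_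
      filter_upwards [h2, h1 (hunif' ε hε0)] with k hk hk'
      have e1 := (abs_le.1 (hk' _ _ _ (hμk' k) (hνk' k) (hπk k))).1
      have e2 := hπk' k
      change sInf _ ≤ a at hk
      simp only [Function.uncurry]
      linarith
    have h4 := csInf_le hbdd ⟨π, hπ, rfl⟩
    simp only [Function.uncurry] at h3
    linarith
  · intro a ha
    set ε := (a - sInf {v | ∃ π : Measure (ℝ × ℝ), IsMart μ ν π ∧ v = ∫ z, c z.1 z.2 ∂π}) / 4
      with hε
    have hε0 : 0 < ε := by rw [hε]; linarith
    obtain ⟨v, ⟨π, hπ, rfl⟩, hv⟩ := exists_lt_of_csInf_lt hne (lt_add_of_pos_right _ hε0)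
    have := hπ.prob hμ'
    obtain ⟨γ, hγ, hcost⟩ := exists_integral_le_add hc hr hcg (fun z => hcpos _ _)
      (hπ.integrable_fst hμ') (hπ.integrable_snd hν') (by simp) hε0
    obtain ⟨τ, hτ, hnear⟩ := hπ.exists_near hμ' hν' hγ
    filter_upwards [eventually_exists_coupling hμk' hμ' hconvμ hτ,
      eventually_exists_coupling hνk' hν' hconvν hτ, hunif' ε hε0]
      with k ⟨θ, h1, h2, h3⟩ ⟨θ', h1', h2', h3'⟩ hk
    obtain ⟨Q, hQ1, hQ2, hQ3⟩ := hnear (μk k) (νk k) θ (hμk' k) (hνk' k) (horder k).integral_eq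
      (horder k).pot_le h1 h2 h3 fun z => ((abs_pot_sub_pot_le (hνk' k) hν' h1' h2').1 z).trans h3'
    have j1 := (hQ1.integrable_fst (hμk' k)).comp_measurable measurable_fst
    have j2 := (hQ1.integrable_snd (hνk' k)).comp_measurable measurable_fst
    have hπi1 := hπ.integrable_fst hμ'
    have hπi2 := hπ.integrable_snd hν'
    rw [← hQ2] at hπi1 hπi2
    have j3 := hπi1.comp_measurable measurable_snd
    have j4 := hπi2.comp_measurable measurable_snd
    have h4 := hcost Q hQ2 ((j1.sub j3).abs.add (j2.sub j4).abs) hQ3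
    have h5 := (abs_le.1 (hk _ _ _ (hμk' k) (hνk' k) hQ1)).2
    have h6 := csInf_le (hbddk k) ⟨_, hQ1, rfl⟩
    simp only [Function.uncurry] at h4
    linarith
end
end
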